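/- arXiv:math/0505105 — 4 statements merged into one kernel-verified Lean document; each statement's English description precedes it below -/
import Mathlib

section
/- In the abstract ordered measure-space setting, S is bounded from L^p_≺(ν) to L^p(ν), i.e., there exists C > 0 with ∫_X (Sf)^p dν ≤ C ∫_X f^p dν for every nonnegative ≺-decreasing measurable f, if and only if there exists C > 0 such that for every ≺-decreasing set D ⊆ X, ∫_{X∖D} μ_x(D ∩ X_x)^p dν(x) ≤ C ν(D). -/
open MeasureTheory Set
open scoped ENNReal NNReal

/-- The abstract Hardy operator `Sf(x) = ∫_{X_x} f dμ_x`, where `X_x = {u | u ≤ x}`. -/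
noncomputable def hardyOp {X : Type*} [MeasurableSpace X] [PartialOrder X]
    (μ : X → Measure X) (f : X → ℝ≥0) (x : X) : ℝ≥0∞ :=
  ∫⁻ u in {u : X | u ≤ x}, (f u : ℝ≥0∞) ∂(μ x)

/-- The dyadic sum `∑ 2 ^ k` over the integers `k` with `2 ^ k < a` is at most `2 * a`. -/
lemma tsum_zpow_indicator_le (a : ℝ≥0∞) :
    ∑' k : ℤ, (2 : ℝ≥0∞) ^ k * (Ioi ((2 : ℝ≥0∞) ^ k)).indicator 1 a ≤ 2 * a := by
  rcases eq_or_ne a 0 with rfl | h0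
  · simp
  rcases eq_or_ne a ∞ with rfl | htop
  · simp
  obtain ⟨m, hm, hm'⟩ := ENNReal.exists_mem_Ioc_zpow h0 htop (y := 2) (by norm_num) (by norm_num)
  have hinj : Function.Injective (fun j : ℕ => m - (j : ℤ)) := fun i j h => by
    simpa using h
  rw [← hinj.tsum_eq]
  · calc ∑' j : ℕ, (2 : ℝ≥0∞) ^ (m - (j : ℤ)) * (Ioi ((2 : ℝ≥0∞) ^ (m - (j : ℤ)))).indicator 1 a
        ≤ ∑' j : ℕ, (2 : ℝ≥0∞) ^ m * (2⁻¹ : ℝ≥0∞) ^ j := by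
          refine ENNReal.tsum_le_tsum fun j => ?_
          calc (2 : ℝ≥0∞) ^ (m - (j : ℤ)) * (Ioi ((2 : ℝ≥0∞) ^ (m - (j : ℤ)))).indicator 1 a
              ≤ (2 : ℝ≥0∞) ^ (m - (j : ℤ)) * 1 := by
                gcongr
                exact indicator_le_self' (by simp) a
            _ = (2 : ℝ≥0∞) ^ m * (2⁻¹ : ℝ≥0∞) ^ j := by
                rw [mul_one, sub_eq_add_neg, ENNReal.zpow_add (by norm_num) (by norm_num),
                  ENNReal.zpow_neg, zpow_natCast, ENNReal.inv_pow]
      _ = (2 : ℝ≥0∞) ^ m * 2 := by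
          rw [ENNReal.tsum_mul_left, ENNReal.tsum_geometric, ENNReal.one_sub_inv_two, inv_inv]
      _ ≤ 2 * a := by rw [mul_comm]; gcongr
  · intro k hk
    have hka : (2 : ℝ≥0∞) ^ k < a := by
      by_contra h
      exact hk (by simp [indicator, h])
    have hkm : k ≤ m := by
      by_contra! h
      have : (2 : ℝ≥0∞) ^ (m + 1) ≤ 2 ^ k := ENNReal.zpow_le_of_le (by norm_num) h
      exact absurd (hka.trans_le hm') (not_lt.2 this)
    exact ⟨(m - k).toNat, by simp; omega⟩

/-- A finite value is at most twice the dyadic sum `∑ 2 ^ k` over the `k` with `2 ^ k < a`. -/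
lemma le_two_mul_tsum_zpow_indicator {a : ℝ≥0∞} (ha : a ≠ ∞) :
    a ≤ 2 * ∑' k : ℤ, (2 : ℝ≥0∞) ^ k * (Ioi ((2 : ℝ≥0∞) ^ k)).indicator 1 a := by
  rcases eq_or_ne a 0 with rfl | h0
  · simp
  obtain ⟨m, hm, hm'⟩ := ENNReal.exists_mem_Ioc_zpow h0 ha (y := 2) (by norm_num) (by norm_num)
  calc a ≤ 2 ^ (m + 1) := hm'
    _ = 2 * ((2 : ℝ≥0∞) ^ m * (Ioi ((2 : ℝ≥0∞) ^ m)).indicator 1 a) := by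
        rw [ENNReal.zpow_add (by norm_num) (by norm_num), zpow_one, mul_comm,
          indicator_of_mem (mem_Ioi.2 hm)]
        simp
    _ ≤ _ := by
        gcongr
        exact ENNReal.le_tsum (f := fun k : ℤ =>
          (2 : ℝ≥0∞) ^ k * (Ioi ((2 : ℝ≥0∞) ^ k)).indicator 1 a) m

lemma le_tsum_rpow_indicator {p : ℝ} (hp : 0 < p) {a : ℝ≥0∞} (ha : a ≠ ∞) :
    a ≤ ∑' k : ℤ, (2 * (2 : ℝ≥0∞) ^ k) ^ p⁻¹ *
      (Ioi ((2 : ℝ≥0∞) ^ k)).indicator 1 (a ^ p) := by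
  rcases eq_or_ne a 0 with rfl | h0
  · simp
  obtain ⟨m, hm, hm'⟩ := ENNReal.exists_mem_Ioc_zpow (x := a ^ p) (y := 2)
    (by simp [h0, ha]) (by simp [ha, hp.le]) (by norm_num) (by norm_num)
  calc a = (a ^ p) ^ p⁻¹ := by rw [ENNReal.rpow_rpow_inv hp.ne']
    _ ≤ (2 * (2 : ℝ≥0∞) ^ m) ^ p⁻¹ := by
        rw [ENNReal.zpow_add (by norm_num) (by norm_num), zpow_one, mul_comm] at hm'
        gcongr
    _ = (2 * (2 : ℝ≥0∞) ^ m) ^ p⁻¹ * (Ioi ((2 : ℝ≥0∞) ^ m)).indicator 1 (a ^ p) := by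
        rw [indicator_of_mem (mem_Ioi.2 hm)]
        simp
    _ ≤ _ := ENNReal.le_tsum (f := fun k : ℤ => (2 * (2 : ℝ≥0∞) ^ k) ^ p⁻¹ *
          (Ioi ((2 : ℝ≥0∞) ^ k)).indicator 1 (a ^ p)) m

lemma ENNReal.tsum_rpow_le {ι : Type*} (a : ι → ℝ≥0∞) {p : ℝ} (hp : 0 < p) (hp1 : p ≤ 1) :
    (∑' i, a i) ^ p ≤ ∑' i, a i ^ p := by
  have h : Filter.Tendsto (fun s : Finset ι => (∑ i ∈ s, a i) ^ p) Filter.atTop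
      (nhds ((∑' i, a i) ^ p)) :=
    ((ENNReal.continuous_rpow_const (y := p)).tendsto _).comp ENNReal.summable.hasSum
  refine le_of_tendsto' h fun s => le_trans ?_ (ENNReal.sum_le_tsum s)
  classical
  induction s using Finset.induction_on with
  | empty => simp [hp]
  | insert i s hi ih =>
    rw [Finset.sum_insert hi, Finset.sum_insert hi]
    exact (ENNReal.rpow_add_le_add_rpow _ _ hp.le hp1).trans (by gcongr)

/-- For a finite measure `Q` and a function `g`, at least half of the mass of `Q`
is carried by points `u` for which `{g ≥ g u}` has at least half of the mass. -/
lemma half_le_measure_half_le {X : Type*} [MeasurableSpace X] (Q : Measure X)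
    [IsFiniteMeasure Q] (g : X → ℝ≥0∞) :
    Q univ / 2 ≤ Q {u | Q univ / 2 ≤ Q {v | g u ≤ g v}} := by
  set A := Q univ with hA
  set B : Set ℝ≥0∞ := {r | Q {v | r ≤ g v} < A / 2} with hB
  have hQB : Q (g ⁻¹' B) ≤ A / 2 := by
    rcases B.eq_empty_or_nonempty with h | h
    · simp [h]
    by_cases hmem : sInf B ∈ B
    · refine (measure_mono fun v (hv : g v ∈ B) => ?_).trans (le_of_lt hmem)
      exact sInf_le hv
    obtain ⟨r, hr, -, hlim, hrB⟩ := (isGLB_sInf B).exists_seq_antitone_tendsto h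
    calc Q (g ⁻¹' B) ≤ Q (⋃ n, {v | r n ≤ g v}) := by
          refine measure_mono fun v hv => mem_iUnion.2 ?_
          have hlt : sInf B < g v :=
            lt_of_le_of_ne (sInf_le hv) fun h => hmem (h ▸ hv)
          obtain ⟨n, hn⟩ := (hlim.eventually (gt_mem_nhds hlt)).exists
          exact ⟨n, hn.le⟩
      _ = ⨆ n, Q {v | r n ≤ g v} :=
          Monotone.measure_iUnion fun i j hij v hv => (hr hij).trans hv
      _ ≤ A / 2 := iSup_le fun n => le_of_lt (hrB n)
  have hcover : A ≤ A / 2 + Q {u | A / 2 ≤ Q {v | g u ≤ g v}} := by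
    calc A ≤ Q (g ⁻¹' B ∪ {u | A / 2 ≤ Q {v | g u ≤ g v}}) := by
          refine measure_mono fun u _ => ?_
          rcases lt_or_ge (Q {v | g u ≤ g v}) (A / 2) with h | h
          · exact Or.inl h
          · exact Or.inr h
      _ ≤ _ := (measure_union_le _ _).trans (by gcongr)
  have hfin : A / 2 ≠ ∞ := (ENNReal.div_lt_top (measure_ne_top _ _) (by norm_num)).ne
  rwa [← ENNReal.add_le_add_iff_left hfin, ENNReal.add_halves]

/-- The dyadic form of the layer-cake lower bound for `μ {g > s} ^ p`. -/
lemma lintegral_mul_rpow_le_tsum {X : Type*} [MeasurableSpace X] (P : Measure X)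
    {g : X → ℝ≥0∞} (hg : Measurable g) (hgtop : ∀ u, g u ≠ ∞) {p : ℝ} (hp : 1 ≤ p) :
    ∫⁻ u, g u * P {v | g u ≤ g v} ^ (p - 1) ∂P ≤
      2 * ∑' k : ℤ, (2 : ℝ≥0∞) ^ k * P {u | 2 ^ k < g u} ^ p := by
  have hw : Measurable fun u => P {v | g u ≤ g v} ^ (p - 1) := by
    have : Antitone fun r : ℝ≥0∞ => P {v | r ≤ g v} :=
      fun r s hrs => measure_mono fun v hv => le_trans hrs hv
    exact (this.measurable.comp hg).pow_const _
  have hD : ∀ k : ℤ, MeasurableSet {u | (2 : ℝ≥0∞) ^ k < g u} :=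
    fun k => measurableSet_lt measurable_const hg
  have hterm : ∀ k : ℤ, ∫⁻ u in {u | (2 : ℝ≥0∞) ^ k < g u}, P {v | g u ≤ g v} ^ (p - 1) ∂P ≤
      P {u | (2 : ℝ≥0∞) ^ k < g u} ^ p := fun k => by
    calc _ ≤ ∫⁻ _ in {u | (2 : ℝ≥0∞) ^ k < g u}, P {u | (2 : ℝ≥0∞) ^ k < g u} ^ (p - 1) ∂P := by
          refine setLIntegral_mono measurable_const fun u hu => ?_
          refine ENNReal.rpow_le_rpow (measure_mono fun v hv => ?_) (by linarith)
          exact lt_of_lt_of_le (mem_ofPred.1 hu) (mem_ofPred.1 hv)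
      _ = P {u | (2 : ℝ≥0∞) ^ k < g u} ^ p := by
          rw [setLIntegral_const]
          nth_rw 2 [← ENNReal.rpow_one (P {u | (2 : ℝ≥0∞) ^ k < g u})]
          rw [← ENNReal.rpow_add_of_nonneg _ _ (by linarith) zero_le_one, sub_add_cancel]
  calc ∫⁻ u, g u * P {v | g u ≤ g v} ^ (p - 1) ∂P
      ≤ ∫⁻ u, 2 * ∑' k : ℤ, (2 : ℝ≥0∞) ^ k *
          {u | (2 : ℝ≥0∞) ^ k < g u}.indicator (fun u => P {v | g u ≤ g v} ^ (p - 1)) u ∂P := by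
        refine lintegral_mono fun u => ?_
        refine (mul_le_mul_left (le_two_mul_tsum_zpow_indicator (hgtop u)) _).trans ?_
        rw [mul_assoc, ← ENNReal.tsum_mul_right]
        refine mul_le_mul_right (ENNReal.tsum_le_tsum fun k => ?_) _
        rw [mul_assoc]
        refine mul_le_mul_right ?_ _
        by_cases h : (2 : ℝ≥0∞) ^ k < g u <;> simp [indicator, h]
    _ = 2 * ∑' k : ℤ, (2 : ℝ≥0∞) ^ k *
          ∫⁻ u in {u | (2 : ℝ≥0∞) ^ k < g u}, P {v | g u ≤ g v} ^ (p - 1) ∂P := by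
        rw [lintegral_const_mul' _ _ (by norm_num), lintegral_tsum fun k =>
          ((hw.indicator (hD k)).const_mul _).aemeasurable]
        congr 2 with k
        rw [lintegral_const_mul _ (hw.indicator (hD k)), lintegral_indicator (hD k)]
    _ ≤ _ := by gcongr with k; exact hterm k

section Hardy

variable {X : Type*} [MeasurableSpace X] [PartialOrder X] {μ : X → Measure X}

lemma le_hardyOp (hlowmeas : ∀ D : Set X, IsLowerSet D → MeasurableSet D)
    (hone : ∀ x : X, μ x {u : X | u ≤ x} = 1) {f : X → ℝ≥0} (hf : Antitone f) (u : X) :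
    (f u : ℝ≥0∞) ≤ hardyOp μ f u := by
  calc (f u : ℝ≥0∞) = ∫⁻ _ in {y : X | y ≤ u}, (f u : ℝ≥0∞) ∂(μ u) := by simp [hone]
    _ ≤ _ := setLIntegral_mono' (hlowmeas _ (isLowerSet_Iic u)) fun y hy => by
        exact_mod_cast hf hy

/-- The mean of a decreasing function over a lower set containing `u` is at most its mean over
the initial segment of `u`. -/
lemma setLIntegral_le_hardyOp_mul (hlowmeas : ∀ D : Set X, IsLowerSet D → MeasurableSet D)
    (htot : ∀ x u v : X, u ≤ x → v ≤ x → u ≤ v ∨ v ≤ u)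
    (hone : ∀ x : X, μ x {u : X | u ≤ x} = 1)
    (hcons : ∀ x u : X, u ≤ x → ∀ E : Set X, MeasurableSet E → E ⊆ {y : X | y ≤ u} →
      μ x E = μ x {y : X | y ≤ u} * μ u E)
    {f : X → ℝ≥0} (hf : Antitone f) {x u : X} (hux : u ≤ x) {E : Set X} (hE : IsLowerSet E)
    (hu : u ∈ E) :
    ∫⁻ v in E, (f v : ℝ≥0∞) ∂((μ x).restrict {u | u ≤ x}) ≤
      hardyOp μ f u * (μ x).restrict {u | u ≤ x} E := by
  have hX : ∀ y : X, MeasurableSet {v : X | v ≤ y} := fun y => hlowmeas _ (isLowerSet_Iic y)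
  have hEm := hlowmeas E hE
  have hsub : {v : X | v ≤ u} ⊆ E ∩ {v | v ≤ x} := fun v hv => ⟨hE hv hu, le_trans hv hux⟩
  have hrestr : (μ x).restrict {v | v ≤ u} =
      μ x {v : X | v ≤ u} • (μ u).restrict {v | v ≤ u} := by
    ext s hs
    rw [Measure.smul_apply, Measure.restrict_apply hs, Measure.restrict_apply hs, smul_eq_mul]
    exact hcons x u hux _ (hs.inter (hX u)) inter_subset_right
  rw [Measure.restrict_restrict hEm, Measure.restrict_apply hEm]
  calc ∫⁻ v in E ∩ {v | v ≤ x}, (f v : ℝ≥0∞) ∂(μ x)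
      = ∫⁻ v in {v | v ≤ u}, (f v : ℝ≥0∞) ∂(μ x) +
          ∫⁻ v in (E ∩ {v | v ≤ x}) \ {v | v ≤ u}, (f v : ℝ≥0∞) ∂(μ x) := by
        rw [← lintegral_inter_add_sdiff _ (E ∩ {v | v ≤ x}) (hX u),
          inter_eq_right.2 hsub]
    _ ≤ hardyOp μ f u * μ x {v | v ≤ u} +
          hardyOp μ f u * μ x ((E ∩ {v | v ≤ x}) \ {v | v ≤ u}) := by
        refine add_le_add ?_ ?_
        · rw [hrestr, lintegral_smul_measure, smul_eq_mul, mul_comm]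
          rfl
        · rw [← setLIntegral_const]
          refine setLIntegral_mono' ((hEm.inter (hX x)).diff (hX u)) fun v hv => ?_
          refine le_trans ?_ (le_hardyOp hlowmeas hone hf u)
          have : u ≤ v := (htot x u v hux hv.1.2).resolve_right hv.2
          exact_mod_cast hf this
    _ = hardyOp μ f u * μ x (E ∩ {v | v ≤ x}) := by
        rw [← mul_add, ← measure_inter_add_sdiff (E ∩ {v | v ≤ x}) (hX u), inter_eq_right.2 hsub]

/-- Pointwise control of `(Sf) ^ p` by the level sets of `f * (Sf) ^ (p - 1)`. -/
lemma hardyOp_rpow_le_tsum (hlowmeas : ∀ D : Set X, IsLowerSet D → MeasurableSet D)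
    (htot : ∀ x u v : X, u ≤ x → v ≤ x → u ≤ v ∨ v ≤ u)
    (hone : ∀ x : X, μ x {u : X | u ≤ x} = 1)
    (hcons : ∀ x u : X, u ≤ x → ∀ E : Set X, MeasurableSet E → E ⊆ {y : X | y ≤ u} →
      μ x E = μ x {y : X | y ≤ u} * μ u E)
    {p : ℝ} (hp : 1 ≤ p) {f : X → ℝ≥0} (hfm : Measurable f) (hf : Antitone f)
    (hSm : Measurable (hardyOp μ f)) (hSf : Antitone (hardyOp μ f))
    (hfin : ∀ x, hardyOp μ f x ≠ ∞) (x : X) :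
    hardyOp μ f x ^ p ≤ 2 ^ (p + 1) * ∑' k : ℤ, (2 : ℝ≥0∞) ^ k *
      (μ x).restrict {u | u ≤ x} {u | 2 ^ k < f u * hardyOp μ f u ^ (p - 1)} ^ p := by
  set P := (μ x).restrict {u : X | u ≤ x} with hP
  set g : X → ℝ≥0∞ := fun u => f u * hardyOp μ f u ^ (p - 1) with hgdef
  have hp1 : 0 ≤ p - 1 := by linarith
  have hfm' : Measurable fun u => (f u : ℝ≥0∞) := hfm.coe_nnreal_ennreal
  have hgm : Measurable g := hfm'.mul (hSm.pow_const _)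
  have hg : Antitone g := fun u v huv =>
    mul_le_mul' (by exact_mod_cast hf huv) (ENNReal.rpow_le_rpow (hSf huv) hp1)
  have hgtop : ∀ u, g u ≠ ∞ := fun u =>
    ENNReal.mul_ne_top ENNReal.coe_ne_top (ENNReal.rpow_ne_top_of_nonneg hp1 (hfin u))
  have hlow : ∀ r, IsLowerSet {v | r ≤ g v} := fun r a b hba ha => le_trans ha (hg hba)
  set Q := P.withDensity fun u => (f u : ℝ≥0∞) with hQ
  have hQuniv : Q univ = hardyOp μ f x := by
    rw [hQ, withDensity_apply _ MeasurableSet.univ, Measure.restrict_univ]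
    rfl
  have : IsFiniteMeasure Q := ⟨by rw [hQuniv]; exact (hfin x).lt_top⟩
  set A := hardyOp μ f x with hA
  have hQm : Measurable fun u => Q {v | g u ≤ g v} ^ (p - 1) := by
    have : Antitone fun r : ℝ≥0∞ => Q {v | r ≤ g v} :=
      fun r s hrs => measure_mono fun v hv => le_trans hrs hv
    exact (this.measurable.comp hgm).pow_const _
  have key : (A / 2) ^ p ≤ ∫⁻ u, g u * P {v | g u ≤ g v} ^ (p - 1) ∂P := by
    calc (A / 2) ^ p = (A / 2) ^ (p - 1) * (A / 2) := by
          nth_rw 3 [← ENNReal.rpow_one (A / 2)]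
          rw [← ENNReal.rpow_add_of_nonneg _ _ hp1 zero_le_one, sub_add_cancel]
      _ ≤ (A / 2) ^ (p - 1) * Q {u | A / 2 ≤ Q {v | g u ≤ g v}} := by
          gcongr
          simpa only [hQuniv] using half_le_measure_half_le Q g
      _ ≤ (A / 2) ^ (p - 1) * Q {u | (A / 2) ^ (p - 1) ≤ Q {v | g u ≤ g v} ^ (p - 1)} := by
          gcongr _ * Q ?_
          exact fun u hu => ENNReal.rpow_le_rpow hu hp1
      _ ≤ ∫⁻ u, Q {v | g u ≤ g v} ^ (p - 1) ∂Q := mul_meas_ge_le_lintegral hQm _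
      _ = ∫⁻ u, f u * Q {v | g u ≤ g v} ^ (p - 1) ∂P :=
          lintegral_withDensity_eq_lintegral_mul _ hfm' hQm
      _ ≤ ∫⁻ u, g u * P {v | g u ≤ g v} ^ (p - 1) ∂P := by
          refine setLIntegral_mono' (hlowmeas _ (isLowerSet_Iic x)) fun u hu => ?_
          rw [hgdef, mul_assoc, ← ENNReal.mul_rpow_of_nonneg _ _ hp1]
          refine mul_le_mul_right (ENNReal.rpow_le_rpow ?_ hp1) _
          rw [hQ, withDensity_apply _ (hlowmeas _ (hlow _))]
          exact setLIntegral_le_hardyOp_mul hlowmeas htot hone hcons hf hu (hlow (g u))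
            (mem_ofPred.2 le_rfl)
  have h2 : A ^ p = 2 ^ p * (A / 2) ^ p := by
    rw [← ENNReal.mul_rpow_of_nonneg _ _ (by linarith),
      ENNReal.mul_div_cancel (by norm_num) (by norm_num)]
  rw [h2, ENNReal.rpow_add _ _ (by norm_num) (by norm_num), ENNReal.rpow_one, mul_assoc]
  gcongr
  exact key.trans (lintegral_mul_rpow_le_tsum P hgm hgtop hp)

lemma hardyOp_rpow_le_tsum_of_le_one (hlowmeas : ∀ D : Set X, IsLowerSet D → MeasurableSet D)
    {p : ℝ} (hp : 0 < p) (hp1 : p ≤ 1) {f : X → ℝ≥0} (hf : Antitone f) (x : X) :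
    hardyOp μ f x ^ p ≤ 2 * ∑' k : ℤ, (2 : ℝ≥0∞) ^ k *
      (μ x).restrict {u | u ≤ x} {u | 2 ^ k < (f u : ℝ≥0∞) ^ p} ^ p := by
  have hD : ∀ k : ℤ, MeasurableSet {u | (2 : ℝ≥0∞) ^ k < (f u : ℝ≥0∞) ^ p} := fun k =>
    hlowmeas _ fun a b hba ha => lt_of_lt_of_le ha
      (ENNReal.rpow_le_rpow (by exact_mod_cast hf hba) hp.le)
  set P := (μ x).restrict {u : X | u ≤ x} with hP
  have hle : hardyOp μ f x ≤ ∑' k : ℤ, (2 * (2 : ℝ≥0∞) ^ k) ^ p⁻¹ *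
      P {u | 2 ^ k < (f u : ℝ≥0∞) ^ p} := by
    calc hardyOp μ f x ≤ ∫⁻ u, ∑' k : ℤ, (2 * (2 : ℝ≥0∞) ^ k) ^ p⁻¹ *
          {u | (2 : ℝ≥0∞) ^ k < (f u : ℝ≥0∞) ^ p}.indicator 1 u ∂P :=
          lintegral_mono fun u => le_tsum_rpow_indicator hp ENNReal.coe_ne_top
      _ = _ := by
          rw [lintegral_tsum fun k =>
            ((measurable_one.indicator (hD k)).const_mul _).aemeasurable]
          congr 1 with k
          rw [lintegral_const_mul _ (measurable_one.indicator (hD k)),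
            lintegral_indicator_one (hD k)]
  calc _ ≤ _ := ENNReal.rpow_le_rpow hle hp.le
    _ ≤ _ := ENNReal.tsum_rpow_le _ hp hp1
    _ = _ := by
        rw [← ENNReal.tsum_mul_left]
        congr 1 with k
        rw [ENNReal.mul_rpow_of_nonneg _ _ hp.le, ENNReal.rpow_inv_rpow hp.ne', mul_assoc]

variable {prec : X → X → Prop} {ν : Measure X} {p : ℝ}

/-- Summing the estimate for decreasing sets over the dyadic level sets of a decreasing
function. -/
lemma lintegral_tsum_level_le (hlowmeas : ∀ D : Set X, IsLowerSet D → MeasurableSet D)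
    (hle : ∀ x y : X, x ≤ y → prec x y)
    (hμmeas : ∀ D : Set X, (∀ x y, prec x y → y ∈ D → x ∈ D) →
      Measurable (fun x : X => (μ x).restrict {u : X | u ≤ x} D))
    {C : ℝ≥0∞} (hC : ∀ D : Set X, (∀ x y, prec x y → y ∈ D → x ∈ D) →
      ∫⁻ x, ((μ x).restrict {u : X | u ≤ x} D) ^ p ∂ν ≤ C * ν D)
    {g : X → ℝ≥0∞} (hg : ∀ x y, prec x y → g y ≤ g x) :
    ∫⁻ x, ∑' k : ℤ, (2 : ℝ≥0∞) ^ k * (μ x).restrict {u | u ≤ x} {u | 2 ^ k < g u} ^ p ∂ν ≤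
      2 * C * ∫⁻ x, g x ∂ν := by
  have hdec : ∀ k : ℤ, ∀ x y, prec x y → y ∈ {u | (2 : ℝ≥0∞) ^ k < g u} →
      x ∈ {u | (2 : ℝ≥0∞) ^ k < g u} := fun k x y hxy hy => lt_of_lt_of_le hy (hg x y hxy)
  have hD : ∀ k : ℤ, MeasurableSet {u | (2 : ℝ≥0∞) ^ k < g u} := fun k =>
    hlowmeas _ fun a b hba ha => hdec k b a (hle b a hba) ha
  calc _ = ∑' k : ℤ, (2 : ℝ≥0∞) ^ k *
        ∫⁻ x, (μ x).restrict {u | u ≤ x} {u | 2 ^ k < g u} ^ p ∂ν := by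
        rw [lintegral_tsum fun k =>
          (((hμmeas _ (hdec k)).pow_const p).const_mul _).aemeasurable]
        congr 1 with k
        rw [lintegral_const_mul _ ((hμmeas _ (hdec k)).pow_const p)]
    _ ≤ ∑' k : ℤ, (2 : ℝ≥0∞) ^ k * (C * ν {u | 2 ^ k < g u}) := by
        gcongr with k
        exact hC _ (hdec k)
    _ = C * ∫⁻ x, ∑' k : ℤ, (2 : ℝ≥0∞) ^ k * {u | (2 : ℝ≥0∞) ^ k < g u}.indicator 1 x ∂ν := by
        rw [lintegral_tsum fun k =>
            ((measurable_one.indicator (hD k)).const_mul _).aemeasurable, ← ENNReal.tsum_mul_left]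
        congr 1 with k
        rw [lintegral_const_mul _ (measurable_one.indicator (hD k)),
            lintegral_indicator_one (hD k), mul_left_comm]
    _ ≤ C * ∫⁻ x, 2 * g x ∂ν := by
        gcongr with x
        exact tsum_zpow_indicator_le (g x)
    _ = 2 * C * ∫⁻ x, g x ∂ν := by
        rw [lintegral_const_mul' _ _ (by norm_num)]
        ring

end Hardy

lemma ENNReal.mul_rpow_sub_one_le {p : ℝ} (hp : 1 ≤ p) {M : ℝ≥0∞} (hM0 : M ≠ 0) (hM : M ≠ ∞)
    (a b : ℝ≥0∞) : a * b ^ (p - 1) ≤ M⁻¹ * b ^ p + M ^ (p - 1) * a ^ p := by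
  have hp1 : 0 ≤ p - 1 := by linarith
  have hpow : ∀ c : ℝ≥0∞, c ^ p = c * c ^ (p - 1) := fun c => by
    nth_rw 2 [← ENNReal.rpow_one c]
    rw [← ENNReal.rpow_add_of_nonneg _ _ zero_le_one hp1, add_sub_cancel]
  rcases le_total b (M * a) with h | h
  · refine le_add_left ?_
    calc a * b ^ (p - 1) ≤ a * (M * a) ^ (p - 1) := by gcongr
      _ = M ^ (p - 1) * a ^ p := by
          rw [ENNReal.mul_rpow_of_nonneg _ _ hp1, hpow a]
          ring
  · refine le_add_right ?_
    have ha : a ≤ M⁻¹ * b := by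
      rwa [mul_comm, ← div_eq_mul_inv, ENNReal.le_div_iff_mul_le (.inl hM0) (.inl hM), mul_comm]
    calc a * b ^ (p - 1) ≤ M⁻¹ * b * b ^ (p - 1) := by gcongr
      _ = M⁻¹ * b ^ p := by rw [hpow b, mul_assoc]

section Boundedness

variable {X : Type*} [MeasurableSpace X] [PartialOrder X] {μ : X → Measure X}
  {prec : X → X → Prop} {ν : Measure X} {p : ℝ}

/-- The a priori estimate: the bound holds for bounded functions with `∫ (Sf) ^ p < ∞`. -/
lemma lintegral_hardyOp_rpow_le_of_ne_top
    (hlowmeas : ∀ D : Set X, IsLowerSet D → MeasurableSet D)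
    (htot : ∀ x u v : X, u ≤ x → v ≤ x → u ≤ v ∨ v ≤ u)
    (hone : ∀ x : X, μ x {u : X | u ≤ x} = 1)
    (hcons : ∀ x u : X, u ≤ x → ∀ E : Set X, MeasurableSet E → E ⊆ {y : X | y ≤ u} →
      μ x E = μ x {y : X | y ≤ u} * μ u E)
    (hle : ∀ x y : X, x ≤ y → prec x y)
    (hμmeas : ∀ D : Set X, (∀ x y, prec x y → y ∈ D → x ∈ D) →
      Measurable (fun x : X => (μ x).restrict {u : X | u ≤ x} D))
    {C : ℝ≥0∞} (hC0 : C ≠ 0) (hCtop : C ≠ ∞)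
    (hC : ∀ D : Set X, (∀ x y, prec x y → y ∈ D → x ∈ D) →
      ∫⁻ x, ((μ x).restrict {u : X | u ≤ x} D) ^ p ∂ν ≤ C * ν D)
    (hp : 1 ≤ p) {f : X → ℝ≥0} (hfm : Measurable f) (hf : ∀ x y, prec x y → f y ≤ f x)
    (hSm : Measurable (hardyOp μ f))
    (hSf : ∀ x y, prec x y → hardyOp μ f y ≤ hardyOp μ f x)
    (hfin : ∀ x, hardyOp μ f x ≠ ∞) (hT : ∫⁻ x, hardyOp μ f x ^ p ∂ν ≠ ∞) :
    ∫⁻ x, hardyOp μ f x ^ p ∂ν ≤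
      (2 * (2 ^ (p + 1) * (2 * C))) ^ p * ∫⁻ x, (f x : ℝ≥0∞) ^ p ∂ν := by
  have hp1 : 0 ≤ p - 1 := by linarith
  set T := ∫⁻ x, hardyOp μ f x ^ p ∂ν
  set F := ∫⁻ x, (f x : ℝ≥0∞) ^ p ∂ν
  set K : ℝ≥0∞ := 2 ^ (p + 1) * (2 * C) with hK
  have h2p0 : (2 : ℝ≥0∞) ^ (p + 1) ≠ 0 := by simp
  have h2p : (2 : ℝ≥0∞) ^ (p + 1) ≠ ∞ := ENNReal.rpow_ne_top_of_nonneg (by linarith) (by norm_num)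
  have hK0 : K ≠ 0 := mul_ne_zero h2p0 (mul_ne_zero (by norm_num) hC0)
  have hKtop : K ≠ ∞ := ENNReal.mul_ne_top h2p (ENNReal.mul_ne_top (by norm_num) hCtop)
  have h2K0 : 2 * K ≠ 0 := mul_ne_zero (by norm_num) hK0
  have h2Ktop : 2 * K ≠ ∞ := ENNReal.mul_ne_top (by norm_num) hKtop
  have hKinv : K * (2 * K)⁻¹ = 2⁻¹ := by
    rw [ENNReal.mul_inv (a := 2) (b := K) (.inl (by norm_num)) (.inl (by norm_num)),
      mul_left_comm, ENNReal.mul_inv_cancel hK0 hKtop, mul_one]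
  have hfm' : Measurable fun u => (f u : ℝ≥0∞) := hfm.coe_nnreal_ennreal
  have habs : T ≤ T / 2 + K * (2 * K) ^ (p - 1) * F := by
    calc T ≤ ∫⁻ x, 2 ^ (p + 1) * ∑' k : ℤ, (2 : ℝ≥0∞) ^ k * (μ x).restrict {u | u ≤ x}
          {u | 2 ^ k < f u * hardyOp μ f u ^ (p - 1)} ^ p ∂ν :=
          lintegral_mono fun x => hardyOp_rpow_le_tsum hlowmeas htot hone hcons hp hfm
            (fun a b hab => hf a b (hle a b hab)) hSm (fun a b hab => hSf a b (hle a b hab))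
            hfin x
      _ ≤ K * ∫⁻ x, f x * hardyOp μ f x ^ (p - 1) ∂ν := by
          rw [lintegral_const_mul' _ _ h2p, hK, mul_assoc]
          gcongr
          exact lintegral_tsum_level_le hlowmeas hle hμmeas hC fun x y hxy =>
            mul_le_mul' (by exact_mod_cast hf x y hxy)
              (ENNReal.rpow_le_rpow (hSf x y hxy) hp1)
      _ ≤ K * ∫⁻ x, ((2 * K)⁻¹ * hardyOp μ f x ^ p + (2 * K) ^ (p - 1) * (f x : ℝ≥0∞) ^ p) ∂ν := by
          gcongr with x
          exact ENNReal.mul_rpow_sub_one_le hp h2K0 h2Ktop _ _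
      _ = K * ((2 * K)⁻¹ * T + (2 * K) ^ (p - 1) * F) := by
          rw [lintegral_add_left ((hSm.pow_const p).const_mul _),
            lintegral_const_mul _ (hSm.pow_const p), lintegral_const_mul _ (hfm'.pow_const p)]
      _ = T / 2 + K * (2 * K) ^ (p - 1) * F := by
          rw [mul_add, ← mul_assoc K _ T, ← mul_assoc K _ F, hKinv, mul_comm, div_eq_mul_inv]
  have hhalf : T / 2 ≠ ∞ := (ENNReal.div_lt_top hT (by norm_num)).ne
  have hle' : T / 2 ≤ K * (2 * K) ^ (p - 1) * F := by
    rw [← ENNReal.add_le_add_iff_left hhalf, ENNReal.add_halves]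
    exact habs
  calc T = 2 * (T / 2) := (ENNReal.mul_div_cancel (by norm_num) (by norm_num)).symm
    _ ≤ 2 * (K * (2 * K) ^ (p - 1) * F) := by gcongr
    _ = (2 * K) ^ (1 : ℝ) * (2 * K) ^ (p - 1) * F := by
        rw [ENNReal.rpow_one]
        ring
    _ = (2 * K) ^ p * F := by
        rw [← ENNReal.rpow_add_of_nonneg _ _ zero_le_one hp1, add_sub_cancel]

/-- For a bounded function supported in a decreasing set of finite measure, `∫ (Sf) ^ p < ∞`. -/
lemma lintegral_hardyOp_rpow_ne_top (hp : 0 < p)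
    {C : ℝ≥0∞} (hCtop : C ≠ ∞) {D : Set X} (hDm : MeasurableSet D)
    (hC : ∫⁻ x, ((μ x).restrict {u : X | u ≤ x} D) ^ p ∂ν ≤ C * ν D)
    (hν : ν D ≠ ∞) {f : X → ℝ≥0} {n : ℝ≥0} (hfn : ∀ x, f x ≤ n) (hfD : ∀ x ∉ D, f x = 0) :
    ∫⁻ x, hardyOp μ f x ^ p ∂ν ≠ ∞ := by
  have hS : ∀ x, hardyOp μ f x ≤ n * (μ x).restrict {u : X | u ≤ x} D := fun x => by
    rw [← lintegral_indicator_const hDm]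
    refine lintegral_mono fun u => ?_
    by_cases hu : u ∈ D
    · simpa [hu] using hfn u
    · simp [hu, hfD u hu]
  have hn : (n : ℝ≥0∞) ^ p ≠ ∞ := ENNReal.rpow_ne_top_of_nonneg hp.le ENNReal.coe_ne_top
  refine ne_top_of_le_ne_top (ENNReal.mul_ne_top hn (ENNReal.mul_ne_top hCtop hν)) ?_
  calc ∫⁻ x, hardyOp μ f x ^ p ∂ν
      ≤ ∫⁻ x, (n : ℝ≥0∞) ^ p * ((μ x).restrict {u : X | u ≤ x} D) ^ p ∂ν := by
        gcongr with x
        rw [← ENNReal.mul_rpow_of_nonneg _ _ hp.le]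
        exact ENNReal.rpow_le_rpow (hS x) hp.le
    _ ≤ (n : ℝ≥0∞) ^ p * (C * ν D) := by
        rw [lintegral_const_mul' _ _ hn]
        gcongr

lemma tendsto_min_tsub_natCast (a : ℝ≥0) :
    Filter.Tendsto (fun n : ℕ => min (a - 1 / ((n : ℝ≥0) + 1)) n) Filter.atTop (nhds a) := by
  have h : Filter.Tendsto (fun n : ℕ => a - 1 / ((n : ℝ≥0) + 1)) Filter.atTop (nhds a) := by
    simpa using (tendsto_const_nhds (x := a)).sub
      (tendsto_one_div_add_atTop_nhds_zero_nat (𝕜 := ℝ≥0))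
  refine h.congr' ?_
  filter_upwards [Filter.eventually_ge_atTop ⌈a⌉₊] with n hn
  exact (min_eq_left (tsub_le_self.trans ((Nat.le_ceil a).trans (by exact_mod_cast hn)))).symm

lemma monotone_min_tsub_natCast (a : ℝ≥0) :
    Monotone fun n : ℕ => min (a - 1 / ((n : ℝ≥0) + 1)) n := fun m n hmn => by
  dsimp only
  gcongr

lemma lintegral_hardyOp_rpow_le
    (hlowmeas : ∀ D : Set X, IsLowerSet D → MeasurableSet D)
    (htot : ∀ x u v : X, u ≤ x → v ≤ x → u ≤ v ∨ v ≤ u)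
    (hone : ∀ x : X, μ x {u : X | u ≤ x} = 1)
    (hcons : ∀ x u : X, u ≤ x → ∀ E : Set X, MeasurableSet E → E ⊆ {y : X | y ≤ u} →
      μ x E = μ x {y : X | y ≤ u} * μ u E)
    (hle : ∀ x y : X, x ≤ y → prec x y)
    (hSdec : ∀ f : X → ℝ≥0, Measurable f → (∀ x y, prec x y → f y ≤ f x) →
      ∀ x y, prec x y → hardyOp μ f y ≤ hardyOp μ f x)
    (hSmeas : ∀ f : X → ℝ≥0, Measurable f → (∀ x y, prec x y → f y ≤ f x) →
      Measurable (hardyOp μ f))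
    (hμmeas : ∀ D : Set X, (∀ x y, prec x y → y ∈ D → x ∈ D) →
      Measurable (fun x : X => (μ x).restrict {u : X | u ≤ x} D))
    {C : ℝ≥0∞} (hC0 : C ≠ 0) (hCtop : C ≠ ∞)
    (hC : ∀ D : Set X, (∀ x y, prec x y → y ∈ D → x ∈ D) →
      ∫⁻ x, ((μ x).restrict {u : X | u ≤ x} D) ^ p ∂ν ≤ C * ν D)
    (hp : 1 ≤ p) {f : X → ℝ≥0} (hfm : Measurable f) (hf : ∀ x y, prec x y → f y ≤ f x) :
    ∫⁻ x, hardyOp μ f x ^ p ∂ν ≤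
      (2 * (2 ^ (p + 1) * (2 * C))) ^ p * ∫⁻ x, (f x : ℝ≥0∞) ^ p ∂ν := by
  have hp0 : 0 < p := by linarith
  have hM0 : (2 * (2 ^ (p + 1) * (2 * C))) ^ p ≠ 0 := by
    simp [ENNReal.rpow_eq_zero_iff, hC0, hp0, hp0.le]
  rcases eq_or_ne (∫⁻ x, (f x : ℝ≥0∞) ^ p ∂ν) ∞ with hF | hF
  · rw [hF, ENNReal.mul_top hM0]
    exact le_top
  set φ : ℕ → X → ℝ≥0 := fun n x => min (f x - 1 / ((n : ℝ≥0) + 1)) n with hφ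
  have hφm : ∀ n, Measurable (φ n) := fun n => (hfm.sub_const _).min measurable_const
  have hφdec : ∀ n x y, prec x y → φ n y ≤ φ n x := fun n x y hxy =>
    min_le_min_right _ (tsub_le_tsub_right (hf x y hxy) _)
  have hφmono : ∀ x, Monotone fun n => φ n x := fun x => monotone_min_tsub_natCast (f x)
  have hSmono : ∀ x, Monotone fun n => hardyOp μ (φ n) x := fun x m n hmn =>
    lintegral_mono fun u => ENNReal.coe_le_coe.2 (hφmono u hmn)
  have hSlim : ∀ x, Filter.Tendsto (fun n => hardyOp μ (φ n) x) Filter.atTop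
      (nhds (hardyOp μ f x)) := fun x =>
    lintegral_tendsto_of_tendsto_of_monotone
      (fun n => (hφm n).coe_nnreal_ennreal.aemeasurable)
      (.of_forall fun u m n hmn => ENNReal.coe_le_coe.2 (hφmono u hmn))
      (.of_forall fun u => ENNReal.tendsto_coe.2 (tendsto_min_tsub_natCast (f u)))
  have hlim : Filter.Tendsto (fun n => ∫⁻ x, hardyOp μ (φ n) x ^ p ∂ν) Filter.atTop
      (nhds (∫⁻ x, hardyOp μ f x ^ p ∂ν)) :=
    lintegral_tendsto_of_tendsto_of_monotone
      (fun n => ((hSmeas _ (hφm n) (hφdec n)).pow_const p).aemeasurable)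
      (.of_forall fun x m n hmn => ENNReal.rpow_le_rpow (hSmono x hmn) hp0.le)
      (.of_forall fun x => ((ENNReal.continuous_rpow_const (y := p)).tendsto _).comp (hSlim x))
  refine le_of_tendsto' hlim fun n => ?_
  have hφn : ∀ x, φ n x ≤ n := fun x => min_le_right _ _
  have hfin : ∀ x, hardyOp μ (φ n) x ≠ ∞ := fun x => by
    refine ne_top_of_le_ne_top (ENNReal.natCast_ne_top n) ?_
    calc hardyOp μ (φ n) x ≤ ∫⁻ _ in {u : X | u ≤ x}, (n : ℝ≥0∞) ∂(μ x) :=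
          lintegral_mono fun u => ENNReal.coe_le_coe.2 (hφn u)
      _ = n := by simp [hone]
  set D : Set X := {x | 1 / ((n : ℝ≥0) + 1) ≤ f x} with hD
  have hε : 0 < 1 / ((n : ℝ≥0) + 1) := by positivity
  have hν : ν D ≠ ∞ := by
    refine ne_top_of_le_ne_top ?_ ((measure_mono fun x (hx : _ ≤ f x) => ?_).trans
      (meas_ge_le_lintegral_div (hfm.coe_nnreal_ennreal.pow_const p).aemeasurable
        (ε := ((1 / ((n : ℝ≥0) + 1) : ℝ≥0) : ℝ≥0∞) ^ p) ?_ ?_))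
    · refine (ENNReal.div_lt_top hF ?_).ne
      simp [ENNReal.rpow_eq_zero_iff]
    · exact ENNReal.rpow_le_rpow (by exact_mod_cast hx) hp0.le
    · simp [ENNReal.rpow_eq_zero_iff]
    · exact ENNReal.rpow_ne_top_of_nonneg hp0.le ENNReal.coe_ne_top
  have hT := lintegral_hardyOp_rpow_ne_top hp0 hCtop (measurableSet_le measurable_const hfm)
    (hC D fun x y hxy hy => le_trans hy (hf x y hxy)) hν hφn fun x hx => by
      have : f x ≤ 1 / ((n : ℝ≥0) + 1) := (not_le.1 hx).le
      rw [hφ]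
      dsimp only
      rw [tsub_eq_zero_of_le this, min_eq_left zero_le]
  refine (lintegral_hardyOp_rpow_le_of_ne_top hlowmeas htot hone hcons hle hμmeas hC0 hCtop hC hp
    (hφm n) (hφdec n) (hSmeas _ (hφm n) (hφdec n)) (hSdec _ (hφm n) (hφdec n)) hfin hT).trans ?_
  gcongr with x
  exact (min_le_left _ _).trans tsub_le_self

end Boundedness

/-- In the abstract partially ordered measure-space setting, the Hardy
operator `S` is bounded from `L^p_≺(ν)` to `L^p(ν)` if and only if for every `≺`-decreasing
set `D`, `∫_{X∖D} μ_x(D ∩ X_x)^p dν(x) ≤ C ν(D)`. -/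
theorem stmt2 {X : Type*} [MeasurableSpace X] [PartialOrder X]
    (μ : X → Measure X) (hσ : ∀ x : X, SigmaFinite (μ x))
    -- every ≤-decreasing (i.e. lower) set is measurable
    (hlowmeas : ∀ D : Set X, IsLowerSet D → MeasurableSet D)
    -- (1) ≤ restricted to each X_x is a total order
    (htot : ∀ x u v : X, u ≤ x → v ≤ x → u ≤ v ∨ v ≤ u)
    -- (2) μ_x(X_x) = 1
    (hone : ∀ x : X, μ x {u : X | u ≤ x} = 1)
    -- (3) if u ≤ x then μ_x(E) = μ_x(X_u) · μ_u(E) for measurable E ⊆ X_u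
    (hcons : ∀ x u : X, u ≤ x → ∀ E : Set X, MeasurableSet E → E ⊆ {y : X | y ≤ u} →
      μ x E = μ x {y : X | y ≤ u} * μ u E)
    -- the second partial order ≺
    (prec : X → X → Prop)
    (hrefl : ∀ x, prec x x)
    (htrans : ∀ x y z, prec x y → prec y z → prec x z)
    (hantisymm : ∀ x y, prec x y → prec y x → x = y)
    -- x ≤ y implies x ≺ y
    (hle : ∀ x y : X, x ≤ y → prec x y)
    -- S maps ≺-decreasing functions to ≺-decreasing functions
    (hSdec : ∀ f : X → ℝ≥0, Measurable f → (∀ x y, prec x y → f y ≤ f x) →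
      ∀ x y, prec x y → hardyOp μ f y ≤ hardyOp μ f x)
    (ν : Measure X) (p : ℝ) (hp : 0 < p)
    -- measurability assumptions
    (hSmeas : ∀ f : X → ℝ≥0, Measurable f → (∀ x y, prec x y → f y ≤ f x) →
      Measurable (hardyOp μ f))
    (hμmeas : ∀ D : Set X, (∀ x y, prec x y → y ∈ D → x ∈ D) →
      Measurable (fun x : X => μ x (D ∩ {u : X | u ≤ x}))) :
    (∃ C : ℝ, 0 < C ∧ ∀ f : X → ℝ≥0, Measurable f →
        (∀ x y, prec x y → f y ≤ f x) →
        ∫⁻ x, hardyOp μ f x ^ p ∂ν ≤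
          ENNReal.ofReal C * ∫⁻ x, (f x : ℝ≥0∞) ^ p ∂ν) ↔
      (∃ C : ℝ, 0 < C ∧ ∀ D : Set X, (∀ x y, prec x y → y ∈ D → x ∈ D) →
        ∫⁻ x in Dᶜ, (μ x (D ∩ {u : X | u ≤ x})) ^ p ∂ν ≤ ENNReal.ofReal C * ν D) := by
  have hX : ∀ x : X, MeasurableSet {u : X | u ≤ x} := fun x => hlowmeas _ (isLowerSet_Iic x)
  have hDm : ∀ D : Set X, (∀ x y, prec x y → y ∈ D → x ∈ D) → MeasurableSet D := fun D hD =>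
    hlowmeas D fun a b hba ha => hD b a (hle b a hba) ha
  constructor
  · rintro ⟨C, hC, h⟩
    refine ⟨C, hC, fun D hD => ?_⟩
    have hind : ∀ u, ((D.indicator 1 u : ℝ≥0) : ℝ≥0∞) = D.indicator 1 u := fun u => by
      by_cases hu : u ∈ D <;> simp [hu]
    have hS : ∀ x, hardyOp μ (D.indicator 1) x = μ x (D ∩ {u | u ≤ x}) := fun x => by
      simp only [hardyOp, hind]
      rw [lintegral_indicator_one (hDm D hD), Measure.restrict_apply (hDm D hD)]
    have hpow : ∀ u, ((D.indicator 1 u : ℝ≥0) : ℝ≥0∞) ^ p = D.indicator 1 u := fun u => by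
      by_cases hu : u ∈ D <;> simp [hu, hp]
    have := h (D.indicator 1) (measurable_one.indicator (hDm D hD)) fun x y hxy => by
      by_cases hy : y ∈ D
      · simp [hy, hD x y hxy hy]
      · simp [hy]
    simp only [hS, hpow] at this
    rw [lintegral_indicator_one (hDm D hD)] at this
    exact (setLIntegral_le_lintegral _ _).trans this
  · rintro ⟨C, hC, h⟩
    have hrestr : ∀ (D : Set X) (x : X),
        μ x (D ∩ {u | u ≤ x}) = (μ x).restrict {u | u ≤ x} D := fun D x =>
      (Measure.restrict_apply' (hX x)).symm
    simp only [hrestr] at h hμmeas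
    set C' : ℝ≥0∞ := 1 + ENNReal.ofReal C with hC'
    have hC0 : C' ≠ 0 := by simp [hC']
    have hCtop : C' ≠ ∞ := by simp [hC']
    have hfull : ∀ D : Set X, (∀ x y, prec x y → y ∈ D → x ∈ D) →
        ∫⁻ x, ((μ x).restrict {u : X | u ≤ x} D) ^ p ∂ν ≤ C' * ν D := fun D hD => by
      rw [← lintegral_add_compl _ (hDm D hD), hC', add_mul, one_mul]
      refine add_le_add ?_ (h D hD)
      rw [← setLIntegral_one]
      refine lintegral_mono fun x => ENNReal.rpow_le_one ?_ hp.le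
      calc (μ x).restrict {u | u ≤ x} D ≤ (μ x).restrict {u | u ≤ x} univ :=
            measure_mono (subset_univ D)
        _ = 1 := by rw [Measure.restrict_apply_univ, hone]
    suffices ∃ K : ℝ≥0∞, K ≠ 0 ∧ K ≠ ∞ ∧ ∀ f : X → ℝ≥0, Measurable f →
        (∀ x y, prec x y → f y ≤ f x) →
        ∫⁻ x, hardyOp μ f x ^ p ∂ν ≤ K * ∫⁻ x, (f x : ℝ≥0∞) ^ p ∂ν by
      obtain ⟨K, hK0, hKtop, hK⟩ := this
      refine ⟨K.toReal, ENNReal.toReal_pos hK0 hKtop, ?_⟩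
      rwa [ENNReal.ofReal_toReal hKtop]
    rcases le_total p 1 with hp1 | hp1
    · refine ⟨2 * (2 * C'), mul_ne_zero (by norm_num) (mul_ne_zero (by norm_num) hC0),
        ENNReal.mul_ne_top (by norm_num) (ENNReal.mul_ne_top (by norm_num) hCtop),
        fun f hfm hf => ?_⟩
      calc ∫⁻ x, hardyOp μ f x ^ p ∂ν
          ≤ ∫⁻ x, 2 * ∑' k : ℤ, (2 : ℝ≥0∞) ^ k *
              (μ x).restrict {u | u ≤ x} {u | 2 ^ k < (f u : ℝ≥0∞) ^ p} ^ p ∂ν :=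
            lintegral_mono fun x => hardyOp_rpow_le_tsum_of_le_one hlowmeas hp hp1
              (fun a b hab => hf a b (hle a b hab)) x
        _ ≤ 2 * (2 * C') * ∫⁻ x, (f x : ℝ≥0∞) ^ p ∂ν := by
            rw [lintegral_const_mul' _ _ (by norm_num), mul_assoc 2 (2 * C')]
            gcongr
            exact lintegral_tsum_level_le hlowmeas hle hμmeas hfull fun x y hxy =>
              ENNReal.rpow_le_rpow (by exact_mod_cast hf x y hxy) hp.le
    · have hB0 : 2 * (2 ^ (p + 1) * (2 * C')) ≠ 0 := by simp [hC0]
      have hBtop : 2 * (2 ^ (p + 1) * (2 * C')) ≠ ∞ :=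
        ENNReal.mul_ne_top (by norm_num) <| ENNReal.mul_ne_top
          (ENNReal.rpow_ne_top_of_nonneg (by linarith) (by norm_num))
          (ENNReal.mul_ne_top (by norm_num) hCtop)
      exact ⟨(2 * (2 ^ (p + 1) * (2 * C'))) ^ p, (ENNReal.rpow_pos hB0.bot_lt hBtop).ne',
        ENNReal.rpow_ne_top_of_nonneg hp.le hBtop,
        fun f hfm hf => lintegral_hardyOp_rpow_le hlowmeas htot hone hcons hle hSdec hSmeas hμmeas
          hC0 hCtop hfull hp1 hfm hf⟩
end

section
/- Let ν be a σ-finite Borel measure on (0,∞) and 0 < p < ∞. The Hardy operator Sf(x) = (1/x)∫₀^x f(t) dt satisfies: there exists C > 0 with ∫_{(0,∞)} (Sf)^p dν ≤ C ∫_{(0,∞)} f^p dν for every nonnegative decreasing measurable f on (0,∞), if and only if there exists C > 0 such that for every r > 0, r^p ∫_{(r,∞)} x^{−p} dν(x) ≤ C ν((0,r]). -/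
open MeasureTheory Set
open scoped ENNReal NNReal

/-- The one-dimensional Hardy operator `Sf(x) = (1/x) ∫₀^x f(t) dt`. -/
noncomputable def hardy1 (f : ℝ → ℝ≥0) (x : ℝ) : ℝ≥0∞ :=
  (∫⁻ t in Set.Ioc 0 x, (f t : ℝ≥0∞)) / ENNReal.ofReal x

theorem lintegral_Ioi_mono_of_antitoneOn {μ₁ μ₂ : Measure ℝ}
    (hμ : ∀ r : ℝ, 0 < r → μ₁ (Ioc 0 r) ≤ μ₂ (Ioc 0 r)) {h : ℝ → ℝ≥0} (hm : Measurable h)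
    (ha : AntitoneOn h (Ioi 0)) :
    ∫⁻ x in Ioi (0 : ℝ), (h x : ℝ≥0∞) ∂μ₁ ≤ ∫⁻ x in Ioi (0 : ℝ), (h x : ℝ≥0∞) ∂μ₂ := by
  have key (μ : Measure ℝ) : ∫⁻ x in Ioi (0 : ℝ), (h x : ℝ≥0∞) ∂μ
      = ∫⁻ s in Ioi (0 : ℝ), μ ({x | s < (h x : ℝ)} ∩ Ioi 0) := by
    have := lintegral_eq_lintegral_meas_lt (f := fun x => (h x : ℝ)) (μ.restrict (Ioi 0))
      (Filter.Eventually.of_forall fun x => (h x).2) hm.coe_nnreal_real.aemeasurable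
    simp only [ENNReal.ofReal_coe_nnreal] at this
    rw [this]
    refine lintegral_congr fun s => ?_
    rw [Measure.restrict_apply (measurableSet_lt measurable_const hm.coe_nnreal_real)]
  rw [key, key]
  refine lintegral_mono fun s => ?_
  set S : Set ℝ := {x | s < (h x : ℝ)} ∩ Ioi 0 with hS
  have hlow {x y : ℝ} (hx : 0 < x) (hxy : x ≤ y) (hy : y ∈ S) : x ∈ S :=
    ⟨lt_of_lt_of_le hy.1 (NNReal.coe_le_coe.2 (ha hx hy.2 hxy)), hx⟩
  have : S.OrdConnected := ⟨fun x hx y hy z hz => hlow (lt_of_lt_of_le hx.2 hz.1) hz.2 hy⟩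
  have hU : S = ⋃ r : S, Ioc 0 (r : ℝ) := by
    ext x
    simp only [mem_iUnion]
    exact ⟨fun hx => ⟨⟨x, hx⟩, hx.2, le_rfl⟩, fun ⟨r, hr⟩ => hlow hr.1 hr.2 r.2⟩
  have hmono : Monotone fun r : S => Ioc 0 (r : ℝ) := fun a b hab => Ioc_subset_Ioc_right hab
  change μ₁ S ≤ μ₂ S
  rw [hU, hmono.measure_iUnion, hmono.measure_iUnion]
  exact iSup_mono fun r => hμ r r.2.2

theorem measurable_setLIntegral_Ici (ν : Measure ℝ) (w : ℝ → ℝ≥0∞) :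
    Measurable fun t : ℝ => ∫⁻ x in Ici t, w x ∂ν :=
  Antitone.measurable fun _ _ hab => lintegral_mono_set (Ici_subset_Ici.2 hab)

theorem measurable_setLIntegral_Ioc (ν : Measure ℝ) (w : ℝ → ℝ≥0∞) :
    Measurable fun t : ℝ => ∫⁻ x in Ioc 0 t, w x ∂ν :=
  Monotone.measurable fun _ _ hab => lintegral_mono_set (Ioc_subset_Ioc_right hab)

theorem lintegral_mul_setLIntegral_Ioc (ν : Measure ℝ) [SFinite ν] {w g : ℝ → ℝ≥0∞}
    (hw : Measurable w) (hg : Measurable g) :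
    ∫⁻ x in Ioi (0 : ℝ), w x * (∫⁻ t in Ioc 0 x, g t) ∂ν
      = ∫⁻ t in Ioi (0 : ℝ), g t * ∫⁻ x in Ici t, w x ∂ν := by
  set D : Set (ℝ × ℝ) := {q | 0 < q.2 ∧ q.2 ≤ q.1} with hD
  have hDm : MeasurableSet D :=
    (measurableSet_lt measurable_const measurable_snd).inter
      (measurableSet_le measurable_snd measurable_fst)
  have hL : ∫⁻ x in Ioi (0 : ℝ), w x * (∫⁻ t in Ioc 0 x, g t) ∂ν
      = ∫⁻ x, (∫⁻ t, D.indicator (fun q => w q.1 * g q.2) (x, t)) ∂ν := by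
    rw [← lintegral_indicator measurableSet_Ioi]
    refine lintegral_congr fun x => ?_
    have : ∀ t, D.indicator (fun q => w q.1 * g q.2) (x, t)
        = w x * (Ioc 0 x).indicator g t := by
      intro t
      by_cases ht : t ∈ Ioc 0 x
      · rw [indicator_of_mem ht, indicator_of_mem (show (x, t) ∈ D from ht)]
      · rw [indicator_of_notMem ht, indicator_of_notMem (show (x, t) ∉ D from ht), mul_zero]
    simp_rw [this]
    rw [lintegral_const_mul _ (hg.indicator measurableSet_Ioc),
      lintegral_indicator measurableSet_Ioc]
    by_cases hx : x ∈ Ioi (0 : ℝ)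
    · rw [indicator_of_mem hx]
    · rw [indicator_of_notMem hx, Ioc_eq_empty (by simpa using hx)]
      simp
  have hR : ∫⁻ t in Ioi (0 : ℝ), g t * ∫⁻ x in Ici t, w x ∂ν
      = ∫⁻ t, ∫⁻ x, D.indicator (fun q => w q.1 * g q.2) (x, t) ∂ν := by
    rw [← lintegral_indicator measurableSet_Ioi]
    refine lintegral_congr fun t => ?_
    by_cases ht : t ∈ Ioi (0 : ℝ)
    · rw [indicator_of_mem ht, ← lintegral_indicator measurableSet_Ici,
        ← lintegral_const_mul _ (hw.indicator measurableSet_Ici)]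
      refine lintegral_congr fun x => ?_
      by_cases hx : x ∈ Ici t
      · rw [indicator_of_mem hx, indicator_of_mem (show (x, t) ∈ D from ⟨ht, hx⟩), mul_comm]
      · rw [indicator_of_notMem hx,
          indicator_of_notMem (show (x, t) ∉ D from fun h => hx h.2), mul_zero]
    · rw [indicator_of_notMem ht]
      symm
      rw [lintegral_eq_zero_of_ae_eq_zero]
      exact Filter.Eventually.of_forall fun x =>
        indicator_of_notMem (show (x, t) ∉ D from fun h => ht h.1) _
  rw [hL, hR]
  refine lintegral_lintegral_swap (Measurable.aemeasurable ?_)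
  exact ((hw.comp measurable_fst).mul (hg.comp measurable_snd)).indicator hDm

theorem setLIntegral_Ioc_rpow_sub_one {p r : ℝ} (hp : 0 < p) (hr : 0 ≤ r) :
    ∫⁻ t in Ioc 0 r, ENNReal.ofReal (t ^ (p - 1)) = ENNReal.ofReal (r ^ p / p) := by
  have hi : IntervalIntegrable (fun t : ℝ => t ^ (p - 1)) volume 0 r :=
    intervalIntegral.intervalIntegrable_rpow' (by linarith)
  rw [intervalIntegrable_iff_integrableOn_Ioc_of_le hr] at hi
  rw [← ofReal_integral_eq_lintegral_ofReal hi
    ((ae_restrict_iff' measurableSet_Ioc).2 (Filter.Eventually.of_forall fun t ht =>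
      Real.rpow_nonneg ht.1.le _)), ← intervalIntegral.integral_of_le hr,
    integral_rpow (Or.inl (by linarith))]
  simp [Real.zero_rpow hp.ne']

theorem lintegral_rpow_mul_le_of_Bp (ν : Measure ℝ) [SFinite ν] {p : ℝ} (hp : 0 < p) {C : ℝ}
    (hC : 0 < C)
    (hB : ∀ r : ℝ, 0 < r →
        ENNReal.ofReal (r ^ p) * ∫⁻ x in Ioi r, ENNReal.ofReal (x ^ (-p)) ∂ν ≤
          ENNReal.ofReal C * ν (Ioc 0 r))
    {h : ℝ → ℝ≥0} (hm : Measurable h) (ha : AntitoneOn h (Ioi 0)) :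
    ∫⁻ x in Ioi (0 : ℝ), ENNReal.ofReal (x ^ (-p)) *
        (∫⁻ t in Ioc 0 x, ENNReal.ofReal (t ^ (p - 1)) * h t) ∂ν
      ≤ ENNReal.ofReal ((1 + C) / p) * ∫⁻ x in Ioi (0 : ℝ), (h x : ℝ≥0∞) ∂ν := by
  have hw (q : ℝ) : Measurable fun x : ℝ => ENNReal.ofReal (x ^ q) := by fun_prop
  set W : ℝ → ℝ≥0∞ := fun t => ∫⁻ x in Ici t, ENNReal.ofReal (x ^ (-p)) ∂ν with hW
  have hWm : Measurable W := measurable_setLIntegral_Ici ν _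
  have hd : Measurable fun t : ℝ => ENNReal.ofReal (t ^ (p - 1)) * W t := (hw _).mul hWm
  rw [lintegral_mul_setLIntegral_Ioc ν (hw _)
    (show Measurable fun t => ENNReal.ofReal (t ^ (p - 1)) * (h t : ℝ≥0∞) from
      (hw _).mul hm.coe_nnreal_ennreal)]
  have key := lintegral_Ioi_mono_of_antitoneOn
    (μ₁ := volume.withDensity fun t : ℝ => ENNReal.ofReal (t ^ (p - 1)) * W t)
    (μ₂ := ENNReal.ofReal ((1 + C) / p) • ν) (fun r hr => ?_) hm ha
  · rw [setLIntegral_withDensity_eq_setLIntegral_mul _ hd hm.coe_nnreal_ennreal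
      measurableSet_Ioi, Measure.restrict_smul, lintegral_smul_measure, smul_eq_mul] at key
    refine le_of_eq_of_le (lintegral_congr fun t => ?_) key
    simp only [Pi.mul_apply, hW]
    ring
  · rw [withDensity_apply _ measurableSet_Ioc, Measure.smul_apply, smul_eq_mul]
    have h1 : ∫⁻ t in Ioc 0 r, ENNReal.ofReal (t ^ (p - 1)) * W t
        = ∫⁻ t in Ioi (0 : ℝ),
          (Ioc 0 r).indicator (fun t => ENNReal.ofReal (t ^ (p - 1))) t * W t := by
      rw [← lintegral_indicator measurableSet_Ioc, ← lintegral_indicator measurableSet_Ioi]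
      refine lintegral_congr fun t => ?_
      by_cases ht : t ∈ Ioc 0 r
      · simp [ht, ht.1]
      · by_cases ht' : 0 < t <;> simp [indicator, ht, ht']
    rw [h1, ← lintegral_mul_setLIntegral_Ioc ν (hw _) ((hw _).indicator measurableSet_Ioc),
      ← Ioc_union_Ioi_eq_Ioi hr.le, lintegral_union measurableSet_Ioi
        (Ioc_disjoint_Ioi le_rfl)]
    have hin (x : ℝ) : ∫⁻ t in Ioc 0 x,
        (Ioc 0 r).indicator (fun t => ENNReal.ofReal (t ^ (p - 1))) t
        = ∫⁻ t in Ioc 0 (min r x), ENNReal.ofReal (t ^ (p - 1)) := by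
      rw [lintegral_indicator measurableSet_Ioc, Measure.restrict_restrict measurableSet_Ioc,
        Ioc_inter_Ioc, max_self]
    have hA : ∫⁻ x in Ioc 0 r, ENNReal.ofReal (x ^ (-p)) * (∫⁻ t in Ioc 0 x,
        (Ioc 0 r).indicator (fun t => ENNReal.ofReal (t ^ (p - 1))) t) ∂ν
        = ENNReal.ofReal (1 / p) * ν (Ioc 0 r) := by
      rw [← setLIntegral_const]
      refine setLIntegral_congr_fun measurableSet_Ioc fun x hx => ?_
      rw [hin, min_eq_right hx.2, setLIntegral_Ioc_rpow_sub_one hp hx.1.le,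
        ← ENNReal.ofReal_mul (Real.rpow_nonneg hx.1.le _), mul_div_assoc',
        ← Real.rpow_add hx.1]
      simp
    have hB' : ∫⁻ x in Ioi r, ENNReal.ofReal (x ^ (-p)) * (∫⁻ t in Ioc 0 x,
        (Ioc 0 r).indicator (fun t => ENNReal.ofReal (t ^ (p - 1))) t) ∂ν
        ≤ ENNReal.ofReal (C / p) * ν (Ioc 0 r) := by
      have : ∫⁻ x in Ioi r, ENNReal.ofReal (x ^ (-p)) * (∫⁻ t in Ioc 0 x,
          (Ioc 0 r).indicator (fun t => ENNReal.ofReal (t ^ (p - 1))) t) ∂ν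
          = ∫⁻ x in Ioi r, ENNReal.ofReal (x ^ (-p)) * ENNReal.ofReal (r ^ p / p) ∂ν := by
        refine setLIntegral_congr_fun measurableSet_Ioi fun x hx => ?_
        rw [hin, min_eq_left (le_of_lt hx), setLIntegral_Ioc_rpow_sub_one hp hr.le]
      rw [this, lintegral_mul_const _ (hw _), div_eq_mul_inv, div_eq_mul_inv,
        ENNReal.ofReal_mul (Real.rpow_nonneg hr.le _), ENNReal.ofReal_mul hC.le]
      calc _ = ENNReal.ofReal p⁻¹ * (ENNReal.ofReal (r ^ p)
              * ∫⁻ x in Ioi r, ENNReal.ofReal (x ^ (-p)) ∂ν) := by ring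
        _ ≤ ENNReal.ofReal p⁻¹ * (ENNReal.ofReal C * ν (Ioc 0 r)) := mul_le_mul' le_rfl (hB r hr)
        _ = _ := by ring
    rw [hA, add_div, ENNReal.ofReal_add (by positivity) (by positivity), add_mul]
    gcongr

theorem ofReal_mul_le_setLIntegral_of_antitoneOn {f : ℝ → ℝ≥0} (ha : AntitoneOn f (Ioi 0)) {x : ℝ}
    (hx : 0 < x) : ENNReal.ofReal x * f x ≤ ∫⁻ t in Ioc 0 x, (f t : ℝ≥0∞) := by
  calc ENNReal.ofReal x * f x = ∫⁻ _ in Ioc 0 x, (f x : ℝ≥0∞) := by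
        rw [setLIntegral_const, Real.volume_Ioc, sub_zero, mul_comm]
    _ ≤ _ := setLIntegral_mono' measurableSet_Ioc fun t ht =>
        ENNReal.coe_le_coe.2 (ha ht.1 hx ht.2)

theorem le_hardy1_of_antitoneOn {f : ℝ → ℝ≥0} (ha : AntitoneOn f (Ioi 0)) {x : ℝ} (hx : 0 < x) :
    f x ≤ hardy1 f x := by
  rw [hardy1, ENNReal.le_div_iff_mul_le (Or.inl (by simpa using hx)) (Or.inl ENNReal.ofReal_ne_top),
    mul_comm]
  exact ofReal_mul_le_setLIntegral_of_antitoneOn ha hx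

theorem antitoneOn_hardy1 {f : ℝ → ℝ≥0} (ha : AntitoneOn f (Ioi 0)) :
    AntitoneOn (hardy1 f) (Ioi 0) := by
  intro x hx y hy hxy
  have hx' : ENNReal.ofReal x ≠ 0 := by simpa using hx
  have hsplit : ENNReal.ofReal y = ENNReal.ofReal x + ENNReal.ofReal (y - x) := by
    rw [← ENNReal.ofReal_add (le_of_lt hx) (sub_nonneg.2 hxy)]
    simp
  refine ENNReal.div_le_of_le_mul ?_
  rw [hsplit, mul_add, hardy1, ENNReal.div_mul_cancel hx' ENNReal.ofReal_ne_top,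
    ← Ioc_union_Ioc_eq_Ioc (le_of_lt hx) hxy,
    lintegral_union measurableSet_Ioc (Ioc_disjoint_Ioc_of_le le_rfl)]
  gcongr
  calc ∫⁻ t in Ioc x y, (f t : ℝ≥0∞) ≤ ∫⁻ _ in Ioc x y, (f x : ℝ≥0∞) :=
        setLIntegral_mono' measurableSet_Ioc fun t ht =>
          ENNReal.coe_le_coe.2 (ha hx (lt_trans hx ht.1) ht.1.le)
    _ = f x * ENNReal.ofReal (y - x) := by rw [setLIntegral_const, Real.volume_Ioc]
    _ ≤ _ := by
        gcongr
        exact le_hardy1_of_antitoneOn ha hx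

theorem measurable_hardy1 (f : ℝ → ℝ≥0) : Measurable (hardy1 f) :=
  (measurable_setLIntegral_Ioc _ _).div ENNReal.measurable_ofReal

theorem hardy1_mono {f g : ℝ → ℝ≥0} (hfg : ∀ t, f t ≤ g t) (x : ℝ) : hardy1 f x ≤ hardy1 g x :=
  ENNReal.div_le_div_right (lintegral_mono fun t => ENNReal.coe_le_coe.2 (hfg t)) _

theorem hardy1_rpow (f : ℝ → ℝ≥0) {p : ℝ} (hp : 0 ≤ p) {x : ℝ} (hx : 0 < x) :
    hardy1 f x ^ p = ENNReal.ofReal (x ^ (-p)) * (∫⁻ t in Ioc 0 x, (f t : ℝ≥0∞)) ^ p := by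
  rw [hardy1, ENNReal.div_rpow_of_nonneg _ _ hp, ← ENNReal.ofReal_rpow_of_pos hx,
    ENNReal.rpow_neg, div_eq_mul_inv, mul_comm]

theorem rpow_setLIntegral_le_of_le_one {f : ℝ → ℝ≥0} (hm : Measurable f)
    (ha : AntitoneOn f (Ioi 0)) {p : ℝ} (hp : 0 < p) (hp1 : p ≤ 1) {x : ℝ}
    (hF : ∫⁻ t in Ioc 0 x, (f t : ℝ≥0∞) ≠ ⊤) :
    (∫⁻ t in Ioc 0 x, (f t : ℝ≥0∞)) ^ p
      ≤ ∫⁻ t in Ioc 0 x, ENNReal.ofReal (t ^ (p - 1)) * ((f t ^ p : ℝ≥0) : ℝ≥0∞) := by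
  set F := ∫⁻ t in Ioc 0 x, (f t : ℝ≥0∞) with hFd
  rcases eq_or_ne F 0 with h0 | h0
  · simp [h0, ENNReal.zero_rpow_of_pos hp]
  have : F ^ p = ∫⁻ t in Ioc 0 x, F ^ (p - 1) * f t := by
    rw [lintegral_const_mul _ hm.coe_nnreal_ennreal, ← hFd]
    conv_lhs => rw [← sub_add_cancel p 1, ENNReal.rpow_add _ _ h0 hF, ENNReal.rpow_one]
  rw [this]
  refine setLIntegral_mono' measurableSet_Ioc fun t ht => ?_
  rcases eq_or_ne (f t) 0 with hf | hf
  · simp [hf]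
  have hf' : (f t : ℝ≥0∞) ≠ 0 := by simpa using hf
  have hle : ENNReal.ofReal t * f t ≤ F :=
    (ofReal_mul_le_setLIntegral_of_antitoneOn ha ht.1).trans
      (lintegral_mono_set (Ioc_subset_Ioc_right ht.2))
  have hpow : F ^ (p - 1) ≤ (ENNReal.ofReal t * f t) ^ (p - 1) := by
    rw [← neg_sub 1 p, ENNReal.rpow_neg, ENNReal.rpow_neg]
    exact ENNReal.inv_le_inv.2 (ENNReal.rpow_le_rpow hle (by linarith))
  calc F ^ (p - 1) * f t ≤ (ENNReal.ofReal t * f t) ^ (p - 1) * f t := by gcongr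
    _ = ENNReal.ofReal (t ^ (p - 1)) * ((f t : ℝ≥0∞) ^ (p - 1) * (f t : ℝ≥0∞) ^ (1 : ℝ)) := by
        rw [ENNReal.mul_rpow_of_ne_top ENNReal.ofReal_ne_top ENNReal.coe_ne_top,
          ENNReal.ofReal_rpow_of_pos ht.1, ENNReal.rpow_one, mul_assoc]
    _ = _ := by
        rw [← ENNReal.rpow_add _ _ hf' ENNReal.coe_ne_top, sub_add_cancel,
          ENNReal.coe_rpow_of_nonneg _ hp.le]

theorem exists_setLIntegral_Ioc_eq_half {f : ℝ → ℝ≥0} (hm : Measurable f) {x : ℝ} (hx : 0 < x)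
    (hF : ∫⁻ t in Ioc 0 x, (f t : ℝ≥0∞) ≠ ⊤) :
    ∃ y ∈ Icc 0 x, ∫⁻ t in Ioc 0 y, (f t : ℝ≥0∞) = (∫⁻ t in Ioc 0 x, (f t : ℝ≥0∞)) / 2 ∧
      ∫⁻ t in Ioc y x, (f t : ℝ≥0∞) = (∫⁻ t in Ioc 0 x, (f t : ℝ≥0∞)) / 2 := by
  have hi : IntegrableOn (fun t => (f t : ℝ)) (Ioc 0 x) :=
    ⟨hm.coe_nnreal_real.aestronglyMeasurable, by
      simpa [HasFiniteIntegral, enorm_eq_nnnorm] using lt_top_iff_ne_top.2 hF⟩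
  have hof {y : ℝ} (hy : y ≤ x) : ∫⁻ t in Ioc 0 y, (f t : ℝ≥0∞)
      = ENNReal.ofReal (∫ t in Ioc 0 y, (f t : ℝ)) :=
    lintegral_coe_eq_integral f (hi.mono_set (Ioc_subset_Ioc_right hy))
  have hnn : 0 ≤ ∫ t in Ioc 0 x, (f t : ℝ) := integral_nonneg fun t => (f t).2
  have hc := intervalIntegral.continuousOn_primitive
    ((integrableOn_Icc_iff_integrableOn_Ioc (by simp)).2 hi)
  obtain ⟨y, hy, hyF⟩ := intermediate_value_Icc hx.le hc
    (show (∫ t in Ioc 0 x, (f t : ℝ)) / 2 ∈ _ from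
      ⟨by simp only [Ioc_self, setIntegral_empty]; linarith, by linarith⟩)
  beta_reduce at hyF
  have h1 : ∫⁻ t in Ioc 0 y, (f t : ℝ≥0∞) = (∫⁻ t in Ioc 0 x, (f t : ℝ≥0∞)) / 2 := by
    rw [hof hy.2, hof le_rfl, hyF, ENNReal.ofReal_div_of_pos two_pos]
    simp
  refine ⟨y, hy, h1, ?_⟩
  have hs : ∫⁻ t in Ioc 0 x, (f t : ℝ≥0∞)
      = (∫⁻ t in Ioc 0 x, (f t : ℝ≥0∞)) / 2 + ∫⁻ t in Ioc y x, (f t : ℝ≥0∞) := by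
    rw [← h1, ← lintegral_union measurableSet_Ioc (Ioc_disjoint_Ioc_of_le le_rfl),
      Ioc_union_Ioc_eq_Ioc hy.1 hy.2]
  refine (ENNReal.add_right_inj (ENNReal.div_ne_top hF two_ne_zero)).1 (hs.symm.trans ?_)
  exact (ENNReal.add_halves _).symm

theorem rpow_setLIntegral_le_of_one_le {f : ℝ → ℝ≥0} (hm : Measurable f) {p : ℝ} (hp1 : 1 ≤ p)
    {x : ℝ} (hx : 0 < x) (hF : ∫⁻ t in Ioc 0 x, (f t : ℝ≥0∞) ≠ ⊤) :
    (∫⁻ t in Ioc 0 x, (f t : ℝ≥0∞)) ^ p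
      ≤ ENNReal.ofReal (2 ^ p) *
        ∫⁻ t in Ioc 0 x, ENNReal.ofReal (t ^ (p - 1)) * (hardy1 f t ^ (p - 1) * f t) := by
  obtain ⟨y, hy, h1, h2⟩ := exists_setLIntegral_Ioc_eq_half hm hx hF
  set F := ∫⁻ t in Ioc 0 x, (f t : ℝ≥0∞) with hFd
  have hp0 : 0 ≤ p - 1 := by linarith
  have hhalf : (F / 2) ^ p ≤
      ∫⁻ t in Ioc 0 x, ENNReal.ofReal (t ^ (p - 1)) * (hardy1 f t ^ (p - 1) * f t) := by
    calc (F / 2) ^ p = (F / 2) ^ (p - 1) * (F / 2) ^ (1 : ℝ) := by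
          rw [← ENNReal.rpow_add_of_nonneg _ _ hp0 zero_le_one, sub_add_cancel]
      _ = ∫⁻ t in Ioc y x, (F / 2) ^ (p - 1) * f t := by
          rw [lintegral_const_mul _ hm.coe_nnreal_ennreal, h2, ENNReal.rpow_one]
      _ ≤ ∫⁻ t in Ioc y x, ENNReal.ofReal (t ^ (p - 1)) * (hardy1 f t ^ (p - 1) * f t) := by
          refine setLIntegral_mono' measurableSet_Ioc fun t ht => ?_
          have ht0 : 0 < t := hy.1.trans_lt ht.1
          rw [← mul_assoc, ← ENNReal.ofReal_rpow_of_pos ht0,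
            ← ENNReal.mul_rpow_of_nonneg _ _ hp0, hardy1,
            ENNReal.mul_div_cancel (by simpa using ht0) ENNReal.ofReal_ne_top, ← h1]
          gcongr
          exact ht.1.le
      _ ≤ _ := lintegral_mono_set (Ioc_subset_Ioc_left hy.1)
  calc F ^ p = ENNReal.ofReal (2 ^ p) * (F / 2) ^ p := by
        rw [← ENNReal.ofReal_rpow_of_pos two_pos, ← ENNReal.mul_rpow_of_nonneg _ _ (by linarith)]
        simp [ENNReal.mul_div_cancel]
    _ ≤ _ := by gcongr

theorem NNReal.rpow_sub_one_mul_le {p : ℝ} (hp : 1 ≤ p) {ε : ℝ≥0} (hε : 0 < ε) (s f : ℝ≥0) :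
    s ^ (p - 1) * f ≤ ε * s ^ p + ε⁻¹ ^ (p - 1) * f ^ p := by
  have hp0 : 0 ≤ p - 1 := by linarith
  have hadd (u : ℝ≥0) : u ^ p = u ^ (p - 1) * u := by
    conv_rhs => rw [← NNReal.rpow_one u, ← NNReal.rpow_mul, one_mul]
    rw [← NNReal.rpow_add_of_nonneg _ hp0 zero_le_one, sub_add_cancel]
  rcases le_total f (ε * s) with h | h
  · refine le_trans ?_ le_self_add
    rw [hadd, mul_left_comm]
    gcongr
  · refine le_trans ?_ le_add_self
    rw [hadd, ← mul_assoc, ← NNReal.mul_rpow]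
    gcongr
    exact (le_inv_mul_iff₀ hε).2 h

section Bp

variable {ν : Measure ℝ} {p C : ℝ}

theorem setLIntegral_Ioi_rpow_ne_top_of_Bp
    (hB : ∀ r : ℝ, 0 < r →
        ENNReal.ofReal (r ^ p) * ∫⁻ x in Ioi r, ENNReal.ofReal (x ^ (-p)) ∂ν ≤
          ENNReal.ofReal C * ν (Ioc 0 r))
    {r : ℝ} (hr : 0 < r) (hfin : ν (Ioc 0 r) ≠ ⊤) :
    ∫⁻ x in Ioi r, ENNReal.ofReal (x ^ (-p)) ∂ν ≠ ⊤ := by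
  intro h
  have := hB r hr
  rw [h, ENNReal.mul_top (by simpa using Real.rpow_pos_of_pos hr p), top_le_iff] at this
  exact ENNReal.mul_ne_top ENNReal.ofReal_ne_top hfin this

theorem measure_Ioc_ne_top_of_Bp (hp : 0 < p)
    (hB : ∀ r : ℝ, 0 < r →
        ENNReal.ofReal (r ^ p) * ∫⁻ x in Ioi r, ENNReal.ofReal (x ^ (-p)) ∂ν ≤
          ENNReal.ofReal C * ν (Ioc 0 r))
    {r : ℝ} (hr : 0 < r) (hfin : ν (Ioc 0 r) ≠ ⊤) (s : ℝ) : ν (Ioc 0 s) ≠ ⊤ := by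
  rcases le_total s r with hs | hs
  · exact ne_top_of_le_ne_top hfin (measure_mono (Ioc_subset_Ioc_right hs))
  have hs0 : 0 < s := hr.trans_le hs
  rw [← Ioc_union_Ioc_eq_Ioc hr.le hs]
  refine measure_union_ne_top hfin fun h => ?_
  refine setLIntegral_Ioi_rpow_ne_top_of_Bp hB hr hfin (top_le_iff.1 ?_)
  calc ⊤ = ∫⁻ _ in Ioc r s, ENNReal.ofReal (s ^ (-p)) ∂ν := by
        rw [setLIntegral_const, h, ENNReal.mul_top]
        simpa using Real.rpow_pos_of_pos hs0 (-p)
    _ ≤ ∫⁻ x in Ioc r s, ENNReal.ofReal (x ^ (-p)) ∂ν :=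
        setLIntegral_mono' measurableSet_Ioc fun x hx => ENNReal.ofReal_le_ofReal
          (Real.rpow_le_rpow_of_nonpos (hr.trans hx.1) hx.2 (by linarith))
    _ ≤ _ := lintegral_mono_set Ioc_subset_Ioi_self

theorem lintegral_hardy1_rpow_ne_top_of_Bp (hp : 0 < p)
    (hB : ∀ r : ℝ, 0 < r →
        ENNReal.ofReal (r ^ p) * ∫⁻ x in Ioi r, ENNReal.ofReal (x ^ (-p)) ∂ν ≤
          ENNReal.ofReal C * ν (Ioc 0 r))
    {f : ℝ → ℝ≥0} {M r : ℝ≥0} (hr : 0 < r) (hfin : ν (Ioc 0 (r : ℝ)) ≠ ⊤) (hM : ∀ t, f t ≤ M)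
    (hs : ∀ t : ℝ, r < t → f t = 0) :
    ∫⁻ x in Ioi (0 : ℝ), hardy1 f x ^ p ∂ν ≠ ⊤ := by
  have hr' : (0 : ℝ) < r := hr
  rw [← Ioc_union_Ioi_eq_Ioi hr'.le, lintegral_union measurableSet_Ioi (Ioc_disjoint_Ioi le_rfl)]
  refine ENNReal.add_ne_top.2 ⟨?_, ?_⟩
  · refine ne_top_of_le_ne_top (b := (M : ℝ≥0∞) ^ p * ν (Ioc 0 (r : ℝ)))
      (ENNReal.mul_ne_top (ENNReal.rpow_ne_top_of_nonneg hp.le ENNReal.coe_ne_top) hfin) ?_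
    rw [← setLIntegral_const]
    refine setLIntegral_mono' measurableSet_Ioc fun x hx => ENNReal.rpow_le_rpow ?_ hp.le
    refine ENNReal.div_le_of_le_mul ?_
    calc ∫⁻ t in Ioc 0 x, (f t : ℝ≥0∞) ≤ ∫⁻ _ in Ioc 0 x, (M : ℝ≥0∞) :=
          lintegral_mono fun t => ENNReal.coe_le_coe.2 (hM t)
      _ = _ := by rw [setLIntegral_const, Real.volume_Ioc, sub_zero]
  · refine ne_top_of_le_ne_top (b := (∫⁻ x in Ioi (r : ℝ), ENNReal.ofReal (x ^ (-p)) ∂ν) *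
      ((M : ℝ≥0∞) * r) ^ p) (ENNReal.mul_ne_top (setLIntegral_Ioi_rpow_ne_top_of_Bp hB hr' hfin)
        (ENNReal.rpow_ne_top_of_nonneg hp.le (by finiteness))) ?_
    rw [← lintegral_mul_const _ (by fun_prop)]
    refine setLIntegral_mono' measurableSet_Ioi fun x hx => ?_
    rw [hardy1_rpow f hp.le (hr'.trans hx)]
    gcongr
    calc ∫⁻ t in Ioc 0 x, (f t : ℝ≥0∞)
        = ∫⁻ t in Ioc 0 (r : ℝ), (f t : ℝ≥0∞) := by
          rw [← Ioc_union_Ioc_eq_Ioc hr'.le (le_of_lt hx),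
            lintegral_union measurableSet_Ioc (Ioc_disjoint_Ioc_of_le le_rfl),
            setLIntegral_congr_fun (s := Ioc (r : ℝ) x) (g := 0) measurableSet_Ioc
              fun t ht => by simp [hs t ht.1]]
          simp
      _ ≤ ∫⁻ _ in Ioc 0 (r : ℝ), (M : ℝ≥0∞) :=
          lintegral_mono fun t => ENNReal.coe_le_coe.2 (hM t)
      _ = _ := by rw [setLIntegral_const, Real.volume_Ioc, sub_zero, ENNReal.ofReal_coe_nnreal]

theorem lintegral_hardy1_rpow_le_of_le_one [SFinite ν] (hp : 0 < p) (hp1 : p ≤ 1) (hC : 0 < C)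
    (hB : ∀ r : ℝ, 0 < r →
        ENNReal.ofReal (r ^ p) * ∫⁻ x in Ioi r, ENNReal.ofReal (x ^ (-p)) ∂ν ≤
          ENNReal.ofReal C * ν (Ioc 0 r))
    {f : ℝ → ℝ≥0} (hm : Measurable f) (ha : AntitoneOn f (Ioi 0))
    (hF : ∀ x, ∫⁻ t in Ioc 0 x, (f t : ℝ≥0∞) ≠ ⊤) :
    ∫⁻ x in Ioi (0 : ℝ), hardy1 f x ^ p ∂ν ≤
      ENNReal.ofReal ((1 + C) / p) * ∫⁻ x in Ioi (0 : ℝ), (f x : ℝ≥0∞) ^ p ∂ν := by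
  have := lintegral_rpow_mul_le_of_Bp ν hp hC hB (h := fun t => f t ^ p) (hm.pow_const p)
    fun x hx y hy hxy => NNReal.rpow_le_rpow (ha hx hy hxy) hp.le
  simp only [← ENNReal.coe_rpow_of_nonneg _ hp.le]
  refine le_trans (setLIntegral_mono' measurableSet_Ioi fun x hx => ?_) this
  rw [hardy1_rpow f hp.le hx]
  gcongr
  exact rpow_setLIntegral_le_of_le_one hm ha hp hp1 (hF x)

theorem lintegral_hardy1_rpow_le_of_one_le [SFinite ν] (hp1 : 1 ≤ p) (hC : 0 < C)
    (hB : ∀ r : ℝ, 0 < r →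
        ENNReal.ofReal (r ^ p) * ∫⁻ x in Ioi r, ENNReal.ofReal (x ^ (-p)) ∂ν ≤
          ENNReal.ofReal C * ν (Ioc 0 r))
    {f : ℝ → ℝ≥0} (hm : Measurable f) (ha : AntitoneOn f (Ioi 0))
    (hF : ∀ x, ∫⁻ t in Ioc 0 x, (f t : ℝ≥0∞) ≠ ⊤)
    (hfin : ∫⁻ x in Ioi (0 : ℝ), hardy1 f x ^ p ∂ν ≠ ⊤) :
    ∫⁻ x in Ioi (0 : ℝ), hardy1 f x ^ p ∂ν ≤
      ENNReal.ofReal ((2 * (2 ^ p * ((1 + C) / p))) ^ p) *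
        ∫⁻ x in Ioi (0 : ℝ), (f x : ℝ≥0∞) ^ p ∂ν := by
  have hp : 0 < p := by linarith
  have hp0 : 0 ≤ p - 1 := by linarith
  set K : ℝ := 2 ^ p * ((1 + C) / p) with hK
  have hK0 : 0 < K := by positivity
  set S : ℝ → ℝ≥0 := fun x => (hardy1 f x).toNNReal with hS
  have hSc {x : ℝ} (hx : 0 < x) : (S x : ℝ≥0∞) = hardy1 f x :=
    ENNReal.coe_toNNReal (ENNReal.div_ne_top (hF x) (by simpa using hx))
  have hSm : Measurable S := (measurable_hardy1 f).ennreal_toNNReal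
  have hSa : AntitoneOn S (Ioi 0) := fun x hx y hy hxy => by
    rw [← ENNReal.coe_le_coe, hSc hx, hSc hy]
    exact antitoneOn_hardy1 ha hx hy hxy
  have hL := lintegral_rpow_mul_le_of_Bp ν hp hC hB (h := fun t => S t ^ (p - 1) * f t)
    ((hSm.pow_const _).mul hm) fun x hx y hy hxy =>
      mul_le_mul' (NNReal.rpow_le_rpow (hSa hx hy hxy) hp0) (ha hx hy hxy)
  set A := ∫⁻ x in Ioi (0 : ℝ), hardy1 f x ^ p ∂ν with hA
  have h1 : A ≤ ENNReal.ofReal K *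
      ∫⁻ x in Ioi (0 : ℝ), ((S x ^ (p - 1) * f x : ℝ≥0) : ℝ≥0∞) ∂ν := by
    rw [hK, ENNReal.ofReal_mul (by positivity), mul_assoc]
    refine le_trans ?_ (mul_le_mul' le_rfl hL)
    rw [← lintegral_const_mul' _ _ ENNReal.ofReal_ne_top]
    refine setLIntegral_mono' measurableSet_Ioi fun x hx => ?_
    rw [hardy1_rpow f hp.le hx, mul_left_comm]
    gcongr
    refine (rpow_setLIntegral_le_of_one_le hm hp1 hx (hF x)).trans_eq ?_
    congr 1
    refine setLIntegral_congr_fun measurableSet_Ioc fun t ht => ?_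
    simp only [ENNReal.coe_mul, ENNReal.coe_rpow_of_nonneg _ hp0, hSc ht.1]
  set ε : ℝ≥0 := (2 * K.toNNReal)⁻¹ with hε
  have hε0 : 0 < ε := by simpa [hε] using hK0
  have h2 : ∫⁻ x in Ioi (0 : ℝ), ((S x ^ (p - 1) * f x : ℝ≥0) : ℝ≥0∞) ∂ν
      ≤ ε * A + ((ε⁻¹ ^ (p - 1) : ℝ≥0) : ℝ≥0∞) * ∫⁻ x in Ioi (0 : ℝ), (f x : ℝ≥0∞) ^ p ∂ν := by
    rw [← lintegral_const_mul' _ _ ENNReal.coe_ne_top, ← lintegral_const_mul' _ _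
      ENNReal.coe_ne_top, ← lintegral_add_left (((measurable_hardy1 f).pow_const p).const_mul _)]
    refine setLIntegral_mono' measurableSet_Ioi fun x hx => ?_
    rw [← hSc hx, ← ENNReal.coe_rpow_of_nonneg _ hp.le, ← ENNReal.coe_rpow_of_nonneg _ hp.le]
    exact_mod_cast NNReal.rpow_sub_one_mul_le hp1 hε0 (S x) (f x)
  set B := ∫⁻ x in Ioi (0 : ℝ), (f x : ℝ≥0∞) ^ p ∂ν with hBd
  have hKε : ENNReal.ofReal K * ε = 2⁻¹ := by
    have : K.toNNReal * ε = 2⁻¹ := by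
      have : K.toNNReal ≠ 0 := by simpa using hK0
      rw [hε]
      field_simp
    rw [ENNReal.ofReal, ← ENNReal.coe_mul, this]
    simp
  have hKp : 2 * (ENNReal.ofReal K * ((ε⁻¹ ^ (p - 1) : ℝ≥0) : ℝ≥0∞))
      = ENNReal.ofReal ((2 * K) ^ p) := by
    have h2K : ENNReal.ofReal (2 * K) = 2 * ENNReal.ofReal K := by
      rw [ENNReal.ofReal_mul two_pos.le]
      simp
    have hε' : ((ε⁻¹ : ℝ≥0) : ℝ≥0∞) = ENNReal.ofReal (2 * K) := by
      rw [h2K, hε, inv_inv]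
      simp [ENNReal.ofReal]
    rw [ENNReal.coe_rpow_of_nonneg _ hp0, hε', ← mul_assoc, ← h2K,
      ← ENNReal.ofReal_rpow_of_pos (by positivity)]
    conv_lhs => rw [← ENNReal.rpow_one (ENNReal.ofReal (2 * K)), ← ENNReal.rpow_mul, one_mul]
    rw [← ENNReal.rpow_add_of_nonneg _ _ zero_le_one hp0, add_sub_cancel]
  have h3 : A / 2 + A / 2 ≤
      A / 2 + ENNReal.ofReal K * ((ε⁻¹ ^ (p - 1) : ℝ≥0) : ℝ≥0∞) * B := by
    rw [ENNReal.add_halves]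
    refine (h1.trans (mul_le_mul' le_rfl h2)).trans_eq ?_
    rw [mul_add, ← mul_assoc, hKε, div_eq_mul_inv, mul_comm A, mul_assoc]
  have h4 := (ENNReal.add_le_add_iff_left (ENNReal.div_ne_top hfin two_ne_zero)).1 h3
  rw [← hKp, mul_assoc, ← ENNReal.div_le_iff' two_ne_zero ENNReal.ofNat_ne_top]
  exact h4

end Bp

/-- Truncation of `f` to height `n` and to the half-line `(-∞, n]`. -/
noncomputable def truncate (f : ℝ → ℝ≥0) (n : ℕ) : ℝ → ℝ≥0 :=
  (Iic (n : ℝ)).indicator fun t => min (f t) n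

theorem truncate_le (f : ℝ → ℝ≥0) (n : ℕ) (t : ℝ) : truncate f n t ≤ f t :=
  indicator_le' (fun _ _ => min_le_left _ _) (fun _ _ => zero_le) t

theorem truncate_le_natCast (f : ℝ → ℝ≥0) (n : ℕ) (t : ℝ) : truncate f n t ≤ n :=
  indicator_le' (g := fun _ => (n : ℝ≥0)) (fun _ _ => min_le_right _ _) (fun _ _ => zero_le) t

theorem truncate_of_lt (f : ℝ → ℝ≥0) {n : ℕ} {t : ℝ} (h : n < t) : truncate f n t = 0 :=
  indicator_of_notMem (by simpa using h) _

theorem measurable_truncate {f : ℝ → ℝ≥0} (hm : Measurable f) (n : ℕ) :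
    Measurable (truncate f n) :=
  (hm.min measurable_const).indicator measurableSet_Iic

theorem antitoneOn_truncate {f : ℝ → ℝ≥0} (ha : AntitoneOn f (Ioi 0)) (n : ℕ) :
    AntitoneOn (truncate f n) (Ioi 0) := by
  intro x hx y hy hxy
  by_cases h : y ≤ n
  · simp only [truncate, indicator_of_mem (show y ∈ Iic (n : ℝ) from h),
      indicator_of_mem (show x ∈ Iic (n : ℝ) from hxy.trans h)]
    exact min_le_min_right _ (ha hx hy hxy)
  · rw [truncate_of_lt f (not_le.1 h)]
    exact zero_le

theorem monotone_truncate (f : ℝ → ℝ≥0) (t : ℝ) : Monotone fun n => truncate f n t := by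
  intro m n hmn
  have hmn' : (m : ℝ) ≤ n := by exact_mod_cast hmn
  by_cases h : t ≤ m
  · simp only [truncate, indicator_of_mem (show t ∈ Iic (m : ℝ) from h),
      indicator_of_mem (show t ∈ Iic (n : ℝ) from h.trans hmn')]
    gcongr
  · simp only [truncate_of_lt f (not_le.1 h)]
    exact zero_le

theorem tendsto_truncate (f : ℝ → ℝ≥0) (t : ℝ) :
    Filter.Tendsto (fun n => truncate f n t) Filter.atTop (nhds (f t)) := by
  obtain ⟨N, hN⟩ := exists_nat_ge (max t (f t))
  refine tendsto_const_nhds.congr' ?_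
  filter_upwards [Filter.eventually_ge_atTop N] with n hn
  have hn' : max t (f t) ≤ n := hN.trans (by exact_mod_cast hn)
  rw [truncate, indicator_of_mem (show t ∈ Iic (n : ℝ) from (le_max_left _ _).trans hn'),
    min_eq_left]
  exact_mod_cast (le_max_right _ _).trans hn'

theorem tendsto_hardy1_truncate {f : ℝ → ℝ≥0} (hm : Measurable f) {x : ℝ} (hx : 0 < x) :
    Filter.Tendsto (fun n => hardy1 (truncate f n) x) Filter.atTop (nhds (hardy1 f x)) := by
  refine ENNReal.Tendsto.div_const ?_ (Or.inr (by simpa using hx))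
  refine lintegral_tendsto_of_tendsto_of_monotone
    (fun n => (measurable_truncate hm n).coe_nnreal_ennreal.aemeasurable)
    (Filter.Eventually.of_forall fun t m n hmn => ?_)
    (Filter.Eventually.of_forall fun t => ?_)
  · exact ENNReal.coe_le_coe.2 (monotone_truncate f t hmn)
  · exact ENNReal.tendsto_coe.2 (tendsto_truncate f t)

theorem setLIntegral_truncate_ne_top (f : ℝ → ℝ≥0) (n : ℕ) (x : ℝ) :
    ∫⁻ t in Ioc 0 x, (truncate f n t : ℝ≥0∞) ≠ ⊤ := by
  refine ne_top_of_le_ne_top (b := ∫⁻ _ in Ioc 0 x, ((n : ℝ≥0) : ℝ≥0∞)) ?_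
    (lintegral_mono fun t => ENNReal.coe_le_coe.2 (truncate_le_natCast f n t))
  rw [setLIntegral_const, Real.volume_Ioc]
  finiteness

/-- An `L^p` bound for the Hardy operator passes from the truncations of `f` to `f`. -/
theorem lintegral_hardy1_rpow_le_of_truncate {ν : Measure ℝ} {p : ℝ} (hp : 0 < p) {K : ℝ≥0∞}
    {f : ℝ → ℝ≥0} (hm : Measurable f)
    (h : ∀ n : ℕ, 0 < n → ∫⁻ x in Ioi (0 : ℝ), hardy1 (truncate f n) x ^ p ∂ν ≤
      K * ∫⁻ x in Ioi (0 : ℝ), (truncate f n x : ℝ≥0∞) ^ p ∂ν) :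
    ∫⁻ x in Ioi (0 : ℝ), hardy1 f x ^ p ∂ν ≤ K * ∫⁻ x in Ioi (0 : ℝ), (f x : ℝ≥0∞) ^ p ∂ν := by
  have hlim : Filter.Tendsto (fun n => ∫⁻ x in Ioi (0 : ℝ), hardy1 (truncate f n) x ^ p ∂ν)
      Filter.atTop (nhds (∫⁻ x in Ioi (0 : ℝ), hardy1 f x ^ p ∂ν)) := by
    refine lintegral_tendsto_of_tendsto_of_monotone
      (fun n => ((measurable_hardy1 _).pow_const p).aemeasurable)
      (Filter.Eventually.of_forall fun x m n hmn => ?_)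
      ((ae_restrict_iff' measurableSet_Ioi).2 (Filter.Eventually.of_forall fun x hx => ?_))
    · exact ENNReal.rpow_le_rpow (hardy1_mono (fun t => monotone_truncate f t hmn) x) hp.le
    · exact (ENNReal.continuous_rpow_const.tendsto _).comp (tendsto_hardy1_truncate hm hx)
  refine le_of_tendsto hlim ?_
  filter_upwards [Filter.eventually_gt_atTop 0] with n hn
  refine (h n hn).trans ?_
  gcongr with x
  exact truncate_le f n x

theorem Bp_of_hardy1_bound {ν : Measure ℝ} {p C : ℝ} (hp : 0 < p)
    (hC : ∀ f : ℝ → ℝ≥0, Measurable f → (∀ x y : ℝ, 0 < x → x ≤ y → f y ≤ f x) →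
        ∫⁻ x in Ioi (0 : ℝ), hardy1 f x ^ p ∂ν ≤
          ENNReal.ofReal C * ∫⁻ x in Ioi (0 : ℝ), (f x : ℝ≥0∞) ^ p ∂ν)
    {r : ℝ} (hr : 0 < r) :
    ENNReal.ofReal (r ^ p) * ∫⁻ x in Ioi r, ENNReal.ofReal (x ^ (-p)) ∂ν ≤
      ENNReal.ofReal C * ν (Ioc 0 r) := by
  have h := hC ((Ioc 0 r).indicator 1) (measurable_one.indicator measurableSet_Ioc)
    fun x y hx hxy => by
      by_cases hy : y ≤ r
      · rw [indicator_of_mem (show y ∈ Ioc 0 r from ⟨hx.trans_le hxy, hy⟩),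
          indicator_of_mem (show x ∈ Ioc 0 r from ⟨hx, hxy.trans hy⟩)]
        simp
      · rw [indicator_of_notMem fun h => hy h.2]
        exact zero_le
  have hR : ∫⁻ x in Ioi (0 : ℝ), (((Ioc 0 r).indicator 1 x : ℝ≥0) : ℝ≥0∞) ^ p ∂ν
      = ν (Ioc 0 r) := by
    have : ∀ x, (((Ioc 0 r).indicator 1 x : ℝ≥0) : ℝ≥0∞) ^ p
        = (Ioc 0 r).indicator 1 x := fun x => by
      by_cases hx : x ∈ Ioc 0 r <;> simp [hx, hp, indicator]
    simp_rw [this]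
    rw [lintegral_indicator_one measurableSet_Ioc, Measure.restrict_apply measurableSet_Ioc,
      inter_eq_left.2 Ioc_subset_Ioi_self]
  rw [hR] at h
  refine le_trans ?_ h
  rw [← lintegral_const_mul' _ _ ENNReal.ofReal_ne_top]
  refine le_trans (setLIntegral_mono' measurableSet_Ioi fun x hx => ?_)
    (lintegral_mono_set (Ioi_subset_Ioi hr.le))
  rw [hardy1_rpow _ hp.le (hr.trans hx), mul_comm, ← ENNReal.ofReal_rpow_of_pos hr]
  gcongr
  calc ENNReal.ofReal r = ∫⁻ _ in Ioc 0 r, 1 := by simp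
    _ = ∫⁻ t in Ioc 0 r, (((Ioc 0 r).indicator 1 t : ℝ≥0) : ℝ≥0∞) :=
        setLIntegral_congr_fun measurableSet_Ioc fun t ht => by simp [indicator_of_mem ht]
    _ ≤ _ := lintegral_mono_set (Ioc_subset_Ioc_right (le_of_lt hx))

theorem eqOn_zero_of_lintegral_rpow_ne_top {ν : Measure ℝ} {p : ℝ} (hp : 0 < p)
    (hν : ∀ r : ℝ, 0 < r → ν (Ioc 0 r) = ⊤) {f : ℝ → ℝ≥0} (ha : AntitoneOn f (Ioi 0))
    (hf : ∫⁻ x in Ioi (0 : ℝ), (f x : ℝ≥0∞) ^ p ∂ν ≠ ⊤) : EqOn f 0 (Ioi 0) := by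
  intro x hx
  by_contra h
  refine hf (top_le_iff.1 ?_)
  calc ⊤ = ∫⁻ _ in Ioc 0 x, (f x : ℝ≥0∞) ^ p ∂ν := by
        rw [setLIntegral_const, hν x hx, ENNReal.mul_top]
        simpa [hp.le, hp] using h
    _ ≤ ∫⁻ t in Ioc 0 x, (f t : ℝ≥0∞) ^ p ∂ν :=
        setLIntegral_mono' measurableSet_Ioc fun t ht =>
          ENNReal.rpow_le_rpow (ENNReal.coe_le_coe.2 (ha ht.1 hx ht.2)) hp.le
    _ ≤ _ := lintegral_mono_set Ioc_subset_Ioi_self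

/-- For a σ-finite Borel measure `ν` on `(0,∞)` and `0 < p < ∞`, the Hardy
operator is bounded on nonnegative decreasing functions, `∫ (Sf)^p dν ≤ C ∫ f^p dν`, if and
only if the `B_p` condition `r^p ∫_{(r,∞)} x^(-p) dν(x) ≤ C ν((0,r])` holds for all `r > 0`. -/
theorem stmt4 (ν : Measure ℝ) [SigmaFinite ν] (p : ℝ) (hp : 0 < p) :
    (∃ C : ℝ, 0 < C ∧ ∀ f : ℝ → ℝ≥0, Measurable f →
        (∀ x y : ℝ, 0 < x → x ≤ y → f y ≤ f x) →
        ∫⁻ x in Set.Ioi (0 : ℝ), hardy1 f x ^ p ∂ν ≤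
          ENNReal.ofReal C * ∫⁻ x in Set.Ioi (0 : ℝ), (f x : ℝ≥0∞) ^ p ∂ν) ↔
      (∃ C : ℝ, 0 < C ∧ ∀ r : ℝ, 0 < r →
        ENNReal.ofReal (r ^ p) * ∫⁻ x in Set.Ioi r, ENNReal.ofReal (x ^ (-p)) ∂ν ≤
          ENNReal.ofReal C * ν (Set.Ioc 0 r)) := by
  refine ⟨fun ⟨C, hC, h⟩ => ⟨C, hC, fun r hr => Bp_of_hardy1_bound hp h hr⟩, ?_⟩
  rintro ⟨C, hC, hB⟩
  rcases le_total p 1 with hp1 | hp1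
  · refine ⟨(1 + C) / p, by positivity, fun f hm hf => ?_⟩
    have ha : AntitoneOn f (Ioi 0) := fun x hx y _ hxy => hf x y hx hxy
    exact lintegral_hardy1_rpow_le_of_truncate hp hm fun n _ =>
      lintegral_hardy1_rpow_le_of_le_one hp hp1 hC hB (measurable_truncate hm n)
        (antitoneOn_truncate ha n) (setLIntegral_truncate_ne_top f n)
  · refine ⟨(2 * (2 ^ p * ((1 + C) / p))) ^ p, by positivity, fun f hm hf => ?_⟩
    have ha : AntitoneOn f (Ioi 0) := fun x hx y _ hxy => hf x y hx hxy
    by_cases hν : ∀ r : ℝ, 0 < r → ν (Ioc 0 r) = ⊤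
    · by_cases hfin : ∫⁻ x in Ioi (0 : ℝ), (f x : ℝ≥0∞) ^ p ∂ν = ⊤
      · rw [hfin, ENNReal.mul_top]
        · exact le_top
        · have : 0 < (2 * (2 ^ p * ((1 + C) / p))) ^ p := by positivity
          simpa using this
      · have h0 := eqOn_zero_of_lintegral_rpow_ne_top hp hν ha hfin
        have hS (x : ℝ) : hardy1 f x = 0 := by
          rw [hardy1, setLIntegral_congr_fun (g := 0) measurableSet_Ioc
            fun t ht => by simp [h0 (show t ∈ Ioi 0 from ht.1)]]
          simp
        simp [hS, hp]
    · push Not at hν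
      obtain ⟨r, hr, hfin⟩ := hν
      exact lintegral_hardy1_rpow_le_of_truncate hp hm fun n hn =>
        lintegral_hardy1_rpow_le_of_one_le hp1 hC hB (measurable_truncate hm n)
          (antitoneOn_truncate ha n) (setLIntegral_truncate_ne_top f n)
          (lintegral_hardy1_rpow_ne_top_of_Bp hp hB (r := n) (M := n) (by exact_mod_cast hn)
            (measure_Ioc_ne_top_of_Bp hp hB hr hfin _) (truncate_le_natCast f n)
            fun t ht => truncate_of_lt f (by simpa using ht))
end

section
/- Let ν be a σ-finite Borel measure on (0,∞)² and 0 < p < ∞, and let T f(x,t) = (1/t)∫₀^t f(x,s) ds. There exists C > 0 with ∫_{(0,∞)²} (Tf)^p dν ≤ C ∫_{(0,∞)²} f^p dν for every nonnegative measurable f on (0,∞)² that is decreasing in each variable, if and only if there exists C > 0 such that for every decreasing set D ⊆ (0,∞)², ∫_{(0,∞)²∖D} (|D_x|/t)^p dν(x,t) ≤ C ν(D), where D_x = {t > 0 : (x,t) ∈ D} and |·| denotes one-dimensional Lebesgue measure. -/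
open MeasureTheory Set
open scoped ENNReal NNReal

/-- A set `D ⊆ (0,∞)²` is decreasing if its indicator is decreasing in each variable. -/
def DecSet2 (D : Set (ℝ × ℝ)) : Prop :=
  D ⊆ Set.Ioi 0 ×ˢ Set.Ioi 0 ∧
    ∀ z ∈ D, ∀ w : ℝ × ℝ, 0 < w.1 → w.1 ≤ z.1 → 0 < w.2 → w.2 ≤ z.2 → w ∈ D

/-- A function on `(0,∞)²` is decreasing in each variable. -/
def DecFun2 (f : ℝ × ℝ → ℝ≥0) : Prop :=
  ∀ x y x' y' : ℝ, 0 < x' → x' ≤ x → 0 < y' → y' ≤ y → f (x, y) ≤ f (x', y')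

/-- The partial Hardy operator `Tf(x,t) = (1/t) ∫₀^t f(x,s) ds`. -/
noncomputable def hardyT (f : ℝ × ℝ → ℝ≥0) (z : ℝ × ℝ) : ℝ≥0∞ :=
  (∫⁻ s in Set.Ioc 0 z.2, (f (z.1, s) : ℝ≥0∞)) / ENNReal.ofReal z.2

theorem Antitone.integral_add_le {φ : ℝ → ℝ} (hφ : Antitone φ) {s t : ℝ} (hst : s ≤ t) :
    ∫ u in (0 : ℝ)..t, φ u ≤ (∫ u in (0 : ℝ)..s, φ u) + (t - s) * φ s := by
  have hi : ∀ a b : ℝ, IntervalIntegrable φ volume a b := fun a b => hφ.intervalIntegrable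
  rw [← intervalIntegral.integral_add_adjacent_intervals (hi 0 s) (hi s t)]
  have : ∫ u in s..t, φ u ≤ ∫ _ in s..t, φ s :=
    intervalIntegral.integral_mono_on hst (hi s t) intervalIntegrable_const
      fun u hu => hφ hu.1
  simpa using this

theorem Antitone.mul_le_integral {φ : ℝ → ℝ} (hφ : Antitone φ) {s : ℝ} (hs : 0 ≤ s) :
    s * φ s ≤ ∫ u in (0 : ℝ)..s, φ u := by
  have : ∫ _ in (0 : ℝ)..s, φ s ≤ ∫ u in (0 : ℝ)..s, φ u :=
    intervalIntegral.integral_mono_on hs intervalIntegrable_const hφ.intervalIntegrable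
      fun u hu => hφ hu.2
  simpa using this

theorem Antitone.mul_integral_le_mul_integral {φ : ℝ → ℝ} (hφ : Antitone φ) {s t : ℝ}
    (hs : 0 ≤ s) (hst : s ≤ t) :
    s * ∫ u in (0 : ℝ)..t, φ u ≤ t * ∫ u in (0 : ℝ)..s, φ u := by
  have h1 := hφ.integral_add_le hst
  have h2 := hφ.mul_le_integral hs
  nlinarith [mul_le_mul_of_nonneg_left h1 hs, mul_le_mul_of_nonneg_left h2 (sub_nonneg.2 hst)]

theorem Antitone.rpow_integral_sub_rpow_integral {φ : ℝ → ℝ} (hφ : Antitone φ) (p : ℝ)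
    {a t : ℝ} (hat : a ≤ t)
    (hpos : ∀ s ∈ Icc a t, 0 < ∫ u in (0 : ℝ)..s, φ u) :
    IntervalIntegrable (fun s => p * (∫ u in (0 : ℝ)..s, φ u) ^ (p - 1) * φ s) volume a t ∧
    ∫ s in a..t, p * (∫ u in (0 : ℝ)..s, φ u) ^ (p - 1) * φ s =
      (∫ u in (0 : ℝ)..t, φ u) ^ p - (∫ u in (0 : ℝ)..a, φ u) ^ p := by
  have hi : ∀ a b : ℝ, IntervalIntegrable φ volume a b := fun a b => hφ.intervalIntegrable
  have hc : Continuous fun s : ℝ => ∫ u in (0 : ℝ)..s, φ u :=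
    intervalIntegral.continuous_primitive hi 0
  have hint : IntervalIntegrable (fun s => p * (∫ u in (0 : ℝ)..s, φ u) ^ (p - 1) * φ s)
      volume a t := by
    refine (hi a t).continuousOn_mul ?_
    rw [uIcc_of_le hat]
    exact continuousOn_const.mul
      (hc.continuousOn.rpow_const fun s hs => Or.inl (hpos s hs).ne')
  refine ⟨hint, ?_⟩
  refine integral_eq_of_hasDerivAt_off_countable_of_le
    (fun s => (∫ u in (0 : ℝ)..s, φ u) ^ p) _ hat hφ.countable_not_continuousAt
    (hc.continuousOn.rpow_const fun s hs => Or.inl (hpos s hs).ne') ?_ hint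
  intro s hs
  have hcs : ContinuousAt φ s := by simpa using hs.2
  have hd : HasDerivAt (fun s => ∫ u in (0 : ℝ)..s, φ u) (φ s) s :=
    intervalIntegral.integral_hasDerivAt_right (hi 0 s)
      (hφ.measurable.stronglyMeasurable.stronglyMeasurableAtFilter) hcs
  exact (hd.rpow_const (p := p) (Or.inl (hpos s ⟨hs.1.1.le, hs.1.2.le⟩).ne')).congr_deriv (by ring)

theorem Antitone.ofReal_integral_rpow_le {φ : ℝ → ℝ} (hφ : Antitone φ) (h0 : ∀ s, 0 ≤ φ s)
    {p : ℝ} (hp : 0 < p) {t : ℝ} (ht : 0 < t) :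
    ENNReal.ofReal (∫ u in (0 : ℝ)..t, φ u) ^ p ≤
      ∫⁻ s in Ioc 0 t, ENNReal.ofReal p *
        ENNReal.ofReal (∫ u in (0 : ℝ)..s, φ u) ^ (p - 1) * ENNReal.ofReal (φ s) := by
  set F : ℝ → ℝ := fun s => ∫ u in (0 : ℝ)..s, φ u with hF
  have hF0 : ∀ s, 0 ≤ s → 0 ≤ F s := fun s hs =>
    intervalIntegral.integral_nonneg hs fun u _ => h0 u
  rcases (hF0 t ht.le).eq_or_lt with h | hFt
  · change ENNReal.ofReal (F t) ^ p ≤ _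
    rw [← h, ENNReal.ofReal_zero, ENNReal.zero_rpow_of_pos hp]
    exact zero_le
  have hpos : ∀ s, 0 < s → s ≤ t → 0 < F s := by
    intro s hs hst
    have h1 := hφ.mul_integral_le_mul_integral hs.le hst
    have h2 : 0 < s * F t := mul_pos hs hFt
    exact pos_of_mul_pos_right (h2.trans_le h1) ht.le
  have key : ∀ a, 0 < a → a ≤ t → ENNReal.ofReal (F t ^ p - F a ^ p) ≤
      ∫⁻ s in Ioc 0 t, ENNReal.ofReal p *
        ENNReal.ofReal (F s) ^ (p - 1) * ENNReal.ofReal (φ s) := by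
    intro a ha hat
    obtain ⟨hi, he⟩ := hφ.rpow_integral_sub_rpow_integral p hat
      fun s hs => hpos s (ha.trans_le hs.1) hs.2
    change ∫ s in a..t, p * F s ^ (p - 1) * φ s = F t ^ p - F a ^ p at he
    rw [← he, intervalIntegral.integral_of_le hat, ofReal_integral_eq_lintegral_ofReal]
    · refine (setLIntegral_mono' measurableSet_Ioc fun s hs => ?_).trans
        (lintegral_mono_set (Ioc_subset_Ioc_left ha.le))
      have hs' := hpos s (ha.trans hs.1) hs.2
      rw [ENNReal.ofReal_mul (by positivity), ENNReal.ofReal_mul hp.le,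
        ENNReal.ofReal_rpow_of_pos hs']
    · exact (intervalIntegrable_iff_integrableOn_Ioc_of_le hat).1 hi
    · refine (ae_restrict_iff' measurableSet_Ioc).2 (Filter.Eventually.of_forall fun s hs => ?_)
      have hs' := hpos s (ha.trans hs.1) hs.2
      have := h0 s
      simp only [Pi.zero_apply]
      positivity
  rw [ENNReal.ofReal_rpow_of_pos hFt]
  have hc : Continuous F :=
    intervalIntegral.continuous_primitive (fun a b => hφ.intervalIntegrable) 0
  have hlim : Filter.Tendsto (fun a => ENNReal.ofReal (F t ^ p - F a ^ p)) (nhdsWithin 0 (Ioi 0))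
      (nhds (ENNReal.ofReal (F t ^ p))) := by
    have : Filter.Tendsto (fun a => ENNReal.ofReal (F t ^ p - F a ^ p)) (nhds 0)
        (nhds (ENNReal.ofReal (F t ^ p - F 0 ^ p))) :=
      (ENNReal.continuous_ofReal.comp (continuous_const.sub
        (hc.rpow_const fun _ => Or.inr hp.le))).tendsto 0
    have hF00 : F 0 ^ p = 0 := by simp [hF, Real.zero_rpow hp.ne']
    rw [hF00, sub_zero] at this
    exact this.mono_left nhdsWithin_le_nhds
  refine _root_.le_of_tendsto hlim ?_
  filter_upwards [Ioc_mem_nhdsGT ht] with a ha using key a ha.1 ha.2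
/-- The open quadrant `(0,∞)²`. -/
abbrev quadrant : Set (ℝ × ℝ) := Set.Ioi 0 ×ˢ Set.Ioi 0

theorem measurableSet_quadrant : MeasurableSet quadrant :=
  measurableSet_Ioi.prod measurableSet_Ioi

/-- The Lebesgue measure of the vertical section `D_x`. -/
noncomputable def sectionLength (D : Set (ℝ × ℝ)) (x : ℝ) : ℝ≥0∞ :=
  volume {t : ℝ | 0 < t ∧ (x, t) ∈ D}

/-- `min(t, |D_x|) / t`. -/
noncomputable def truncRatio (D : Set (ℝ × ℝ)) (z : ℝ × ℝ) : ℝ≥0∞ :=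
  min (ENNReal.ofReal z.2) (sectionLength D z.1) / ENNReal.ofReal z.2

theorem lintegral_rpow_Ioc {p : ℝ} (hp : 0 < p) {m : ℝ} (hm : 0 ≤ m) :
    ∫⁻ s in Ioc 0 m, ENNReal.ofReal (p * s ^ (p - 1)) = ENNReal.ofReal (m ^ p) := by
  have hi : IntervalIntegrable (fun s : ℝ => p * s ^ (p - 1)) volume 0 m :=
    (intervalIntegral.intervalIntegrable_rpow' (by linarith)).const_mul p
  rw [← ofReal_integral_eq_lintegral_ofReal
    ((intervalIntegrable_iff_integrableOn_Ioc_of_le hm).1 hi),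
    ← intervalIntegral.integral_of_le hm, intervalIntegral.integral_const_mul,
    integral_rpow (Or.inl (by linarith))]
  · rw [sub_add_cancel, Real.zero_rpow hp.ne', sub_zero, mul_div_cancel₀ _ hp.ne']
  · refine (ae_restrict_iff' measurableSet_Ioc).2 (Filter.Eventually.of_forall fun s hs => ?_)
    have := hs.1
    simp only [Pi.zero_apply]
    positivity

theorem DecSet2.ofReal_le_sectionLength {D : Set (ℝ × ℝ)} (hD : DecSet2 D) {x s : ℝ}
    (hx : 0 < x) (hs : (x, s) ∈ D) : ENNReal.ofReal s ≤ sectionLength D x := by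
  have : Ioc 0 s ⊆ {t : ℝ | 0 < t ∧ (x, t) ∈ D} := fun u hu =>
    ⟨hu.1, hD.2 _ hs (x, u) hx le_rfl hu.1 hu.2⟩
  simpa [sectionLength] using measure_mono (μ := volume) this

theorem DecSet2.lintegral_section_le {D : Set (ℝ × ℝ)} (hD : DecSet2 D) {p : ℝ} (hp : 0 < p)
    {z : ℝ × ℝ} (hz : z ∈ quadrant) :
    (∫⁻ s in {s | (z.1, s) ∈ D} ∩ Ioc 0 z.2, ENNReal.ofReal (p * s ^ (p - 1))) /
      ENNReal.ofReal z.2 ^ p ≤ truncRatio D z ^ p := by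
  set m : ℝ≥0∞ := min (ENNReal.ofReal z.2) (sectionLength D z.1) with hm
  have hmt : m ≠ ⊤ := ne_top_of_le_ne_top ENNReal.ofReal_ne_top (min_le_left _ _)
  have hsub : {s | (z.1, s) ∈ D} ∩ Ioc 0 z.2 ⊆ Ioc 0 m.toReal := by
    rintro s ⟨hs, h0, hle⟩
    refine ⟨h0, (ENNReal.ofReal_le_iff_le_toReal hmt).1 (le_min ?_ ?_)⟩
    · exact ENNReal.ofReal_le_ofReal hle
    · exact hD.ofReal_le_sectionLength hz.1 hs
  rw [truncRatio, ← hm, ENNReal.div_rpow_of_nonneg _ _ hp.le]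
  gcongr
  refine (lintegral_mono_set hsub).trans ?_
  rw [lintegral_rpow_Ioc hp ENNReal.toReal_nonneg,
    ← ENNReal.ofReal_rpow_of_nonneg ENNReal.toReal_nonneg hp.le, ENNReal.ofReal_toReal hmt]

/-- The condition on decreasing sets, with an extended nonnegative constant. -/
def SetCondition (ν : Measure (ℝ × ℝ)) (p : ℝ) (K : ℝ≥0∞) : Prop :=
  ∀ D : Set (ℝ × ℝ), DecSet2 D →
    ∫⁻ z in quadrant \ D, (sectionLength D z.1 / ENNReal.ofReal z.2) ^ p ∂ν ≤ K * ν D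

theorem SetCondition.lintegral_truncRatio_le {ν : Measure (ℝ × ℝ)} {p : ℝ} {K : ℝ≥0∞}
    (h : SetCondition ν p K) (hp : 0 < p) {D : Set (ℝ × ℝ)} (hD : DecSet2 D)
    (hDm : MeasurableSet D) :
    ∫⁻ z in quadrant, truncRatio D z ^ p ∂ν ≤ (1 + K) * ν D := by
  rw [← lintegral_inter_add_sdiff _ quadrant hDm, inter_eq_self_of_subset_right hD.1, add_mul,
    one_mul]
  refine add_le_add ?_ ((lintegral_mono fun z => ?_).trans (h D hD))
  · refine (lintegral_mono (g := fun _ => 1) fun z => ?_).trans (by simp)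
    refine ENNReal.rpow_le_one (ENNReal.div_le_of_le_mul ?_) hp.le
    rw [one_mul]
    exact min_le_left _ _
  · unfold truncRatio
    gcongr
    exact min_le_right _ _

/-- The superlevel set of a function on the quadrant. -/
def superlevel (g : ℝ × ℝ → ℝ≥0) (l : ℝ) : Set (ℝ × ℝ) := quadrant ∩ {z | l < g z}

theorem DecFun2.decSet2_superlevel {g : ℝ × ℝ → ℝ≥0} (hg : DecFun2 g) (l : ℝ) :
    DecSet2 (superlevel g l) := by
  refine ⟨inter_subset_left, ?_⟩
  rintro ⟨x, y⟩ hz ⟨x', y'⟩ hx hx' hy hy'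
  have hle : (g (x, y) : ℝ) ≤ g (x', y') := mod_cast hg x y x' y' hx hx' hy hy'
  exact ⟨⟨hx, hy⟩, lt_of_lt_of_le hz.2.out hle⟩

theorem measurableSet_superlevel {g : ℝ × ℝ → ℝ≥0} (hg : Measurable g) (l : ℝ) :
    MeasurableSet (superlevel g l) :=
  measurableSet_quadrant.inter (measurableSet_lt measurable_const hg.coe_nnreal_real)

theorem lintegral_coe_eq_lintegral_meas_lt {α : Type*} [MeasurableSpace α] (μ : Measure α)
    {g : α → ℝ≥0} (hg : Measurable g) :
    ∫⁻ a, (g a : ℝ≥0∞) ∂μ = ∫⁻ l in Ioi (0 : ℝ), μ {a | l < g a} := by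
  rw [← lintegral_eq_lintegral_meas_lt μ (f := fun a => (g a : ℝ))
    (Filter.Eventually.of_forall fun a => (g a).2) hg.coe_nnreal_real.aemeasurable]
  simp

theorem measurable_truncRatio_superlevel {g : ℝ × ℝ → ℝ≥0} (hg : Measurable g) :
    Measurable fun q : (ℝ × ℝ) × ℝ => truncRatio (superlevel g q.2) q.1 := by
  have hs : MeasurableSet {r : ((ℝ × ℝ) × ℝ) × ℝ |
      0 < r.2 ∧ (r.1.1.1, r.2) ∈ superlevel g r.1.2} := by
    have hm : Measurable fun r : ((ℝ × ℝ) × ℝ) × ℝ => (r.1.1.1, r.2) := by fun_prop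
    refine (measurableSet_lt measurable_const measurable_snd).inter
      ((hm measurableSet_quadrant).inter (measurableSet_lt ?_ (hg.comp hm).coe_nnreal_real))
    fun_prop
  have h : Measurable fun q : (ℝ × ℝ) × ℝ => sectionLength (superlevel g q.2) q.1.1 :=
    measurable_measure_prodMk_left (ν := volume) hs
  unfold truncRatio
  have h2 : Measurable fun q : (ℝ × ℝ) × ℝ => ENNReal.ofReal q.1.2 := by fun_prop
  exact (h2.min h).div h2

/-- The averaging operator `t⁻ᵖ ∫₀ᵗ p sᵖ⁻¹ g(x,s) ds`. -/
noncomputable def powAvg (p : ℝ) (g : ℝ × ℝ → ℝ≥0) (z : ℝ × ℝ) : ℝ≥0∞ :=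
  (∫⁻ s in Ioc 0 z.2, ENNReal.ofReal (p * s ^ (p - 1)) * g (z.1, s)) / ENNReal.ofReal z.2 ^ p

theorem powAvg_le {g : ℝ × ℝ → ℝ≥0} (hg : Measurable g) (hdec : DecFun2 g) {p : ℝ} (hp : 0 < p)
    {z : ℝ × ℝ} (hz : z ∈ quadrant) :
    powAvg p g z ≤ ∫⁻ l in Ioi (0 : ℝ), truncRatio (superlevel g l) z ^ p := by
  have hk : Measurable fun s : ℝ => ENNReal.ofReal (p * s ^ (p - 1)) := by fun_prop
  have hgz : Measurable fun s => g (z.1, s) := by fun_prop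
  have h := lintegral_withDensity_eq_lintegral_mul (volume.restrict (Ioc 0 z.2)) hk
    hgz.coe_nnreal_ennreal
  rw [lintegral_coe_eq_lintegral_meas_lt _ hgz] at h
  simp only [Pi.mul_apply] at h
  rw [powAvg, ← h, ENNReal.div_eq_inv_mul, ← lintegral_const_mul' _ _ (by
    simp [ENNReal.inv_eq_top, ENNReal.rpow_eq_zero_iff, hz.2.out, hp.not_gt, not_le])]
  refine lintegral_mono fun l => ?_
  refine le_trans ?_ ((hdec.decSet2_superlevel l).lintegral_section_le hp hz)
  have hl : MeasurableSet {s : ℝ | l < g (z.1, s)} :=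
    measurableSet_lt measurable_const hgz.coe_nnreal_real
  rw [withDensity_apply _ hl, Measure.restrict_restrict hl, ENNReal.div_eq_inv_mul]
  refine mul_le_mul' le_rfl (lintegral_mono_set ?_)
  exact fun s hs => ⟨⟨⟨hz.1, hs.2.1⟩, hs.1⟩, hs.2⟩

theorem SetCondition.lintegral_powAvg_le {ν : Measure (ℝ × ℝ)} [SigmaFinite ν] {p : ℝ} {K : ℝ≥0∞}
    (h : SetCondition ν p K) (hp : 0 < p) {g : ℝ × ℝ → ℝ≥0} (hg : Measurable g)
    (hdec : DecFun2 g) :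
    ∫⁻ z in quadrant, powAvg p g z ∂ν ≤ (1 + K) * ∫⁻ z in quadrant, (g z : ℝ≥0∞) ∂ν := by
  refine (setLIntegral_mono' measurableSet_quadrant fun z hz => powAvg_le hg hdec hp hz).trans ?_
  rw [lintegral_lintegral_swap ((measurable_truncRatio_superlevel hg).pow_const p).aemeasurable,
    lintegral_coe_eq_lintegral_meas_lt _ hg]
  refine (lintegral_mono fun l => h.lintegral_truncRatio_le hp (hdec.decSet2_superlevel l)
    (measurableSet_superlevel hg l)).trans ?_
  have hm : ∀ l : ℝ, ν.restrict quadrant {z | l < g z} = ν (superlevel g l) := fun l => by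
    rw [Measure.restrict_apply (measurableSet_lt measurable_const hg.coe_nnreal_real),
      inter_comm, superlevel]
  simp only [hm]
  rw [lintegral_const_mul'']
  refine Measurable.aemeasurable (Antitone.measurable fun a b hab => measure_mono ?_)
  exact fun z hz => ⟨hz.1, lt_of_le_of_lt hab hz.2⟩

theorem DecFun2.exists_antitone_section {f : ℝ × ℝ → ℝ≥0} (hf : DecFun2 f) {M : ℝ≥0}
    (hM : ∀ z, f z ≤ M) {x : ℝ} (hx : 0 < x) :
    ∃ φ : ℝ → ℝ, Antitone φ ∧ (∀ s, 0 ≤ φ s) ∧ (∀ s, 0 < s → φ s = f (x, s)) ∧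
      ∀ t, 0 ≤ t →
        ∫⁻ s in Ioc 0 t, (f (x, s) : ℝ≥0∞) = ENNReal.ofReal (∫ s in (0 : ℝ)..t, φ s) := by
  have hφ : Antitone fun s : ℝ => if s ≤ 0 then (M : ℝ) else f (x, s) := by
    intro a b hab
    by_cases ha : a ≤ 0
    · by_cases hb : b ≤ 0
      · simp [ha, hb]
      · simpa [ha, hb] using hM _
    · have hb : ¬ b ≤ 0 := fun hb => ha (hab.trans hb)
      simpa [ha, hb] using hf x b x a hx le_rfl (not_le.1 ha) hab
  have h0 : ∀ s : ℝ, 0 ≤ if s ≤ 0 then (M : ℝ) else f (x, s) := fun s => by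
    split_ifs <;> exact NNReal.coe_nonneg _
  refine ⟨_, hφ, h0, fun s hs => if_neg hs.not_ge, fun t ht => ?_⟩
  rw [intervalIntegral.integral_of_le ht, ofReal_integral_eq_lintegral_ofReal
    ((intervalIntegrable_iff_integrableOn_Ioc_of_le ht).1 hφ.intervalIntegrable)
    (Filter.Eventually.of_forall h0)]
  refine setLIntegral_congr_fun measurableSet_Ioc fun s hs => ?_
  simp [hs.1.not_ge]

theorem measurable_hardyT {f : ℝ × ℝ → ℝ≥0} (hf : Measurable f) : Measurable (hardyT f) := by
  have hs : MeasurableSet {q : (ℝ × ℝ) × ℝ | q.2 ∈ Ioc 0 q.1.2} :=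
    (measurableSet_lt measurable_const measurable_snd).inter
      (measurableSet_le measurable_snd (by fun_prop))
  have hm : Measurable fun q : (ℝ × ℝ) × ℝ => (f (q.1.1, q.2) : ℝ≥0∞) := by fun_prop
  have h : Measurable fun z : ℝ × ℝ => ∫⁻ s in Ioc 0 z.2, (f (z.1, s) : ℝ≥0∞) := by
    have := (hm.indicator hs).lintegral_prod_right' (ν := volume)
    convert this using 2 with z
    rw [← lintegral_indicator measurableSet_Ioc]
    rfl
  unfold hardyT
  exact h.div (by fun_prop)

theorem DecFun2.le_hardyT {f : ℝ × ℝ → ℝ≥0} (hf : DecFun2 f) {z : ℝ × ℝ} (hz : z ∈ quadrant) :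
    (f z : ℝ≥0∞) ≤ hardyT f z := by
  have ht : ENNReal.ofReal z.2 ≠ 0 := by simpa using hz.2
  rw [hardyT, ENNReal.le_div_iff_mul_le (Or.inl ht) (Or.inl ENNReal.ofReal_ne_top)]
  have : ∫⁻ _ in Ioc 0 z.2, (f z : ℝ≥0∞) ≤ ∫⁻ s in Ioc 0 z.2, (f (z.1, s) : ℝ≥0∞) :=
    setLIntegral_mono' measurableSet_Ioc fun s hs =>
      ENNReal.coe_le_coe.2 (hf z.1 z.2 z.1 s hz.1 le_rfl hs.1 hs.2)
  simpa using this

theorem hardyT_le_of_le {f : ℝ × ℝ → ℝ≥0} {M : ℝ≥0} (hM : ∀ z, f z ≤ M) (z : ℝ × ℝ) :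
    hardyT f z ≤ M := by
  refine ENNReal.div_le_of_le_mul ?_
  refine (lintegral_mono fun s => ENNReal.coe_le_coe.2 (hM (z.1, s))).trans ?_
  simp

theorem DecFun2.hardyT_le_hardyT {f : ℝ × ℝ → ℝ≥0} (hf : DecFun2 f) {M : ℝ≥0}
    (hM : ∀ z, f z ≤ M) {x y x' y' : ℝ} (hx' : 0 < x') (hx : x' ≤ x) (hy' : 0 < y')
    (hy : y' ≤ y) : hardyT f (x, y) ≤ hardyT f (x', y') := by
  have h1 : hardyT f (x, y) ≤ hardyT f (x', y) := by
    unfold hardyT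
    refine ENNReal.div_le_div_right (setLIntegral_mono' measurableSet_Ioc fun s hs => ?_) _
    exact ENNReal.coe_le_coe.2 (hf x s x' s hx' hx hs.1 le_rfl)
  refine h1.trans ?_
  obtain ⟨φ, hφ, -, -, hi⟩ := hf.exists_antitone_section hM hx'
  have h2 := hφ.mul_integral_le_mul_integral hy'.le hy
  have hypos := hy'.trans_le hy
  simp only [hardyT]
  rw [hi y hypos.le, hi y' hy'.le, ← ENNReal.ofReal_div_of_pos hypos,
    ← ENNReal.ofReal_div_of_pos hy']
  refine ENNReal.ofReal_le_ofReal ((div_le_div_iff₀ hypos hy').2 ?_)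
  linarith

theorem DecFun2.hardyT_rpow_le {f : ℝ × ℝ → ℝ≥0} (hf : DecFun2 f) {M : ℝ≥0}
    (hM : ∀ z, f z ≤ M) {p : ℝ} (hp : 0 < p) {g : ℝ × ℝ → ℝ≥0}
    (hg : ∀ z ∈ quadrant, hardyT f z ^ (p - 1) * f z ≤ g z) {z : ℝ × ℝ} (hz : z ∈ quadrant) :
    hardyT f z ^ p ≤ powAvg p g z := by
  obtain ⟨φ, hφ, h0, hφf, hi⟩ := hf.exists_antitone_section hM hz.1
  rw [hardyT, ENNReal.div_rpow_of_nonneg _ _ hp.le, powAvg, hi _ hz.2.out.le]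
  refine ENNReal.div_le_div_right ((hφ.ofReal_integral_rpow_le h0 hp hz.2).trans ?_) _
  refine setLIntegral_mono' measurableSet_Ioc fun s hs => ?_
  have hs0 : ENNReal.ofReal s ≠ 0 := by simpa using hs.1
  have hG : ENNReal.ofReal (∫ u in (0 : ℝ)..s, φ u) =
      ENNReal.ofReal s * hardyT f (z.1, s) := by
    rw [← hi s hs.1.le]
    exact (ENNReal.mul_div_cancel hs0 ENNReal.ofReal_ne_top).symm
  have hT : hardyT f (z.1, s) ≠ ⊤ := ne_top_of_le_ne_top ENNReal.coe_ne_top (hardyT_le_of_le hM _)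
  rw [hG, ENNReal.mul_rpow_of_ne_top ENNReal.ofReal_ne_top hT,
    ENNReal.ofReal_rpow_of_pos hs.1, hφf s hs.1, ENNReal.ofReal_coe_nnreal,
    ENNReal.ofReal_mul hp.le]
  calc _ = ENNReal.ofReal p * ENNReal.ofReal (s ^ (p - 1)) *
        (hardyT f (z.1, s) ^ (p - 1) * f (z.1, s)) := by ring
    _ ≤ _ := by
      gcongr
      exact hg (z.1, s) ⟨hz.1, hs.1⟩

theorem SetCondition.lintegral_hardyT_rpow_le_of_le_one {ν : Measure (ℝ × ℝ)} [SigmaFinite ν]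
    {p : ℝ} {K : ℝ≥0∞} (h : SetCondition ν p K) (hp : 0 < p) (hp1 : p ≤ 1)
    {f : ℝ × ℝ → ℝ≥0} (hfm : Measurable f) (hf : DecFun2 f) {M : ℝ≥0} (hM : ∀ z, f z ≤ M) :
    ∫⁻ z in quadrant, hardyT f z ^ p ∂ν ≤
      (1 + K) * ∫⁻ z in quadrant, (f z : ℝ≥0∞) ^ p ∂ν := by
  have hg : ∀ z ∈ quadrant, hardyT f z ^ (p - 1) * f z ≤ ((f z ^ p : ℝ≥0) : ℝ≥0∞) := by
    intro z hz
    rcases eq_or_ne (f z) 0 with h0 | h0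
    · simp [h0]
    · have h1 : hardyT f z ^ (p - 1) ≤ (f z : ℝ≥0∞) ^ (p - 1) := by
        rw [← neg_sub, ENNReal.rpow_neg, ENNReal.rpow_neg]
        exact ENNReal.inv_le_inv.2 (ENNReal.rpow_le_rpow (hf.le_hardyT hz) (by linarith))
      refine (mul_le_mul_left h1 _).trans_eq ?_
      rw [ENNReal.coe_rpow_of_nonneg _ hp.le]
      nth_rw 2 [← ENNReal.rpow_one (f z : ℝ≥0∞)]
      rw [← ENNReal.rpow_add _ _ (by simpa using h0) ENNReal.coe_ne_top, sub_add_cancel]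
  refine (setLIntegral_mono' measurableSet_quadrant fun z hz =>
    hf.hardyT_rpow_le hM hp hg hz).trans ?_
  refine (h.lintegral_powAvg_le hp (hfm.pow_const p) ?_).trans_eq ?_
  · exact fun x y x' y' hx' hx hy' hy => NNReal.rpow_le_rpow (hf x y x' y' hx' hx hy' hy) hp.le
  · simp_rw [ENNReal.coe_rpow_of_nonneg _ hp.le]

theorem SetCondition.lintegral_hardyT_rpow_ne_top {ν : Measure (ℝ × ℝ)}
    {p : ℝ} {K : ℝ≥0∞} (h : SetCondition ν p K) (hK : K ≠ ⊤) (hp : 0 < p)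
    {f : ℝ × ℝ → ℝ≥0} (hfm : Measurable f) (hf : DecFun2 f) {M : ℝ≥0} (hM : ∀ z, f z ≤ M)
    (hν : ν (superlevel f 0) ≠ ⊤) :
    ∫⁻ z in quadrant, hardyT f z ^ p ∂ν ≠ ⊤ := by
  have hle : ∀ z ∈ quadrant,
      hardyT f z ^ p ≤ (M : ℝ≥0∞) ^ p * truncRatio (superlevel f 0) z ^ p := by
    intro z hz
    rw [← ENNReal.mul_rpow_of_nonneg _ _ hp.le]
    refine ENNReal.rpow_le_rpow ?_ hp.le
    rw [hardyT, truncRatio, ← mul_div_assoc]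
    refine ENNReal.div_le_div_right ?_ _
    have hs : MeasurableSet {t : ℝ | 0 < t ∧ (z.1, t) ∈ superlevel f 0} :=
      measurableSet_Ioi.inter (measurable_prodMk_left (measurableSet_superlevel hfm 0))
    calc ∫⁻ s in Ioc 0 z.2, (f (z.1, s) : ℝ≥0∞)
        ≤ ∫⁻ s in Ioc 0 z.2,
            {t : ℝ | 0 < t ∧ (z.1, t) ∈ superlevel f 0}.indicator (fun _ => (M : ℝ≥0∞)) s := by
          refine setLIntegral_mono' measurableSet_Ioc fun s hs => ?_
          by_cases hfs : f (z.1, s) = 0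
          · simp [hfs]
          · rw [indicator_of_mem]
            · exact ENNReal.coe_le_coe.2 (hM _)
            · exact ⟨hs.1, ⟨hz.1, hs.1⟩, NNReal.coe_pos.2 (pos_iff_ne_zero.2 hfs)⟩
      _ = M * volume ({t : ℝ | 0 < t ∧ (z.1, t) ∈ superlevel f 0} ∩ Ioc 0 z.2) := by
          rw [lintegral_indicator_const hs, Measure.restrict_apply hs]
      _ ≤ _ := by
          gcongr
          refine le_min ((measure_mono inter_subset_right).trans_eq ?_)
            (measure_mono inter_subset_left)
          simp
  refine ne_top_of_le_ne_top ?_ (setLIntegral_mono' measurableSet_quadrant hle)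
  rw [lintegral_const_mul' _ _ (ENNReal.rpow_ne_top_of_nonneg hp.le ENNReal.coe_ne_top)]
  refine ENNReal.mul_ne_top (ENNReal.rpow_ne_top_of_nonneg hp.le ENNReal.coe_ne_top) ?_
  refine ne_top_of_le_ne_top ?_ (h.lintegral_truncRatio_le hp (hf.decSet2_superlevel 0)
    (measurableSet_superlevel hfm 0))
  exact ENNReal.mul_ne_top (by simp [hK]) hν

theorem SetCondition.lintegral_hardyT_rpow_le_of_one_lt {ν : Measure (ℝ × ℝ)} [SigmaFinite ν]
    {p : ℝ} {K : ℝ≥0∞} (h : SetCondition ν p K) (hK : K ≠ ⊤) (hp1 : 1 < p)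
    {f : ℝ × ℝ → ℝ≥0} (hfm : Measurable f) (hf : DecFun2 f) {M : ℝ≥0} (hM : ∀ z, f z ≤ M)
    (hν : ν (superlevel f 0) ≠ ⊤) :
    ∫⁻ z in quadrant, hardyT f z ^ p ∂ν ≤
      (1 + K) ^ p * ∫⁻ z in quadrant, (f z : ℝ≥0∞) ^ p ∂ν := by
  have hp : 0 < p := zero_lt_one.trans hp1
  have hp1' : 0 ≤ p - 1 := by linarith
  have hT : ∀ z, hardyT f z ≠ ⊤ := fun z =>
    ne_top_of_le_ne_top ENNReal.coe_ne_top (hardyT_le_of_le hM z)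
  set g : ℝ × ℝ → ℝ≥0 := fun z => (hardyT f z).toNNReal ^ (p - 1) * f z with hgdef
  have hgc : ∀ z, (g z : ℝ≥0∞) = hardyT f z ^ (p - 1) * f z := fun z => by
    rw [hgdef, ENNReal.coe_mul, ENNReal.coe_rpow_of_nonneg _ hp1', ENNReal.coe_toNNReal (hT z)]
  have hgm : Measurable g := ((measurable_hardyT hfm).ennreal_toNNReal.pow_const _).mul hfm
  have hgd : DecFun2 g := fun x y x' y' hx' hx hy' hy =>
    mul_le_mul' (NNReal.rpow_le_rpow (ENNReal.toNNReal_mono (hT _)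
      (hf.hardyT_le_hardyT hM hx' hx hy' hy)) hp1') (hf x y x' y' hx' hx hy' hy)
  have hX := h.lintegral_hardyT_rpow_ne_top hK hp hfm hf hM hν
  have hle := (setLIntegral_mono' measurableSet_quadrant fun z hz =>
    hf.hardyT_rpow_le hM hp (fun z _ => (hgc z).ge) hz).trans (h.lintegral_powAvg_le hp hgm hgd)
  have hpq : (p / (p - 1)).HolderConjugate p :=
    (Real.HolderConjugate.conjExponent hp1).symm
  have hH := ENNReal.lintegral_mul_le_Lp_mul_Lq (ν.restrict quadrant) hpq
    ((measurable_hardyT hfm).pow_const (p - 1)).aemeasurable hfm.coe_nnreal_ennreal.aemeasurable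
  simp only [Pi.mul_apply, ← ENNReal.rpow_mul, ← hgc] at hH
  rw [mul_div_cancel₀ _ (by linarith : p - 1 ≠ 0)] at hH
  set X := ∫⁻ z in quadrant, hardyT f z ^ p ∂ν
  set Y := ∫⁻ z in quadrant, (f z : ℝ≥0∞) ^ p ∂ν
  rcases eq_or_ne X 0 with hX0 | hX0
  · rw [hX0]; exact zero_le
  have hXY : X ^ (1 / (p / (p - 1))) * X ^ (1 / p) ≤
      X ^ (1 / (p / (p - 1))) * ((1 + K) * Y ^ (1 / p)) := by
    rw [← ENNReal.rpow_add _ _ hX0 hX, one_div, one_div, hpq.inv_add_inv_eq_one,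
      ENNReal.rpow_one, ← one_div, ← one_div]
    calc X ≤ _ := hle
      _ ≤ _ := mul_le_mul_right hH _
      _ = _ := by ring
  rw [ENNReal.mul_le_mul_iff_right (by simp [ENNReal.rpow_eq_zero_iff, hX0, hX])
    (by simp [ENNReal.rpow_eq_top_iff, hX0, hX])] at hXY
  have := ENNReal.rpow_le_rpow hXY hp.le
  rwa [ENNReal.mul_rpow_of_nonneg _ _ hp.le, ← ENNReal.rpow_mul, ← ENNReal.rpow_mul,
    one_div_mul_cancel hp.ne', ENNReal.rpow_one, ENNReal.rpow_one] at this

/-- Truncation of a number from above by `n` and, to zero, from below at `1 / (n + 1)`. -/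
noncomputable def truncAt (n : ℕ) (v : ℝ≥0) : ℝ≥0 :=
  if ((n : ℝ≥0) + 1)⁻¹ < v then min v n else 0

theorem truncAt_le_natCast (n : ℕ) (v : ℝ≥0) : truncAt n v ≤ n := by
  unfold truncAt
  split_ifs
  · exact min_le_right _ _
  · exact zero_le

theorem truncAt_le_self (n : ℕ) (v : ℝ≥0) : truncAt n v ≤ v := by
  unfold truncAt
  split_ifs
  · exact min_le_left _ _
  · exact zero_le

theorem monotone_truncAt (n : ℕ) : Monotone (truncAt n) := by
  intro v w hvw
  unfold truncAt
  split_ifs with h1 h2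
  · exact min_le_min_right _ hvw
  · exact absurd (h1.trans_le hvw) h2
  · exact zero_le
  · exact le_rfl

theorem monotone_truncAt_left (v : ℝ≥0) : Monotone fun n => truncAt n v := by
  intro m n hmn
  have hmn' : (m : ℝ≥0) ≤ n := mod_cast hmn
  simp only [truncAt]
  split_ifs with h1 h2
  · exact min_le_min_left _ hmn'
  · refine absurd (lt_of_le_of_lt ?_ h1) h2
    gcongr
  · exact zero_le
  · exact le_rfl

theorem tendsto_truncAt (v : ℝ≥0) :
    Filter.Tendsto (fun n => truncAt n v) Filter.atTop (nhds v) := by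
  refine tendsto_const_nhds.congr' ?_
  rcases eq_or_ne v 0 with rfl | hv
  · exact Filter.Eventually.of_forall fun n => by simp [truncAt]
  · obtain ⟨a, ha⟩ := exists_nat_ge v
    obtain ⟨b, hb⟩ := exists_nat_ge v⁻¹
    filter_upwards [Filter.eventually_ge_atTop (max a b)] with n hn
    have h1 : v ≤ n := ha.trans (mod_cast (le_max_left a b).trans hn)
    have h2 : v⁻¹ < (n : ℝ≥0) + 1 :=
      (hb.trans (mod_cast (le_max_right a b).trans hn)).trans_lt (lt_add_one _)
    have h3 : ((n : ℝ≥0) + 1)⁻¹ < v := by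
      rw [inv_lt_comm₀ (by positivity) (pos_iff_ne_zero.2 hv)]
      exact h2
    simp [truncAt, h3, h1]

theorem DecFun2.truncAt {f : ℝ × ℝ → ℝ≥0} (hf : DecFun2 f) (n : ℕ) :
    DecFun2 fun z => truncAt n (f z) :=
  fun x y x' y' hx' hx hy' hy => monotone_truncAt n (hf x y x' y' hx' hx hy' hy)

theorem measure_superlevel_truncAt_ne_top {ν : Measure (ℝ × ℝ)} {p : ℝ} (hp : 0 < p)
    {f : ℝ × ℝ → ℝ≥0} (hfm : Measurable f)
    (hY : ∫⁻ z in quadrant, (f z : ℝ≥0∞) ^ p ∂ν ≠ ⊤) (n : ℕ) :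
    ν (superlevel (fun z => truncAt n (f z)) 0) ≠ ⊤ := by
  set ε : ℝ≥0 := ((n : ℝ≥0) + 1)⁻¹ with hε
  have hε0 : 0 < ε := by positivity
  have hsub : superlevel (fun z => truncAt n (f z)) 0 ⊆
      {z | (ε : ℝ≥0∞) ^ p ≤ (f z : ℝ≥0∞) ^ p} ∩ quadrant := by
    rintro z ⟨hz, hpos⟩
    refine ⟨ENNReal.rpow_le_rpow (ENNReal.coe_le_coe.2 ?_) hp.le, hz⟩
    by_contra hlt
    have h0 : truncAt n (f z) = 0 := if_neg fun h => hlt h.le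
    simp [h0] at hpos
  refine ne_top_of_le_ne_top ?_ ((measure_mono hsub).trans (Measure.le_restrict_apply _ _))
  have hc : (ε : ℝ≥0∞) ^ p ≠ 0 := by simp [ENNReal.rpow_eq_zero_iff, hε0.ne', hp.not_gt]
  exact (meas_ge_le_lintegral_div (hfm.coe_nnreal_ennreal.pow_const p).aemeasurable hc
    (ENNReal.rpow_ne_top_of_nonneg hp.le ENNReal.coe_ne_top)).trans_lt
      (ENNReal.div_lt_top hY hc) |>.ne

theorem tendsto_hardyT_truncAt {f : ℝ × ℝ → ℝ≥0} (hfm : Measurable f) (z : ℝ × ℝ) (hz : 0 < z.2) :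
    Filter.Tendsto (fun n => hardyT (fun w => truncAt n (f w)) z) Filter.atTop
      (nhds (hardyT f z)) := by
  refine ENNReal.Tendsto.div_const ?_ (Or.inr (by simpa using hz))
  refine lintegral_tendsto_of_tendsto_of_monotone (fun n => ?_)
    (Filter.Eventually.of_forall fun s m n hmn =>
      ENNReal.coe_le_coe.2 (monotone_truncAt_left _ hmn))
    (Filter.Eventually.of_forall fun s => ENNReal.tendsto_coe.2 (tendsto_truncAt _))
  exact ((monotone_truncAt n).measurable.comp
    (hfm.comp measurable_prodMk_left)).coe_nnreal_ennreal.aemeasurable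

theorem lintegral_hardyT_rpow_le_of_truncAt {ν : Measure (ℝ × ℝ)} {p : ℝ} (hp : 0 < p)
    {f : ℝ × ℝ → ℝ≥0} (hfm : Measurable f) {A : ℝ≥0∞}
    (h : ∀ n, ∫⁻ z in quadrant, hardyT (fun w => truncAt n (f w)) z ^ p ∂ν ≤
      A * ∫⁻ z in quadrant, (truncAt n (f z) : ℝ≥0∞) ^ p ∂ν) :
    ∫⁻ z in quadrant, hardyT f z ^ p ∂ν ≤ A * ∫⁻ z in quadrant, (f z : ℝ≥0∞) ^ p ∂ν := by
  have hlim := lintegral_tendsto_of_tendsto_of_monotone (μ := ν.restrict quadrant)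
    (f := fun n z => hardyT (fun w => truncAt n (f w)) z ^ p) (F := fun z => hardyT f z ^ p)
    (fun n => ((measurable_hardyT
      ((monotone_truncAt n).measurable.comp hfm)).pow_const p).aemeasurable)
    (Filter.Eventually.of_forall fun z m n hmn => by
      refine ENNReal.rpow_le_rpow (ENNReal.div_le_div_right (lintegral_mono fun s => ?_) _) hp.le
      exact ENNReal.coe_le_coe.2 (monotone_truncAt_left _ hmn))
    ((ae_restrict_iff' measurableSet_quadrant).2 (Filter.Eventually.of_forall fun z hz =>
      (ENNReal.continuous_rpow_const.tendsto _).comp (tendsto_hardyT_truncAt hfm z hz.2)))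
  refine le_of_tendsto' hlim fun n => (h n).trans ?_
  gcongr with z
  exact truncAt_le_self _ _

theorem SetCondition.exists_forall_lintegral_hardyT_rpow_le {ν : Measure (ℝ × ℝ)} [SigmaFinite ν]
    {p C : ℝ} (hp : 0 < p) (hC : 0 < C) (h : SetCondition ν p (ENNReal.ofReal C)) :
    ∃ C' : ℝ, 0 < C' ∧ ∀ f : ℝ × ℝ → ℝ≥0, Measurable f → DecFun2 f →
      ∫⁻ z in quadrant, hardyT f z ^ p ∂ν ≤
        ENNReal.ofReal C' * ∫⁻ z in quadrant, (f z : ℝ≥0∞) ^ p ∂ν := by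
  have hC1 : 1 + ENNReal.ofReal C = ENNReal.ofReal (1 + C) := by
    rw [ENNReal.ofReal_add zero_le_one hC.le, ENNReal.ofReal_one]
  rcases le_or_gt p 1 with hp1 | hp1
  · refine ⟨1 + C, by positivity, fun f hfm hf =>
      lintegral_hardyT_rpow_le_of_truncAt hp hfm fun n => ?_⟩
    rw [← hC1]
    exact h.lintegral_hardyT_rpow_le_of_le_one hp hp1
      ((monotone_truncAt n).measurable.comp hfm) (hf.truncAt n) fun z => truncAt_le_natCast n _
  · refine ⟨(1 + C) ^ p, by positivity, fun f hfm hf => ?_⟩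
    by_cases hY : ∫⁻ z in quadrant, (f z : ℝ≥0∞) ^ p ∂ν = ⊤
    · rw [hY, ENNReal.mul_top (by simp; positivity)]
      exact le_top
    refine lintegral_hardyT_rpow_le_of_truncAt hp hfm fun n => ?_
    rw [← ENNReal.ofReal_rpow_of_pos (by positivity), ← hC1]
    exact h.lintegral_hardyT_rpow_le_of_one_lt ENNReal.ofReal_ne_top hp1
      ((monotone_truncAt n).measurable.comp hfm) (hf.truncAt n)
      (fun z => truncAt_le_natCast n _) (measure_superlevel_truncAt_ne_top hp hfm hY n)

theorem DecSet2.sectionLength_anti {D : Set (ℝ × ℝ)} (hD : DecSet2 D) {x x' : ℝ} (hx' : 0 < x')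
    (hx : x' ≤ x) : sectionLength D x ≤ sectionLength D x' :=
  measure_mono fun t ht => ⟨ht.1, hD.2 _ ht.2 (x', t) hx' hx ht.1 le_rfl⟩

/-- The points lying strictly below the upper boundary of `D`. -/
def strictPart (D : Set (ℝ × ℝ)) : Set (ℝ × ℝ) :=
  quadrant ∩ {z | ENNReal.ofReal z.2 < sectionLength D z.1}

theorem DecSet2.strictPart_subset {D : Set (ℝ × ℝ)} (hD : DecSet2 D) : strictPart D ⊆ D := by
  rintro ⟨x, t⟩ ⟨hz, hlt⟩
  by_contra hn
  refine hlt.out.not_ge ?_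
  have : {u : ℝ | 0 < u ∧ (x, u) ∈ D} ⊆ Ioc 0 t := fun u hu =>
    ⟨hu.1, le_of_not_gt fun htu => hn (hD.2 _ hu.2 (x, t) hz.1 le_rfl hz.2 htu.le)⟩
  simpa [sectionLength] using measure_mono (μ := volume) this

theorem DecSet2.measurableSet_strictPart {D : Set (ℝ × ℝ)} (hD : DecSet2 D) :
    MeasurableSet (strictPart D) := by
  have hanti : Antitone fun x : ℝ => if x ≤ 0 then ⊤ else sectionLength D x := by
    intro a b hab
    by_cases ha : a ≤ 0
    · simp [ha]
    · have hb : ¬ b ≤ 0 := fun hb => ha (hab.trans hb)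
      simpa [ha, hb] using hD.sectionLength_anti (not_le.1 ha) hab
  have heq : strictPart D = quadrant ∩ {z | ENNReal.ofReal z.2 <
      if z.1 ≤ 0 then ⊤ else sectionLength D z.1} := by
    ext z
    refine and_congr_right fun hz => ?_
    simp [hz.1.out.not_ge]
  rw [heq]
  exact measurableSet_quadrant.inter
    (measurableSet_lt (by fun_prop) (hanti.measurable.comp measurable_fst))

theorem DecSet2.decFun2_indicator_strictPart {D : Set (ℝ × ℝ)} (hD : DecSet2 D) :
    DecFun2 ((strictPart D).indicator fun _ => 1) := by
  intro x y x' y' hx' hx hy' hy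
  by_cases hz : (x, y) ∈ strictPart D
  · have hw : (x', y') ∈ strictPart D :=
      ⟨⟨hx', hy'⟩, (ENNReal.ofReal_le_ofReal hy).trans_lt
        (lt_of_lt_of_le hz.2.out (hD.sectionLength_anti hx' hx))⟩
    rw [indicator_of_mem hz, indicator_of_mem hw]
  · rw [indicator_of_notMem hz]
    exact zero_le

theorem sectionLength_div_le_hardyT (D : Set (ℝ × ℝ)) {z : ℝ × ℝ}
    (hz : z ∈ quadrant \ strictPart D) :
    sectionLength D z.1 / ENNReal.ofReal z.2 ≤
      hardyT ((strictPart D).indicator fun _ => 1) z := by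
  have hle : sectionLength D z.1 ≤ ENNReal.ofReal z.2 := le_of_not_gt fun h => hz.2 ⟨hz.1, h⟩
  have htop : sectionLength D z.1 ≠ ⊤ := ne_top_of_le_ne_top ENNReal.ofReal_ne_top hle
  set r := (sectionLength D z.1).toReal with hr
  have hrz : r ≤ z.2 := ENNReal.toReal_le_of_le_ofReal hz.1.2.out.le hle
  refine ENNReal.div_le_div_right ?_ _
  calc sectionLength D z.1 = ∫⁻ _ in Ioo 0 r, 1 := by simp [hr, htop]
    _ ≤ ∫⁻ s in Ioo 0 r, (((strictPart D).indicator (fun _ => 1) (z.1, s) : ℝ≥0) : ℝ≥0∞) := by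
      refine setLIntegral_mono' measurableSet_Ioo fun s hs => ?_
      have hmem : (z.1, s) ∈ strictPart D :=
        ⟨⟨hz.1.1, hs.1⟩, (ENNReal.ofReal_lt_iff_lt_toReal hs.1.le htop).2 hs.2⟩
      simp [hmem]
    _ ≤ _ := lintegral_mono_set (Ioo_subset_Ioc_self.trans (Ioc_subset_Ioc_right hrz))

theorem setCondition_of_forall_lintegral_hardyT_rpow_le {ν : Measure (ℝ × ℝ)} {p : ℝ} {K : ℝ≥0∞}
    (hp : 0 < p)
    (h : ∀ f : ℝ × ℝ → ℝ≥0, Measurable f → DecFun2 f →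
      ∫⁻ z in quadrant, hardyT f z ^ p ∂ν ≤ K * ∫⁻ z in quadrant, (f z : ℝ≥0∞) ^ p ∂ν) :
    SetCondition ν p K := by
  intro D hD
  have hE := hD.measurableSet_strictPart
  calc ∫⁻ z in quadrant \ D, (sectionLength D z.1 / ENNReal.ofReal z.2) ^ p ∂ν
      ≤ ∫⁻ z in quadrant \ strictPart D, (sectionLength D z.1 / ENNReal.ofReal z.2) ^ p ∂ν :=
        lintegral_mono_set (sdiff_subset_sdiff_right hD.strictPart_subset)
    _ ≤ ∫⁻ z in quadrant \ strictPart D,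
          hardyT ((strictPart D).indicator fun _ => 1) z ^ p ∂ν :=
        setLIntegral_mono' (measurableSet_quadrant.diff hE) fun z hz =>
          ENNReal.rpow_le_rpow (sectionLength_div_le_hardyT D hz) hp.le
    _ ≤ ∫⁻ z in quadrant, hardyT ((strictPart D).indicator fun _ => 1) z ^ p ∂ν :=
        lintegral_mono_set sdiff_subset
    _ ≤ K * ∫⁻ z in quadrant,
          (((strictPart D).indicator (fun _ => 1) z : ℝ≥0) : ℝ≥0∞) ^ p ∂ν :=
        h _ (measurable_const.indicator hE) hD.decFun2_indicator_strictPart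
    _ ≤ K * ∫⁻ z, (strictPart D).indicator (fun _ => 1) z ∂ν := by
        refine mul_le_mul' le_rfl ((setLIntegral_le_lintegral _ _).trans
          (lintegral_mono fun z => ?_))
        by_cases hz : z ∈ strictPart D <;> simp [hz, hp]
    _ = K * ν (strictPart D) := by rw [lintegral_indicator_const hE, one_mul]
    _ ≤ K * ν D := mul_le_mul' le_rfl (measure_mono hD.strictPart_subset)

/-- For a σ-finite Borel measure `ν` on `(0,∞)²` and `0 < p < ∞`, the
partial Hardy operator `T` is bounded on functions decreasing in each variable if and only if
for every decreasing set `D ⊆ (0,∞)²`,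
`∫_{(0,∞)²∖D} (|D_x|/t)^p dν(x,t) ≤ C ν(D)`. -/
theorem stmt5 (ν : Measure (ℝ × ℝ)) [SigmaFinite ν] (p : ℝ) (hp : 0 < p) :
    (∃ C : ℝ, 0 < C ∧ ∀ f : ℝ × ℝ → ℝ≥0, Measurable f → DecFun2 f →
        ∫⁻ z in Set.Ioi (0 : ℝ) ×ˢ Set.Ioi (0 : ℝ), hardyT f z ^ p ∂ν ≤
          ENNReal.ofReal C *
            ∫⁻ z in Set.Ioi (0 : ℝ) ×ˢ Set.Ioi (0 : ℝ), (f z : ℝ≥0∞) ^ p ∂ν) ↔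
      (∃ C : ℝ, 0 < C ∧ ∀ D : Set (ℝ × ℝ), DecSet2 D →
        ∫⁻ z in (Set.Ioi (0 : ℝ) ×ˢ Set.Ioi (0 : ℝ)) \ D,
            (volume {t : ℝ | 0 < t ∧ (z.1, t) ∈ D} / ENNReal.ofReal z.2) ^ p ∂ν ≤
          ENNReal.ofReal C * ν D) := by
  constructor
  · rintro ⟨C, hC, h⟩
    exact ⟨C, hC, setCondition_of_forall_lintegral_hardyT_rpow_le hp h⟩
  · rintro ⟨C, hC, h⟩
    exact SetCondition.exists_forall_lintegral_hardyT_rpow_le hp hC h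
end

section
/- There exists C > 0 such that ∫₀^∞ (S_◁ f)^p(x) u(x) dx ≤ C ∫₀^∞ f^p(x) u(x) dx for every nonnegative measurable f on (0,∞) that is decreasing on each interval (n, n+1), n = 0,1,2,…, if and only if there exists C > 0 such that for every sequence (a_n)_{n≥0} ⊆ [0,1], ∑_{n=0}^∞ ∫_{a_n}^1 (a_n/t)^p u(n+t) dt ≤ C ∑_{n=0}^∞ ∫_0^{a_n} u(n+t) dt. -/
open MeasureTheory Set
open scoped ENNReal NNReal

/-- The Hardy-type operator with variable end-points,
`S_◁ f(x) = (1/(x-[x])) ∫_{[x]}^x f(t) dt`. -/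
noncomputable def Sblack (f : ℝ → ℝ≥0) (x : ℝ) : ℝ≥0∞ :=
  (∫⁻ t in Set.Ioc (⌊x⌋ : ℝ) x, (f t : ℝ≥0∞)) / ENNReal.ofReal (x - ⌊x⌋)

theorem ENNReal.rpow_tsum_le_tsum_rpow (c : ℕ → ℝ≥0∞) {q : ℝ≥0∞} (hq0 : q ≠ 0) (hq1 : q < 1)
    {p : ℝ} (hp : 0 < p) :
    (∑' k, c k) ^ p ≤ ((1 - q)⁻¹) ^ p * ∑' k, ((q ^ k)⁻¹ * c k) ^ p := by
  set S := ∑' k, ((q ^ k)⁻¹ * c k) ^ p with hS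
  have hc : ∀ k, c k ≤ q ^ k * S ^ (1 / p) := by
    intro k
    have h1 : ((q ^ k)⁻¹ * c k) ^ p ≤ S := ENNReal.le_tsum k
    have h2 : (q ^ k)⁻¹ * c k ≤ S ^ (1 / p) := by
      rw [one_div]
      exact (ENNReal.le_rpow_inv_iff hp).2 h1
    have hk0 : q ^ k ≠ 0 := pow_ne_zero _ hq0
    have hkt : q ^ k ≠ ⊤ := ENNReal.pow_ne_top hq1.ne_top
    calc c k = q ^ k * ((q ^ k)⁻¹ * c k) := by
          rw [← mul_assoc, ENNReal.mul_inv_cancel hk0 hkt, one_mul]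
      _ ≤ _ := by gcongr
  calc (∑' k, c k) ^ p ≤ (∑' k, q ^ k * S ^ (1 / p)) ^ p := by
        gcongr with k; exact hc k
    _ = ((1 - q)⁻¹) ^ p * S := by
        rw [ENNReal.tsum_mul_right, ENNReal.tsum_geometric, ENNReal.mul_rpow_of_nonneg _ _ hp.le,
          ← ENNReal.rpow_mul, one_div_mul_cancel hp.ne', ENNReal.rpow_one]

theorem average_le_tsum_of_antitoneOn {g : ℝ → ℝ≥0} (hg : AntitoneOn g (Ioo 0 1)) {x : ℝ}
    (hx : x ∈ Ioo (0 : ℝ) 1) :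
    (∫⁻ s in Ioc 0 x, (g s : ℝ≥0∞)) / ENNReal.ofReal x ≤
      ∑' k : ℕ, (2⁻¹ : ℝ≥0∞) ^ (k + 1) * (g ((2⁻¹ : ℝ) ^ (k + 1) * x) : ℝ≥0∞) := by
  obtain ⟨hx0, hx1⟩ := hx
  have hx' : ENNReal.ofReal x ≠ 0 := by simpa using hx0
  have hcover : Ioc 0 x ⊆ ⋃ k : ℕ, Ioc ((2⁻¹ : ℝ) ^ (k + 1) * x) ((2⁻¹ : ℝ) ^ k * x) := by
    rintro t ⟨ht0, htx⟩
    obtain ⟨k, hk1, hk2⟩ := exists_nat_pow_near_of_lt_one (x := t / x) (y := (2⁻¹ : ℝ))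
      (div_pos ht0 hx0) ((div_le_one hx0).2 htx) (by norm_num) (by norm_num)
    rw [lt_div_iff₀ hx0] at hk1
    rw [div_le_iff₀ hx0] at hk2
    exact mem_iUnion.2 ⟨k, hk1, hk2⟩
  rw [ENNReal.div_le_iff hx' ENNReal.ofReal_ne_top, ← ENNReal.tsum_mul_right]
  refine (lintegral_mono_set hcover).trans ((lintegral_iUnion_le _ _).trans ?_)
  refine ENNReal.tsum_le_tsum fun k => ?_
  have hpos : 0 < (2⁻¹ : ℝ) ^ (k + 1) * x := by positivity
  have hle : (2⁻¹ : ℝ) ^ k * x ≤ x :=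
    mul_le_of_le_one_left hx0.le (pow_le_one₀ (by norm_num) (by norm_num))
  calc ∫⁻ s in Ioc ((2⁻¹ : ℝ) ^ (k + 1) * x) ((2⁻¹ : ℝ) ^ k * x), (g s : ℝ≥0∞)
      ≤ ∫⁻ _ in Ioc ((2⁻¹ : ℝ) ^ (k + 1) * x) ((2⁻¹ : ℝ) ^ k * x),
          (g ((2⁻¹ : ℝ) ^ (k + 1) * x) : ℝ≥0∞) := by
        refine setLIntegral_mono measurable_const fun s hs => ?_
        have hs1 : s < 1 := (hs.2.trans hle).trans_lt hx1
        exact_mod_cast hg ⟨hpos, hs.1.trans hs1⟩ ⟨hpos.trans hs.1, hs1⟩ hs.1.le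
    _ = _ := by
        rw [setLIntegral_const, Real.volume_Ioc]
        have : (2⁻¹ : ℝ) ^ k * x - (2⁻¹ : ℝ) ^ (k + 1) * x = (2⁻¹ : ℝ) ^ (k + 1) * x := by ring
        rw [this, ENNReal.ofReal_mul (by positivity), ENNReal.ofReal_pow (by norm_num),
          ENNReal.ofReal_inv_of_pos (by norm_num), ENNReal.ofReal_ofNat]
        ring

/-- The truncated kernel `min (a ^ (-p)) (t ^ (-p))` integrated against `μ`. -/
noncomputable def truncatedMoment (μ : Measure ℝ) (p a : ℝ) : ℝ≥0∞ :=
  ∫⁻ t, ENNReal.ofReal (min (a ^ (-p)) (t ^ (-p))) ∂μ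

theorem le_truncatedMoment (μ : Measure ℝ) {p a : ℝ} (hp : 0 < p) :
    ENNReal.ofReal (a ^ (-p)) * μ (Ioc 0 a) ≤ truncatedMoment μ p a := by
  rw [← setLIntegral_const, truncatedMoment]
  refine (setLIntegral_mono (by fun_prop) fun t ht => ?_).trans (setLIntegral_le_lintegral _ _)
  rw [min_eq_left (Real.rpow_le_rpow_of_nonpos ht.1 ht.2 (by linarith))]

theorem truncatedMoment_two_mul_le {μ : Measure ℝ} (hμ : ∀ᵐ t ∂μ, t ∈ Ioo (0 : ℝ) 1) {p A a : ℝ}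
    (hp : 0 < p) (hA : 0 < A) (ha : 0 < a)
    (h : truncatedMoment μ p a ≤ ENNReal.ofReal A * (ENNReal.ofReal (a ^ (-p)) * μ (Ioc 0 a))) :
    truncatedMoment μ p (2 * a) ≤
      ENNReal.ofReal ((1 + (1 - 2 ^ (-p)) / A)⁻¹) * truncatedMoment μ p a := by
  have h2 : (2 : ℝ) ^ (-p) < 1 := Real.rpow_lt_one_of_one_lt_of_neg (by norm_num) (by linarith)
  have hap : 0 < a ^ (-p) := Real.rpow_pos_of_pos ha _
  have h2a : (2 * a) ^ (-p) = 2 ^ (-p) * a ^ (-p) := Real.mul_rpow (by norm_num) ha.le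
  set δ := (1 - (2 : ℝ) ^ (-p)) / A with hδ
  have hδ0 : 0 < δ := div_pos (by linarith) hA
  have hle : (2 * a) ^ (-p) ≤ a ^ (-p) := by rw [h2a]; nlinarith
  have hmono : truncatedMoment μ p (2 * a) ≤ truncatedMoment μ p a :=
    lintegral_mono fun t => ENNReal.ofReal_le_ofReal (min_le_min_right _ hle)
  have hadd : truncatedMoment μ p (2 * a) +
      ENNReal.ofReal ((1 - 2 ^ (-p)) * a ^ (-p)) * μ (Ioc 0 a) ≤ truncatedMoment μ p a := by
    rw [← lintegral_indicator_const measurableSet_Ioc, truncatedMoment,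
      ← lintegral_add_right _ (measurable_const.indicator measurableSet_Ioc), truncatedMoment]
    refine lintegral_mono_ae ?_
    filter_upwards [hμ] with t ht
    by_cases hta : t ∈ Ioc 0 a
    · have : a ^ (-p) ≤ t ^ (-p) := Real.rpow_le_rpow_of_nonpos hta.1 hta.2 (by linarith)
      rw [indicator_of_mem hta, min_eq_left this, min_eq_left (hle.trans this),
        ← ENNReal.ofReal_add (by positivity) (mul_nonneg (by linarith) hap.le), h2a]
      exact ENNReal.ofReal_le_ofReal (by linarith)
    · rw [indicator_of_notMem hta, add_zero]
      exact ENNReal.ofReal_le_ofReal (min_le_min_right _ hle)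
  have hkey : ENNReal.ofReal (1 + δ) * truncatedMoment μ p (2 * a) ≤ truncatedMoment μ p a := by
    refine le_trans ?_ hadd
    rw [ENNReal.ofReal_add zero_le_one hδ0.le, ENNReal.ofReal_one, add_mul, one_mul]
    refine add_le_add le_rfl ?_
    calc ENNReal.ofReal δ * truncatedMoment μ p (2 * a)
        ≤ ENNReal.ofReal δ *
          (ENNReal.ofReal A * (ENNReal.ofReal (a ^ (-p)) * μ (Ioc 0 a))) := by
          gcongr; exact hmono.trans h
      _ = _ := by
          rw [← mul_assoc, ← mul_assoc, ← ENNReal.ofReal_mul hδ0.le,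
            ← ENNReal.ofReal_mul (by positivity), hδ, div_mul_cancel₀ _ hA.ne']
  have hpos : 0 < 1 + δ := by linarith
  rw [ENNReal.ofReal_inv_of_pos hpos, mul_comm _ (truncatedMoment μ p a), ← div_eq_mul_inv,
    ENNReal.le_div_iff_mul_le (by simp [hpos]) (by simp), mul_comm]
  exact hkey

theorem measure_Ioc_pow_two_mul_le {μ : Measure ℝ} (hμ : ∀ᵐ t ∂μ, t ∈ Ioo (0 : ℝ) 1) {p A : ℝ}
    (hp : 0 < p) (hA : 0 < A)
    (h : ∀ a, 0 < a →
      truncatedMoment μ p a ≤ ENNReal.ofReal A * (ENNReal.ofReal (a ^ (-p)) * μ (Ioc 0 a)))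
    (m : ℕ) {a : ℝ} (ha : 0 < a) :
    ENNReal.ofReal (2 ^ (-p)) ^ m * μ (Ioc 0 (2 ^ m * a)) ≤
      ENNReal.ofReal ((1 + (1 - 2 ^ (-p)) / A)⁻¹) ^ m * (ENNReal.ofReal A * μ (Ioc 0 a)) := by
  set r := ENNReal.ofReal ((1 + (1 - 2 ^ (-p)) / A)⁻¹) with hr
  have hiter : ∀ m : ℕ, truncatedMoment μ p (2 ^ m * a) ≤ r ^ m * truncatedMoment μ p a := by
    intro m
    induction m with
    | zero => simp
    | succ k ih =>
      have hk : 0 < 2 ^ k * a := by positivity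
      calc truncatedMoment μ p (2 ^ (k + 1) * a) = truncatedMoment μ p (2 * (2 ^ k * a)) := by
            congr 1; ring
        _ ≤ r * truncatedMoment μ p (2 ^ k * a) :=
            truncatedMoment_two_mul_le hμ hp hA hk (h _ hk)
        _ ≤ r * (r ^ k * truncatedMoment μ p a) := by gcongr
        _ = _ := by ring
  have hap : 0 < a ^ (-p) := Real.rpow_pos_of_pos ha _
  have hpow : ENNReal.ofReal ((2 ^ m * a) ^ (-p)) =
      ENNReal.ofReal (a ^ (-p)) * ENNReal.ofReal (2 ^ (-p)) ^ m := by
    rw [← ENNReal.ofReal_pow (by positivity), ← ENNReal.ofReal_mul hap.le,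
      Real.mul_rpow (by positivity) ha.le, ← Real.rpow_natCast_mul (by norm_num),
      ← Real.rpow_mul_natCast (by norm_num), mul_comm, mul_comm (m : ℝ)]
  have hfin := (le_truncatedMoment μ (a := 2 ^ m * a) hp).trans
    ((hiter m).trans (mul_le_mul_right (h a ha) _))
  rw [hpow] at hfin
  have h0 : ENNReal.ofReal (a ^ (-p)) ≠ 0 := by simpa using hap
  refine (ENNReal.mul_le_mul_iff_right h0 ENNReal.ofReal_ne_top).1 ?_
  calc _ = _ := by rw [← mul_assoc]
    _ ≤ _ := hfin
    _ = _ := by ring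

theorem lintegral_comp_mul_le_of_antitoneOn {μ : Measure ℝ} [NullSingletonClass μ]
    (hμ : ∀ᵐ t ∂μ, t ∈ Ioo (0 : ℝ) 1) {g : ℝ → ℝ≥0} (hgm : Measurable g)
    (hg : AntitoneOn g (Ioo 0 1)) {c : ℝ} (hc0 : 0 < c) (hc1 : c ≤ 1) {D : ℝ≥0∞}
    (hD : ∀ a, 0 < a → μ (Ioc 0 (c⁻¹ * a)) ≤ D * μ (Ioc 0 a)) :
    ∫⁻ x, (g (c * x) : ℝ≥0∞) ∂μ ≤ D * ∫⁻ x, (g x : ℝ≥0∞) ∂μ := by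
  have hlayer : ∀ f : ℝ → ℝ≥0, Measurable f →
      ∫⁻ x, (f x : ℝ≥0∞) ∂μ = ∫⁻ s in Ioi (0 : ℝ), μ {x | s < f x} := by
    intro f hf
    have hf' : AEMeasurable (fun x => (f x : ℝ)) μ := by fun_prop
    simpa using lintegral_eq_lintegral_meas_lt μ
      (Filter.Eventually.of_forall fun x => (f x).coe_nonneg) hf'
  have hanti : Antitone fun s : ℝ => μ {x | s < g x} := fun s t hst =>
    measure_mono fun x (hx : t < g x) => hst.trans_lt hx
  rw [hlayer (fun x => g (c * x)) (hgm.comp (measurable_const_mul c)), hlayer g hgm,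
    ← lintegral_const_mul D hanti.measurable]
  refine lintegral_mono fun s => ?_
  set E : Set ℝ := {x | s < g x} ∩ Ioo 0 1 with hE
  have hEbdd : BddAbove E := ⟨1, fun x hx => hx.2.2.le⟩
  have hleft : μ {x | s < g (c * x)} ≤ μ ((fun x => c * x) ⁻¹' E) := by
    refine measure_mono_ae ?_
    filter_upwards [hμ] with x hx hsx
    exact ⟨hsx, mul_pos hc0 hx.1, (mul_le_of_le_one_left hx.1.le hc1).trans_lt hx.2⟩
  refine hleft.trans (le_trans ?_ (mul_le_mul_right (measure_mono (s := E) inter_subset_left) D))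
  rcases E.eq_empty_or_nonempty with hemp | ⟨x₀, hx₀⟩
  · simp [hemp]
  have ha : 0 < sSup E := hx₀.2.1.trans_le (le_csSup hEbdd hx₀)
  have hsub : Ioo 0 (sSup E) ⊆ E := by
    rintro y ⟨hy0, hy⟩
    obtain ⟨z, hz, hyz⟩ := exists_lt_of_lt_csSup ⟨x₀, hx₀⟩ hy
    have hy1 : y ∈ Ioo (0 : ℝ) 1 := ⟨hy0, hyz.trans hz.2.2⟩
    exact ⟨lt_of_lt_of_le (show s < (g z : ℝ) from hz.1)
      (NNReal.coe_le_coe.2 (hg hy1 hz.2 hyz.le)), hy1⟩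
  calc μ ((fun x => c * x) ⁻¹' E) ≤ μ (Ioc 0 (c⁻¹ * sSup E)) := by
        refine measure_mono fun x hx => ⟨?_, ?_⟩
        · exact pos_of_mul_pos_right hx.2.1 hc0.le
        · rw [← div_eq_inv_mul, le_div_iff₀ hc0, mul_comm]
          exact le_csSup hEbdd hx
    _ ≤ D * μ (Ioc 0 (sSup E)) := hD _ ha
    _ = D * μ (Ioo 0 (sSup E)) := by rw [measure_congr Ioo_ae_eq_Ioc]
    _ ≤ D * μ E := by gcongr

theorem exists_lintegral_average_rpow_le {p A : ℝ} (hp : 0 < p) (hA : 0 < A) :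
    ∃ K : ℝ≥0∞, K ≠ ⊤ ∧ ∀ (μ : Measure ℝ) [NullSingletonClass μ],
      (∀ᵐ t ∂μ, t ∈ Ioo (0 : ℝ) 1) →
      (∀ a, 0 < a →
        truncatedMoment μ p a ≤ ENNReal.ofReal A * (ENNReal.ofReal (a ^ (-p)) * μ (Ioc 0 a))) →
      ∀ g : ℝ → ℝ≥0, Measurable g → AntitoneOn g (Ioo 0 1) →
        ∫⁻ x, ((∫⁻ s in Ioc 0 x, (g s : ℝ≥0∞)) / ENNReal.ofReal x) ^ p ∂μ ≤
          K * ∫⁻ x, (g x : ℝ≥0∞) ^ p ∂μ := by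
  set r : ℝ := (1 + (1 - 2 ^ (-p)) / A)⁻¹ with hr
  have h2 : (2 : ℝ) ^ (-p) < 1 := Real.rpow_lt_one_of_one_lt_of_neg (by norm_num) (by linarith)
  have hδ : 0 < (1 - (2 : ℝ) ^ (-p)) / A := div_pos (by linarith) hA
  have hr0 : 0 < r := by positivity
  have hr1 : r < 1 := inv_lt_one_of_one_lt₀ (by linarith)
  set ρ : ℝ≥0∞ := ENNReal.ofReal (√r) with hρ
  have hρρ : ENNReal.ofReal r = ρ * ρ := by
    rw [hρ, ← ENNReal.ofReal_mul (Real.sqrt_nonneg r), Real.mul_self_sqrt hr0.le]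
  have hρ0 : ρ ≠ 0 := by simpa [hρ] using hr0
  have hρ1 : ρ < 1 := by
    rw [hρ, ENNReal.ofReal_lt_one, Real.sqrt_lt' one_pos]; simpa using hr1
  set q : ℝ≥0∞ := ρ ^ (1 / p) with hq
  have hq0 : q ≠ 0 := by
    rw [hq, Ne, ENNReal.rpow_eq_zero_iff]
    rintro (h | h)
    · exact hρ0 h.1
    · exact hρ1.ne_top h.1
  have hq1 : q < 1 := ENNReal.rpow_lt_one hρ1 (by positivity)
  have hqp : q ^ p = ρ := by rw [hq, ← ENNReal.rpow_mul, one_div_mul_cancel hp.ne', ENNReal.rpow_one]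
  set τ : ℝ≥0∞ := ENNReal.ofReal (2 ^ (-p)) with hτ
  have hτ0 : τ ≠ 0 := by simp [hτ]; positivity
  have hτp : (2⁻¹ : ℝ≥0∞) ^ p = τ := by
    rw [hτ, ← ENNReal.ofReal_rpow_of_pos (by norm_num), ENNReal.ofReal_ofNat, ENNReal.inv_rpow,
      ENNReal.rpow_neg]
  have hsub : ∀ s : ℝ≥0∞, s < 1 → (1 - s)⁻¹ ≠ ⊤ := fun s hs =>
    ENNReal.inv_ne_top.2 (tsub_pos_of_lt hs).ne'
  refine ⟨((1 - q)⁻¹) ^ p * (ENNReal.ofReal A * (1 - ρ)⁻¹),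
    ENNReal.mul_ne_top (ENNReal.rpow_ne_top_of_nonneg hp.le (hsub q hq1))
      (ENNReal.mul_ne_top ENNReal.ofReal_ne_top (hsub ρ hρ1)), ?_⟩
  intro μ _ hμ h g hgm hg
  set G : ℝ → ℝ≥0 := fun x => g x ^ p with hG
  have hGm : Measurable G := by fun_prop
  have hGa : AntitoneOn G (Ioo 0 1) := fun x hx y hy hxy =>
    NNReal.rpow_le_rpow (hg hx hy hxy) hp.le
  have hGc : ∀ x, (g x : ℝ≥0∞) ^ p = (G x : ℝ≥0∞) := fun x =>
    (ENNReal.coe_rpow_of_nonneg _ hp.le).symm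
  simp_rw [hGc]
  set I := ∫⁻ x, (G x : ℝ≥0∞) ∂μ with hI
  have hterm : ∀ k : ℕ, ∀ x : ℝ,
      ((q ^ k)⁻¹ * ((2⁻¹ : ℝ≥0∞) ^ (k + 1) * (g ((2⁻¹ : ℝ) ^ (k + 1) * x) : ℝ≥0∞))) ^ p =
        ((ρ ^ k)⁻¹ * τ ^ (k + 1)) * (G ((2⁻¹ : ℝ) ^ (k + 1) * x) : ℝ≥0∞) := by
    intro k x
    rw [ENNReal.mul_rpow_of_nonneg _ _ hp.le, ENNReal.mul_rpow_of_nonneg _ _ hp.le,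
      ENNReal.inv_rpow, hGc, ← hqp, ← hτp, ← ENNReal.rpow_natCast_mul, ← ENNReal.rpow_natCast_mul,
      ← ENNReal.rpow_mul_natCast, ← ENNReal.rpow_mul_natCast, mul_comm p, mul_comm p, mul_assoc]
  have hdil : ∀ k : ℕ, τ ^ (k + 1) * ∫⁻ x, (G ((2⁻¹ : ℝ) ^ (k + 1) * x) : ℝ≥0∞) ∂μ ≤
      (ρ * ρ) ^ (k + 1) * ENNReal.ofReal A * I := by
    intro k
    have ht0 : τ ^ (k + 1) ≠ 0 := pow_ne_zero _ hτ0
    have htt : τ ^ (k + 1) ≠ ⊤ := ENNReal.pow_ne_top ENNReal.ofReal_ne_top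
    have := lintegral_comp_mul_le_of_antitoneOn hμ hGm hGa (c := (2⁻¹ : ℝ) ^ (k + 1))
      (D := (τ ^ (k + 1))⁻¹ * ((ρ * ρ) ^ (k + 1) * ENNReal.ofReal A))
      (by positivity) (pow_le_one₀ (by norm_num) (by norm_num)) (fun a ha => by
        have hm := measure_Ioc_pow_two_mul_le hμ hp hA h (k + 1) ha
        rw [← hr, hρρ, ← hτ] at hm
        rw [inv_pow, inv_inv, mul_assoc, ← ENNReal.div_eq_inv_mul,
          ENNReal.le_div_iff_mul_le (Or.inl ht0) (Or.inl htt), mul_comm, mul_assoc]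
        exact hm)
    calc _ ≤ τ ^ (k + 1) * ((τ ^ (k + 1))⁻¹ * ((ρ * ρ) ^ (k + 1) * ENNReal.ofReal A) * I) := by
          gcongr
      _ = _ := by rw [← mul_assoc, ← mul_assoc, ENNReal.mul_inv_cancel ht0 htt, one_mul]
  calc ∫⁻ x, ((∫⁻ s in Ioc 0 x, (g s : ℝ≥0∞)) / ENNReal.ofReal x) ^ p ∂μ
      ≤ ∫⁻ x, ((1 - q)⁻¹) ^ p * ∑' k : ℕ,
          ((ρ ^ k)⁻¹ * τ ^ (k + 1)) * (G ((2⁻¹ : ℝ) ^ (k + 1) * x) : ℝ≥0∞) ∂μ := by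
        refine lintegral_mono_ae ?_
        filter_upwards [hμ] with x hx
        simp_rw [← hterm]
        exact (ENNReal.rpow_le_rpow (average_le_tsum_of_antitoneOn hg hx) hp.le).trans
          (ENNReal.rpow_tsum_le_tsum_rpow _ hq0 hq1 hp)
    _ = ((1 - q)⁻¹) ^ p * ∑' k : ℕ,
          ((ρ ^ k)⁻¹ * (τ ^ (k + 1) * ∫⁻ x, (G ((2⁻¹ : ℝ) ^ (k + 1) * x) : ℝ≥0∞) ∂μ)) := by
        rw [lintegral_const_mul _ (by fun_prop), lintegral_tsum (fun k => by fun_prop)]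
        congr 2
        funext k
        rw [lintegral_const_mul _ (by fun_prop), mul_assoc]
    _ ≤ ((1 - q)⁻¹) ^ p * ∑' k : ℕ, ρ ^ k * (ENNReal.ofReal A * I) := by
        refine mul_le_mul_right (ENNReal.tsum_le_tsum fun k => ?_) _
        have hk0 : ρ ^ k ≠ 0 := pow_ne_zero _ hρ0
        have hkt : ρ ^ k ≠ ⊤ := ENNReal.pow_ne_top hρ1.ne_top
        calc _ ≤ (ρ ^ k)⁻¹ * ((ρ * ρ) ^ (k + 1) * ENNReal.ofReal A * I) := by
              exact mul_le_mul_right (hdil k) _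
          _ = ((ρ ^ k)⁻¹ * ρ ^ k) * (ρ ^ k * (ρ * ρ)) * (ENNReal.ofReal A * I) := by ring
          _ ≤ 1 * (ρ ^ k * (1 * 1)) * (ENNReal.ofReal A * I) := by
              rw [ENNReal.inv_mul_cancel hk0 hkt]; gcongr
          _ = _ := by ring
    _ = _ := by rw [ENNReal.tsum_mul_right, ENNReal.tsum_geometric]; ring

theorem exists_setLIntegral_average_rpow_le {p C : ℝ} (hp : 0 < p) (hC : 0 < C) :
    ∃ K : ℝ≥0∞, K ≠ ⊤ ∧ ∀ w : ℝ → ℝ≥0, Measurable w →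
      (∀ a ∈ Icc (0 : ℝ) 1, ∫⁻ t in Ioc a 1, ENNReal.ofReal ((a / t) ^ p) * (w t : ℝ≥0∞) ≤
        ENNReal.ofReal C * ∫⁻ t in Ioc 0 a, (w t : ℝ≥0∞)) →
      ∀ g : ℝ → ℝ≥0, Measurable g → AntitoneOn g (Ioo 0 1) →
        ∫⁻ x in Ioo 0 1, (w x : ℝ≥0∞) *
            ((∫⁻ s in Ioc 0 x, (g s : ℝ≥0∞)) / ENNReal.ofReal x) ^ p ≤
          K * ∫⁻ x in Ioo 0 1, (w x : ℝ≥0∞) * (g x : ℝ≥0∞) ^ p := by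
  obtain ⟨K, hK, hmain⟩ := exists_lintegral_average_rpow_le hp (A := 1 + C) (by linarith)
  refine ⟨K, hK, fun w hw hcond g hgm hg => ?_⟩
  have hwm : Measurable fun t => (w t : ℝ≥0∞) := by fun_prop
  set μ : Measure ℝ := (volume.restrict (Ioo 0 1)).withDensity fun t => (w t : ℝ≥0∞) with hμ
  have hlin : ∀ f : ℝ → ℝ≥0∞, ∫⁻ x, f x ∂μ = ∫⁻ x in Ioo 0 1, (w x : ℝ≥0∞) * f x := fun f =>
    lintegral_withDensity_eq_lintegral_mul_non_measurable _ hwm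
      (Filter.Eventually.of_forall fun x => ENNReal.coe_lt_top) f
  have hac : μ ≪ volume.restrict (Ioo 0 1) := withDensity_absolutelyContinuous _ _
  have hae : ∀ᵐ t ∂μ, t ∈ Ioo (0 : ℝ) 1 := hac.ae_le (ae_restrict_mem measurableSet_Ioo)
  have : NullSingletonClass μ := ⟨fun x => hac (measure_singleton x)⟩
  have := hmain μ hae (fun a ha => ?_) g hgm hg
  · simpa only [hlin] using this
  have hvol : (volume : Measure ℝ).restrict (Ioo 0 1) = volume.restrict (Ioc 0 1) :=
    Measure.restrict_congr_set Ioo_ae_eq_Ioc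
  have hap : 0 < a ^ (-p) := Real.rpow_pos_of_pos ha _
  rw [ENNReal.ofReal_add zero_le_one hC.le, ENNReal.ofReal_one]
  rcases le_or_gt a 1 with ha1 | ha1
  · have hWa : μ (Ioc 0 a) = ∫⁻ t in Ioc 0 a, (w t : ℝ≥0∞) := by
      rw [hμ, hvol, withDensity_apply _ measurableSet_Ioc, Measure.restrict_restrict measurableSet_Ioc,
        inter_eq_self_of_subset_left (Ioc_subset_Ioc_right ha1)]
    rw [truncatedMoment, hlin, hvol, ← Ioc_union_Ioc_eq_Ioc ha.le ha1, hWa, add_mul, one_mul]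
    refine (lintegral_union_le _ _ _).trans (add_le_add ?_ ?_)
    · rw [← lintegral_const_mul _ hwm]
      refine lintegral_mono fun t => ?_
      rw [mul_comm]
      gcongr
      exact min_le_left _ _
    · rw [mul_left_comm]
      refine le_trans ?_ (mul_le_mul_right (hcond a ⟨ha.le, ha1⟩) _)
      rw [← lintegral_const_mul _ (by fun_prop)]
      refine setLIntegral_mono (by fun_prop) fun t ht => ?_
      have ht0 : 0 < t := ha.trans ht.1
      rw [← mul_assoc, ← ENNReal.ofReal_mul hap.le, mul_comm]
      gcongr
      refine (min_le_right _ _).trans_eq ?_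
      rw [Real.div_rpow ha.le ht0.le, Real.rpow_neg ha.le, Real.rpow_neg ht0.le]
      have := (Real.rpow_pos_of_pos ha p).ne'
      field_simp
  · have hle : truncatedMoment μ p a ≤ ENNReal.ofReal (a ^ (-p)) * μ (Ioc 0 a) := by
      have huniv : μ (Ioc 0 a) = μ univ := measure_congr (by
        filter_upwards [hae] with t ht
        exact propext ⟨fun _ => trivial, fun _ => ⟨ht.1, ht.2.le.trans ha1.le⟩⟩)
      rw [huniv, ← lintegral_const]
      exact lintegral_mono fun t => ENNReal.ofReal_le_ofReal (min_le_left _ _)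
    exact hle.trans (le_mul_of_one_le_left' (le_add_of_nonneg_right zero_le))

theorem setLIntegral_Ioi_zero_eq_tsum (F : ℝ → ℝ≥0∞) :
    ∫⁻ x in Ioi (0 : ℝ), F x = ∑' n : ℕ, ∫⁻ t in Ioo (0 : ℝ) 1, F ((n : ℝ) + t) := by
  have hU : Ioi (0 : ℝ) = ⋃ n : ℕ, Ioc (n : ℝ) (n + 1) := by
    ext x
    simp only [mem_Ioi, mem_iUnion, mem_Ioc]
    refine ⟨fun hx => ?_, fun ⟨n, hn, _⟩ => (Nat.cast_nonneg n).trans_lt hn⟩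
    obtain ⟨n, hn⟩ := Nat.exists_eq_succ_of_ne_zero (Nat.ceil_pos.2 hx).ne'
    refine ⟨n, Nat.lt_ceil.1 (by omega), ?_⟩
    have := Nat.le_ceil x
    rw [hn] at this
    exact_mod_cast this
  have hdisj : Pairwise (Function.onFun Disjoint fun n : ℕ => Ioc (n : ℝ) (n + 1)) := by
    intro m n hmn
    have := pairwise_disjoint_Ioc_intCast ℝ (Nat.cast_injective.ne hmn : (m : ℤ) ≠ n)
    simpa [Function.onFun] using this
  rw [hU, lintegral_iUnion (fun _ => measurableSet_Ioc) hdisj]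
  congr 1
  funext n
  rw [← (measurePreserving_add_left volume (n : ℝ)).setLIntegral_comp_preimage_emb
      (measurableEmbedding_addLeft _), Measure.restrict_congr_set Ioo_ae_eq_Ioc]
  simp

theorem Sblack_natCast_add (f : ℝ → ℝ≥0) (n : ℕ) {t : ℝ} (ht : t ∈ Ioo (0 : ℝ) 1) :
    Sblack f (n + t) =
      (∫⁻ s in Ioc 0 t, (f (n + s) : ℝ≥0∞)) / ENNReal.ofReal t := by
  have hfl : ⌊(n : ℝ) + t⌋ = n := by
    rw [Int.floor_eq_iff]
    constructor <;> push_cast <;> linarith [ht.1, ht.2]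
  have hshift := (measurePreserving_add_left volume (n : ℝ)).setLIntegral_comp_preimage_emb
    (measurableEmbedding_addLeft _) (fun s => (f s : ℝ≥0∞)) (Ioc (n : ℝ) (n + t))
  rw [Sblack, hfl, Int.cast_natCast, add_sub_cancel_left, ← hshift]
  simp

/-- `S_◁` is bounded in `L^p(u)` on functions decreasing on each interval
`(n,n+1)` if and only if for every sequence `(a_n) ⊆ [0,1]`,
`∑_n ∫_{a_n}^1 (a_n/t)^p u(n+t) dt ≤ C ∑_n ∫_0^{a_n} u(n+t) dt`. -/
theorem stmt6 (u : ℝ → ℝ≥0) (hu : Measurable u)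
    (hloc : MeasureTheory.LocallyIntegrableOn (fun t => (u t : ℝ)) (Set.Ioi 0))
    (p : ℝ) (hp : 0 < p) :
    (∃ C : ℝ, 0 < C ∧ ∀ f : ℝ → ℝ≥0, Measurable f →
        (∀ n : ℕ, ∀ x y : ℝ, (n : ℝ) < x → x ≤ y → y < (n : ℝ) + 1 → f y ≤ f x) →
        ∫⁻ x in Set.Ioi (0 : ℝ), Sblack f x ^ p * (u x : ℝ≥0∞) ≤
          ENNReal.ofReal C * ∫⁻ x in Set.Ioi (0 : ℝ), (f x : ℝ≥0∞) ^ p * (u x : ℝ≥0∞)) ↔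
      (∃ C : ℝ, 0 < C ∧ ∀ a : ℕ → ℝ, (∀ n, a n ∈ Set.Icc (0 : ℝ) 1) →
        ∑' n : ℕ, ∫⁻ t in Set.Ioc (a n) 1,
            ENNReal.ofReal ((a n / t) ^ p) * (u ((n : ℝ) + t) : ℝ≥0∞) ≤
          ENNReal.ofReal C *
            ∑' n : ℕ, ∫⁻ t in Set.Ioc (0 : ℝ) (a n), (u ((n : ℝ) + t) : ℝ≥0∞)) := by
  constructor
  · rintro ⟨C, hC, h⟩
    refine ⟨C, hC, fun a ha => ?_⟩
    set f : ℝ → ℝ≥0 := {x | Int.fract x ≤ a ⌊x⌋₊}.indicator 1 with hf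
    have hfm : Measurable f := measurable_one.indicator
      (measurableSet_le measurable_fract ((measurable_of_countable a).comp Nat.measurable_floor))
    have hfn : ∀ n : ℕ, ∀ t ∈ Ioo (0 : ℝ) 1,
        f (n + t) = (Ioc 0 (a n)).indicator 1 t := by
      intro n t ht
      have hfr : Int.fract ((n : ℝ) + t) = t := by
        rw [Int.fract_natCast_add, Int.fract_eq_self.2 ⟨ht.1.le, ht.2⟩]
      have hfl : ⌊(n : ℝ) + t⌋₊ = n := by
        rw [Nat.floor_eq_iff (by have := ht.1; positivity)]
        constructor <;> linarith [ht.1, ht.2]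
      simp [hf, indicator_apply, hfr, hfl, ht.1]
    have hmono : ∀ n : ℕ, ∀ x y : ℝ, (n : ℝ) < x → x ≤ y → y < (n : ℝ) + 1 → f y ≤ f x := by
      intro n x y hx hxy hy
      obtain ⟨s, rfl⟩ : ∃ s, x = n + s := ⟨x - n, by ring⟩
      obtain ⟨t, rfl⟩ : ∃ t, y = n + t := ⟨y - n, by ring⟩
      rw [hfn n s ⟨by linarith, by linarith⟩, hfn n t ⟨by linarith, by linarith⟩]
      simp only [indicator_apply, mem_Ioc, Pi.one_apply]
      split_ifs with h1 h2
      · exact le_rfl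
      · exact absurd ⟨by linarith, by linarith⟩ h2
      all_goals exact zero_le
    have hmain := h f hfm hmono
    rw [setLIntegral_Ioi_zero_eq_tsum, setLIntegral_Ioi_zero_eq_tsum] at hmain
    refine le_trans (ENNReal.tsum_le_tsum fun n => ?_) (hmain.trans
      (mul_le_mul_right (ENNReal.tsum_le_tsum fun n => ?_) _))
    · rw [← Measure.restrict_congr_set Ioo_ae_eq_Ioc]
      refine le_trans (setLIntegral_mono' measurableSet_Ioo fun t ht => ?_)
        (lintegral_mono_set (Ioo_subset_Ioo_left (ha n).1))
      have ht0 : 0 < t := (ha n).1.trans_lt ht.1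
      rw [Sblack_natCast_add f n ⟨ht0, ht.2⟩,
        ← ENNReal.ofReal_rpow_of_nonneg (div_nonneg (ha n).1 ht0.le) hp.le,
        ENNReal.ofReal_div_of_pos ht0]
      gcongr
      calc ENNReal.ofReal (a n) = ∫⁻ _ in Ioc 0 (a n), (1 : ℝ≥0∞) := by simp
        _ = ∫⁻ s in Ioc 0 (a n), (f (n + s) : ℝ≥0∞) := by
            refine setLIntegral_congr_fun measurableSet_Ioc fun s hs => ?_
            rw [hfn n s ⟨hs.1, (hs.2.trans_lt ht.1).trans ht.2⟩, indicator_of_mem hs]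
            simp
        _ ≤ _ := lintegral_mono_set (Ioc_subset_Ioc_right ht.1.le)
    · calc ∫⁻ t in Ioo 0 1, (f (n + t) : ℝ≥0∞) ^ p * (u (n + t) : ℝ≥0∞)
          ≤ ∫⁻ t in Ioo 0 1, (Ioc 0 (a n)).indicator (fun t => (u (n + t) : ℝ≥0∞)) t := by
            refine setLIntegral_mono' measurableSet_Ioo fun t ht => ?_
            rw [hfn n t ht]
            by_cases hta : t ∈ Ioc 0 (a n) <;> simp [hta, hp]
        _ ≤ _ := (setLIntegral_le_lintegral _ _).trans_eq
            (lintegral_indicator measurableSet_Ioc _)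
  · rintro ⟨C, hC, h⟩
    obtain ⟨K, hK, hmain⟩ := exists_setLIntegral_average_rpow_le hp hC
    refine ⟨K.toReal + 1, by positivity, fun f hfm hf => ?_⟩
    have hKle : K ≤ ENNReal.ofReal (K.toReal + 1) := by
      rw [← ENNReal.ofReal_toReal hK]
      exact ENNReal.ofReal_le_ofReal (by simp)
    refine le_trans ?_ (mul_le_mul_left hKle _)
    rw [setLIntegral_Ioi_zero_eq_tsum, setLIntegral_Ioi_zero_eq_tsum, ← ENNReal.tsum_mul_left]
    refine ENNReal.tsum_le_tsum fun n => ?_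
    have hn := hmain (fun t => u (n + t)) (hu.comp (measurable_const_add _)) (fun a ha => ?_)
      (fun t => f (n + t)) (hfm.comp (measurable_const_add _)) (fun s hs t ht hst =>
        hf n _ _ (by linarith [hs.1]) (by linarith) (by linarith [ht.2]))
    · simp_rw [mul_comm (_ ^ p)]
      refine le_trans (le_of_eq ?_) hn
      refine setLIntegral_congr_fun measurableSet_Ioo fun t ht => ?_
      simp only [Sblack_natCast_add f n ht]
    · have hsingle := h (Pi.single n a) (fun m => by
        rcases eq_or_ne m n with rfl | hmn
        · simpa using ha
        · simp [hmn])
      rw [tsum_eq_single n (fun m hm => by simp [hm, Real.zero_rpow hp.ne']),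
        tsum_eq_single n (fun m hm => by simp [hm])] at hsingle
      simpa using hsingle
end
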